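/- Let Ω ⊂ ℂ be a bounded domain with boundary of class C^{1+ε}, 0 < ε < 1, let 0 < ε' < ε and let n ≥ 1 be an integer. For g ∈ Lip(ε',Ω), define B_Ω(g)(z) = −(1/π) lim_{δ→0+} ∫_{w∈Ω, |w−z|>δ} g(w)(z−w)^{−2} dA(w) for z ∈ Ω (this principal value exists and B_Ω(g) ∈ Lip(ε',Ω)), let B_Ω^n denote the n-th iterate of B_Ω, and define T_n(g)(z) = lim_{δ→0+} ∫_{w∈Ω, |w−z|>δ} b_n(z−w) g(w) dA(w) for z ∈ Ω, where b_n(z) = ((−1)^n n/π) conj(z)^{n−1} z^{−(n+1)}. Then the operator K_n = B_Ω^n − T_n is compact from Lip(ε',Ω) into itself: K_n is linear, there is a constant M with ‖K_n(g)‖_{ε',Ω} ≤ M ‖g‖_{ε',Ω}, and for every sequence (g_k) with ‖g_k‖_{ε',Ω} ≤ 1 there is a subsequence such that K_n(g_{k_j}) converges in the norm ‖·‖_{ε',Ω}. -/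

import Mathlib

open MeasureTheory Metric Set Filter Topology
open scoped ENNReal NNReal

noncomputable section

/-- `Ω ⊆ ℂ` has boundary of class `C^{1+ε}`: near each boundary point, after a rotation of
coordinates, `Ω` is the subgraph of a `C^1` function whose derivative is `ε`-Hölder. -/
def HasC1HolderBoundaryC (ε : ℝ) (Ω : Set ℂ) : Prop :=
  ∀ a ∈ frontier Ω, ∃ r > 0, ∃ e : ℂ, ‖e‖ = 1 ∧ ∃ φ : ℝ → ℝ,
    ContDiff ℝ 1 φ ∧
    (∃ c : ℝ≥0, HolderOnWith c ε.toNNReal (deriv φ) univ) ∧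
    Ω ∩ ball a r = {z ∈ ball a r | (e * z).im < φ ((e * z).re)}

/-- The Hölder norm `‖g‖_{ε',Ω} = sup_Ω |g| + σ_{ε'}(g)`, valued in `ℝ≥0∞`. -/
def holderNorm {X : Type*} [NormedAddCommGroup X] (α : ℝ) (Ω : Set X) (f : X → ℂ) : ℝ≥0∞ :=
  (⨆ x : Ω, (‖f x.1‖₊ : ℝ≥0∞)) +
    ⨆ p : Ω × Ω, ENNReal.ofReal (‖f p.1.1 - f p.2.1‖ / ‖p.1.1 - p.2.1‖ ^ α)

/-- `b_n(z) = ((−1)^n n/π) conj(z)^{n−1} z^{−(n+1)}`, the kernel of the n-th power of the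
Beurling transform. -/
def bnKer (n : ℕ) (z : ℂ) : ℂ :=
  ((-1 : ℂ) ^ n * n / Real.pi) * (starRingEnd ℂ) z ^ (n - 1) / z ^ (n + 1)

/-- The truncated Beurling integral of `g` over `Ω` at level `δ`. -/
def beurlingTrunc (Ω : Set ℂ) (g : ℂ → ℂ) (z : ℂ) (δ : ℝ) : ℂ :=
  (-(1 / Real.pi) : ℂ) * ∫ w in {w ∈ Ω | δ < dist w z}, g w / (z - w) ^ 2

/-- `B_Ω(g)(z)`, the principal value Beurling transform of `g χ_Ω` cut to `Ω`. -/
def BOm (Ω : Set ℂ) (g : ℂ → ℂ) : ℂ → ℂ := fun z =>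
  limUnder (𝓝[>] (0 : ℝ)) (beurlingTrunc Ω g z)

/-- The truncated integral against the kernel `b_n` of `g` over `Ω` at level `δ`. -/
def bnTrunc (Ω : Set ℂ) (n : ℕ) (g : ℂ → ℂ) (z : ℂ) (δ : ℝ) : ℂ :=
  ∫ w in {w ∈ Ω | δ < dist w z}, bnKer n (z - w) * g w

/-- `T_n(g)(z)`, the principal value integral of `g χ_Ω` against `b_n`. -/
def TnOp (Ω : Set ℂ) (n : ℕ) (g : ℂ → ℂ) : ℂ → ℂ := fun z =>
  limUnder (𝓝[>] (0 : ℝ)) (bnTrunc Ω n g z)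

/-- `K_n = B_Ω^n − T_n`. -/
def KnOp (Ω : Set ℂ) (n : ℕ) (g : ℂ → ℂ) : ℂ → ℂ :=
  (BOm Ω)^[n] g - TnOp Ω n g


/-! ### Radial integrals in the plane -/

lemma cx_radial_integrable {f : ℝ → ℝ} (hf : IntegrableOn (fun y => y * f y) (Ioi 0)) (z : ℂ) :
    Integrable (fun w : ℂ => f ‖z - w‖) := by
  have h : Integrable (fun w : ℂ => f ‖w‖) := by
    rw [integrable_fun_norm_addHaar (volume : Measure ℂ)]
    simpa using hf
  exact h.comp_sub_left z

lemma cx_radial_integral (f : ℝ → ℝ) (z : ℂ) :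
    ∫ w : ℂ, f ‖z - w‖ = 2 * Real.pi * ∫ y in Ioi (0 : ℝ), y * f y := by
  have h := integral_fun_norm_addHaar (volume : Measure ℂ) f
  rw [integral_sub_left_eq_self (fun w : ℂ => f ‖w‖) volume z, h]
  simp [Measure.real, Complex.volume_ball]
  ring

lemma cx_ball_mem (z w : ℂ) (r : ℝ) : w ∈ ball z r ↔ ‖z - w‖ ∈ Iio r := by
  rw [mem_ball, dist_comm, dist_eq_norm, mem_Iio]

lemma cx_ind_ball (z : ℂ) (r : ℝ) (g : ℝ → ℝ) :
    (ball z r).indicator (fun w => g ‖z - w‖) = fun w => (Iio r).indicator g ‖z - w‖ := by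
  ext w
  by_cases h : w ∈ ball z r
  · rw [indicator_of_mem h, indicator_of_mem ((cx_ball_mem z w r).1 h)]
  · rw [indicator_of_notMem h, indicator_of_notMem (fun h' => h ((cx_ball_mem z w r).2 h'))]

lemma cx_ind_cball (z : ℂ) (r : ℝ) (g : ℝ → ℝ) :
    (ball z r)ᶜ.indicator (fun w => g ‖z - w‖) = fun w => (Ici r).indicator g ‖z - w‖ := by
  ext w
  have : w ∈ (ball z r)ᶜ ↔ ‖z - w‖ ∈ Ici r := by
    rw [mem_compl_iff, cx_ball_mem]; simp
  by_cases h : w ∈ (ball z r)ᶜ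
  · rw [indicator_of_mem h, indicator_of_mem (this.1 h)]
  · rw [indicator_of_notMem h, indicator_of_notMem (fun h' => h (this.2 h'))]

lemma ball_pow_integrable {s : ℝ} (hs : 0 < s) (z : ℂ) (r : ℝ) :
    IntegrableOn (fun w : ℂ => ‖z - w‖ ^ (s - 2)) (ball z r) := by
  rw [← integrable_indicator_iff measurableSet_ball, cx_ind_ball z r (fun y => y ^ (s - 2))]
  apply cx_radial_integrable
  rcases le_or_gt r 0 with hr | hr
  · refine IntegrableOn.congr_fun (f := fun _ => 0) integrableOn_zero ?_ measurableSet_Ioi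
    intro y hy
    have : y ∉ Iio r := by simp at hy ⊢; linarith
    simp [this]
  have h0 : IntegrableOn (fun y : ℝ => y ^ (s - 1)) (Ioo 0 r) := by
    have := intervalIntegral.intervalIntegrable_rpow' (a := 0) (b := r) (r := s - 1) (by linarith)
    rw [intervalIntegrable_iff_integrableOn_Ioo_of_le hr.le] at this
    exact this
  rw [← integrable_indicator_iff measurableSet_Ioo] at h0
  rw [← integrable_indicator_iff measurableSet_Ioi]
  refine h0.congr (ae_of_all _ fun y => ?_)
  by_cases hy : 0 < y
  · by_cases hy2 : y < r
    · simp [indicator, hy, hy2, ]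
      rw [show s - 1 = 1 + (s - 2) by ring, Real.rpow_add hy, Real.rpow_one]
    · simp [indicator, hy2]
  · simp [indicator, hy]

lemma ball_pow_integral {s : ℝ} (hs : 0 < s) (z : ℂ) {r : ℝ} (hr : 0 ≤ r) :
    ∫ w in ball z r, ‖z - w‖ ^ (s - 2) = 2 * Real.pi / s * r ^ s := by
  rw [← integral_indicator measurableSet_ball, cx_ind_ball z r (fun y => y ^ (s - 2)),
    cx_radial_integral, ← integral_indicator measurableSet_Ioi]
  have : ∫ y, (Ioi (0:ℝ)).indicator (fun y => y * (Iio r).indicator (fun y => y ^ (s - 2)) y) y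
      = ∫ y in (0:ℝ)..r, y ^ (s - 1) := by
    rw [intervalIntegral.integral_of_le hr, integral_Ioc_eq_integral_Ioo,
      ← integral_indicator measurableSet_Ioo]
    congr 1
    ext y
    by_cases hy : 0 < y
    · by_cases hy2 : y < r
      · simp [indicator, hy, hy2, ]
        rw [show s - 1 = 1 + (s - 2) by ring, Real.rpow_add hy, Real.rpow_one]
      · simp [indicator, hy2]
    · simp [indicator, hy]
  rw [this, integral_rpow (Or.inl (by linarith))]
  have : (0:ℝ) ^ (s - 1 + 1) = 0 := Real.zero_rpow (by linarith)
  rw [this]; simp; ring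

lemma compl_pow_integrable {s : ℝ} (hs : 0 < s) (z : ℂ) {r : ℝ} (hr : 0 < r) :
    IntegrableOn (fun w : ℂ => ‖z - w‖ ^ (-2 - s)) (ball z r)ᶜ := by
  rw [← integrable_indicator_iff measurableSet_ball.compl,
    cx_ind_cball z r (fun y => y ^ (-2 - s))]
  apply cx_radial_integrable
  have h0 : IntegrableOn (fun y : ℝ => y ^ (-1 - s)) (Ici r) := by
    rw [integrableOn_Ici_iff_integrableOn_Ioi]
    exact integrableOn_Ioi_rpow_of_lt (by linarith) hr
  rw [← integrable_indicator_iff measurableSet_Ici] at h0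
  rw [← integrable_indicator_iff measurableSet_Ioi]
  refine h0.congr (ae_of_all _ fun y => ?_)
  by_cases hy : r ≤ y
  · have h1 : 0 < y := by linarith
    simp [indicator, hy, h1]
    rw [show -1 - s = 1 + (-2 - s) by ring, Real.rpow_add h1, Real.rpow_one]
  · simp [indicator, hy]

lemma compl_pow_integral {s : ℝ} (hs : 0 < s) (z : ℂ) {r : ℝ} (hr : 0 < r) :
    ∫ w in (ball z r)ᶜ, ‖z - w‖ ^ (-2 - s) = 2 * Real.pi / s * r ^ (-s) := by
  rw [← integral_indicator measurableSet_ball.compl, cx_ind_cball z r (fun y => y ^ (-2 - s)),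
    cx_radial_integral, ← integral_indicator measurableSet_Ioi]
  have : ∫ y, (Ioi (0:ℝ)).indicator (fun y => y * (Ici r).indicator (fun y => y ^ (-2 - s)) y) y
      = ∫ y in Ioi r, y ^ (-1 - s) := by
    rw [← integral_Ici_eq_integral_Ioi,
      ← integral_indicator measurableSet_Ici]
    congr 1
    ext y
    by_cases hy : r ≤ y
    · have h1 : 0 < y := by linarith
      simp [indicator, hy, h1]
      rw [show -1 - s = 1 + (-2 - s) by ring, Real.rpow_add h1, Real.rpow_one]
    · simp [indicator, hy]
  rw [this, integral_Ioi_rpow_of_lt (by linarith) hr]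
  rw [show -1 - s + 1 = -s by ring]
  field_simp

/-- Uniform bound of Riesz potentials of bounded sets. -/
lemma riesz_integrable {s : ℝ} (hs : 0 < s) (hs2 : s ≤ 2) {Ω : Set ℂ} (hm : MeasurableSet Ω)
    (hv : volume Ω ≠ ⊤) (z : ℂ) :
    IntegrableOn (fun w : ℂ => ‖z - w‖ ^ (s - 2)) Ω := by
  have h1 : IntegrableOn (fun w : ℂ => ‖z - w‖ ^ (s - 2)) (Ω \ ball z 1) := by
    refine Integrable.mono' (g := fun _ => 1) ?_ ?_ ?_
    · exact integrableOn_const (ne_top_of_le_ne_top hv (measure_mono sdiff_subset))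
    · exact (Measurable.aestronglyMeasurable (by fun_prop))
    · refine (ae_restrict_iff' (hm.diff measurableSet_ball)).2 (ae_of_all _ fun w hw => ?_)
      have : 1 ≤ ‖z - w‖ := by
        have := hw.2; rw [cx_ball_mem] at this; simpa using this
      rw [Real.norm_of_nonneg (by positivity)]
      exact Real.rpow_le_one_of_one_le_of_nonpos this (by linarith)
  exact (h1.union (ball_pow_integrable hs z 1)).mono_set (by intro w hw; by_cases h : w ∈ ball z 1 <;> simp [h, hw] )

lemma riesz_bound {s : ℝ} (hs : 0 < s) (hs2 : s ≤ 2) {Ω : Set ℂ} (hm : MeasurableSet Ω)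
    (hv : volume Ω ≠ ⊤) (z : ℂ) :
    ∫ w in Ω, ‖z - w‖ ^ (s - 2) ≤ 2 * Real.pi / s + volume.real Ω := by
  have hi := riesz_integrable hs hs2 hm hv z
  rw [← integral_inter_add_sdiff measurableSet_ball hi (t := ball z 1)]
  gcongr
  · calc _ ≤ ∫ w in ball z 1, ‖z - w‖ ^ (s - 2) := by
          apply setIntegral_mono_set (ball_pow_integrable hs z 1)
          · exact ae_of_all _ fun w => by positivity
          · exact inter_subset_right.eventuallyLE
      _ = _ := by rw [ball_pow_integral hs z zero_le_one]; simp
  · calc _ ≤ ∫ w in Ω \ ball z 1, (1:ℝ) := by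
          refine setIntegral_mono_on (hi.mono_set sdiff_subset) ?_ (hm.diff measurableSet_ball) ?_
          · exact integrableOn_const (ne_top_of_le_ne_top hv (measure_mono sdiff_subset))
          · intro w hw
            have : 1 ≤ ‖z - w‖ := by
              have := hw.2; rw [cx_ball_mem] at this; simpa using this
            exact Real.rpow_le_one_of_one_le_of_nonpos this (by linarith)
      _ ≤ _ := by
          simp only [integral_const, smul_eq_mul, mul_one, measureReal_restrict_apply_univ]
          exact measureReal_mono sdiff_subset hv

/-! ### Rotations -/

lemma integral_rot_eq {E : Type*} [NormedAddCommGroup E] [NormedSpace ℝ E] (ω : ℂ) (hω : ‖ω‖ = 1)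
    (f : ℂ → E) : ∫ u, f (ω * u) = ∫ u, f u := by
  let a : Circle := ⟨ω, by simp [Submonoid.unitSphere, hω]⟩
  have h := (rotation a).measurePreserving.integral_comp
    (rotation a).toHomeomorph.measurableEmbedding f
  exact h

lemma integral_zero_of_rot {f : ℂ → ℂ} {ω : ℂ} (hω : ‖ω‖ = 1) (hf : ∀ u, f (ω * u) = - f u)
    : ∫ u, f u = 0 := by
  have h := integral_rot_eq ω hω f
  simp only [hf, integral_neg] at h
  have : (2:ℂ) * ∫ u, f u = 0 := by linear_combination -h
  simpa using this

lemma ball_integral_zero_of_rot {f : ℂ → ℂ} {ω : ℂ} (hω : ‖ω‖ = 1)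
    (hf : ∀ u, f (ω * u) = - f u) (r : ℝ) : ∫ u in ball 0 r, f u = 0 := by
  rw [← integral_indicator measurableSet_ball]
  apply integral_zero_of_rot hω
  intro u
  by_cases h : u ∈ ball (0:ℂ) r
  · have h2 : ω * u ∈ ball (0:ℂ) r := by simpa [hω] using h
    simp only [indicator_of_mem h, indicator_of_mem h2, hf]
  · have h2 : ω * u ∉ ball (0:ℂ) r := by simpa [hω] using h
    simp only [indicator_of_notMem h, indicator_of_notMem h2, neg_zero]

lemma ball_integral_zero_of_rot' {f : ℂ → ℂ} {ω : ℂ} (hω : ‖ω‖ = 1)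
    (hf : ∀ u, f (ω * u) = - f u) (z : ℂ) (r : ℝ) : ∫ w in ball z r, f (z - w) = 0 := by
  rw [← ball_integral_zero_of_rot hω hf r, ← integral_indicator measurableSet_ball,
    ← integral_indicator measurableSet_ball,
    ← integral_sub_left_eq_self (fun w : ℂ => (ball 0 r).indicator f w) volume z]
  congr 1
  ext w
  have : w ∈ ball z r ↔ z - w ∈ ball (0:ℂ) r := by rw [cx_ball_mem]; simp
  by_cases h : w ∈ ball z r
  · rw [indicator_of_mem h, indicator_of_mem (this.1 h)]
  · rw [indicator_of_notMem h, indicator_of_notMem (fun h' => h (this.2 h'))]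

/-- The rotation that changes the sign of the kernel `b_k`. -/
def rotU (k : ℕ) : ℂ := Complex.exp ((Real.pi / (2 * k) : ℝ) * Complex.I)

lemma rotU_norm (k : ℕ) : ‖rotU k‖ = 1 := Complex.norm_exp_ofReal_mul_I _

lemma rotU_pow {k : ℕ} (hk : 1 ≤ k) : rotU k ^ (2 * k) = -1 := by
  rw [rotU, ← Complex.exp_nat_mul, ← Complex.exp_pi_mul_I]
  congr 1
  have : (k : ℂ) ≠ 0 := by exact_mod_cast (by omega : k ≠ 0)
  push_cast
  field_simp

lemma rotU_ne (k : ℕ) : rotU k ≠ 0 := Complex.exp_ne_zero _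

lemma rotU_conj (k : ℕ) : (starRingEnd ℂ) (rotU k) = (rotU k)⁻¹ := by
  rw [Complex.inv_def, Complex.normSq_eq_norm_sq, rotU_norm]; simp

lemma rotU_conj_pow {k : ℕ} (hk : 1 ≤ k) : (starRingEnd ℂ) (rotU k) ^ (2 * k) = -1 := by
  rw [rotU_conj, inv_pow, rotU_pow hk]; norm_num

/-! ### Kernels -/

/-- Measurable kernels of Calderon-Zygmund size that change sign under some rotation. -/
structure KerB (κ : ℂ → ℂ) (C : ℝ) : Prop where
  nn : 0 ≤ C
  meas : Measurable κ
  bd : ∀ u, ‖κ u‖ ≤ C / ‖u‖ ^ 2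
  rot : ∃ ω : ℂ, ‖ω‖ = 1 ∧ ∀ u, κ (ω * u) = - κ u

/-- Constant for the kernel `b_k`. -/
def BK (k : ℕ) : ℝ := 16 * (k : ℝ) ^ 2

lemma BK_nonneg (k : ℕ) : 0 ≤ BK k := by unfold BK; positivity

lemma conj_of_norm_one {ω : ℂ} (hω : ‖ω‖ = 1) : (starRingEnd ℂ) ω = ω⁻¹ := by
  rw [Complex.inv_def, Complex.normSq_eq_norm_sq, hω]; simp

lemma bn_meas (k : ℕ) : Measurable (bnKer k) := by
  unfold bnKer
  have : Measurable (starRingEnd ℂ) := Complex.continuous_conj.measurable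
  fun_prop

lemma bn_norm_eq {k : ℕ} (hk : 1 ≤ k) (u : ℂ) : ‖bnKer k u‖ = (k / Real.pi) / ‖u‖ ^ 2 := by
  unfold bnKer
  by_cases hu : u = 0
  · simp [hu]
  have : ‖u‖ ≠ 0 := by simpa using hu
  obtain ⟨m, rfl⟩ : ∃ m, k = m + 1 := ⟨k - 1, by omega⟩
  have hp : |Real.pi| = Real.pi := abs_of_pos Real.pi_pos
  simp only [norm_div, norm_mul, norm_pow, norm_neg, norm_one, one_pow, one_mul, Complex.norm_natCast,
    Complex.norm_real, Real.norm_eq_abs, hp, Complex.norm_conj, add_tsub_cancel_right]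
  field_simp
  ring

lemma bn_bd {k : ℕ} (hk : 1 ≤ k) (u : ℂ) : ‖bnKer k u‖ ≤ BK k / ‖u‖ ^ 2 := by
  rw [bn_norm_eq hk]
  gcongr
  have h1 : (1:ℝ) ≤ k := by exact_mod_cast hk
  have h2 : (k:ℝ) / Real.pi ≤ k := div_le_self (by positivity) (by linarith [Real.pi_gt_three])
  unfold BK
  nlinarith

lemma bn_rot {k : ℕ} (hk : 1 ≤ k) {ω : ℂ} (hω : ‖ω‖ = 1) (u : ℂ) :
    bnKer k (ω * u) = (starRingEnd ℂ) ω ^ (2 * k) * bnKer k u := by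
  unfold bnKer
  have h0 : ω ≠ 0 := by intro h; simp [h] at hω
  rw [map_mul, conj_of_norm_one hω]
  obtain ⟨m, rfl⟩ : ∃ m, k = m + 1 := ⟨k - 1, by omega⟩
  by_cases hu : u = 0
  · simp [hu]
  simp only [add_tsub_cancel_right, mul_pow, inv_pow]
  field_simp
  ring

lemma bn_ker {k : ℕ} (hk : 1 ≤ k) : KerB (bnKer k) (BK k) :=
  ⟨BK_nonneg k, bn_meas k, bn_bd hk, rotU k, rotU_norm k, fun u => by
    rw [bn_rot hk (rotU_norm k), rotU_conj_pow hk]; ring⟩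

lemma norm_pow_sub_le {x y : ℂ} (hx : ‖x‖ = 1) (hy : ‖y‖ = 1) (n : ℕ) :
    ‖x ^ n - y ^ n‖ ≤ n * ‖x - y‖ := by
  induction n with
  | zero => simp
  | succ n ih =>
    have : x ^ (n + 1) - y ^ (n + 1) = x ^ n * (x - y) + (x ^ n - y ^ n) * y := by ring
    rw [this]
    refine (norm_add_le _ _).trans ?_
    rw [norm_mul, norm_mul, norm_pow, hx, hy]
    push_cast
    simp
    linarith

lemma bn_eq_ratio {k : ℕ} (hk : 1 ≤ k) (u : ℂ) : bnKer k u =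
    ((-1 : ℂ) ^ k * k / Real.pi) * (((starRingEnd ℂ) u / u) ^ (k - 1) * (1 / u ^ 2)) := by
  unfold bnKer
  obtain ⟨m, rfl⟩ : ∃ m, k = m + 1 := ⟨k - 1, by omega⟩
  by_cases hu : u = 0
  · simp [hu]
  simp only [add_tsub_cancel_right, div_pow]
  field_simp
  ring

lemma bn_diff {k : ℕ} (hk : 1 ≤ k) {u v : ℂ} (h : ‖u - v‖ ≤ ‖u‖ / 2) :
    ‖bnKer k u - bnKer k v‖ ≤ BK k * ‖u - v‖ / ‖u‖ ^ 3 := by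
  by_cases hu : u = 0
  · have : v = 0 := by simpa [hu] using h
    simp [hu, this]
  have hu' : 0 < ‖u‖ := by simpa using hu
  have hv1 : ‖u‖ / 2 ≤ ‖v‖ := by
    have : ‖u‖ ≤ ‖u - v‖ + ‖v‖ := by simpa using norm_add_le (u - v) v
    linarith
  have hv2 : ‖v‖ ≤ 3 / 2 * ‖u‖ := by
    have : ‖v‖ ≤ ‖v - u‖ + ‖u‖ := by simpa using norm_add_le (v - u) u
    rw [norm_sub_rev] at this
    linarith
  have hv' : 0 < ‖v‖ := by linarith
  have hv : v ≠ 0 := by simpa using hv'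
  rw [bn_eq_ratio hk, bn_eq_ratio hk, ← mul_sub, norm_mul]
  set x := (starRingEnd ℂ) u / u
  set y := (starRingEnd ℂ) v / v
  have hx : ‖x‖ = 1 := by simp [x, hu]
  have hy : ‖y‖ = 1 := by simp [y, hv]
  have hxy : ‖x - y‖ ≤ 4 * ‖u - v‖ / ‖u‖ := by
    have e : x - y = ((starRingEnd ℂ) u * (v - u) + u * (starRingEnd ℂ) (u - v)) / (u * v) := by
      simp only [x, y, map_sub]; field_simp; ring
    rw [e, norm_div, norm_mul]
    calc _ ≤ (‖u‖ * ‖u - v‖ + ‖u‖ * ‖u - v‖) / (‖u‖ * ‖v‖) := by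
          gcongr
          refine (norm_add_le _ _).trans ?_
          rw [norm_mul, norm_mul, Complex.norm_conj, Complex.norm_conj, norm_sub_rev v u]
      _ = 2 * ‖u - v‖ / ‖v‖ := by field_simp; ring
      _ ≤ 2 * ‖u - v‖ / (‖u‖ / 2) := by gcongr
      _ = _ := by field_simp; ring
  have hq : ‖1 / u ^ 2 - 1 / v ^ 2‖ ≤ 10 * ‖u - v‖ / ‖u‖ ^ 3 := by
    have e : 1 / u ^ 2 - 1 / v ^ 2 = (v - u) * (v + u) / (u ^ 2 * v ^ 2) := by field_simp; ring
    rw [e, norm_div, norm_mul, norm_mul, norm_pow, norm_pow, norm_sub_rev v u]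
    calc _ ≤ ‖u - v‖ * (5 / 2 * ‖u‖) / (‖u‖ ^ 2 * (‖u‖ / 2) ^ 2) := by
          gcongr
          refine (norm_add_le _ _).trans ?_
          linarith
      _ = _ := by field_simp; ring
  have e : x ^ (k - 1) * (1 / u ^ 2) - y ^ (k - 1) * (1 / v ^ 2)
    = x ^ (k - 1) * (1 / u ^ 2 - 1 / v ^ 2) + (x ^ (k - 1) - y ^ (k - 1)) * (1 / v ^ 2) := by ring
  have h3 : ‖x ^ (k - 1) * (1 / u ^ 2) - y ^ (k - 1) * (1 / v ^ 2)‖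
      ≤ 16 * k * ‖u - v‖ / ‖u‖ ^ 3 := by
    rw [e]
    refine (norm_add_le _ _).trans ?_
    rw [norm_mul, norm_mul, norm_pow, hx, one_pow, one_mul]
    have h4 : ‖1 / v ^ 2‖ ≤ 4 / ‖u‖ ^ 2 := by
      rw [norm_div, norm_pow, norm_one]
      calc 1 / ‖v‖ ^ 2 ≤ 1 / (‖u‖ / 2) ^ 2 := by gcongr
        _ = _ := by field_simp; ring
    calc _ ≤ 10 * ‖u - v‖ / ‖u‖ ^ 3 + ((k - 1 : ℕ) * (4 * ‖u - v‖ / ‖u‖)) * (4 / ‖u‖ ^ 2) := by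
          gcongr
          exact (norm_pow_sub_le hx hy _).trans (by gcongr)
      _ = (10 + 16 * ((k : ℝ) - 1)) * (‖u - v‖ / ‖u‖ ^ 3) := by
          rw [Nat.cast_sub hk]; push_cast; field_simp; ring
      _ ≤ (16 * k) * (‖u - v‖ / ‖u‖ ^ 3) := by
          gcongr; linarith
      _ = _ := by ring
  have h5 : ‖((-1 : ℂ) ^ k * k / Real.pi)‖ ≤ k := by
    have hp : |Real.pi| = Real.pi := abs_of_pos Real.pi_pos
    simp only [norm_div, norm_mul, norm_pow, norm_neg, norm_one, one_pow, one_mul,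
      Complex.norm_natCast, Complex.norm_real, Real.norm_eq_abs, hp]
    exact div_le_self (by positivity) (by linarith [Real.pi_gt_three])
  calc _ ≤ (k:ℝ) * (16 * k * ‖u - v‖ / ‖u‖ ^ 3) := by gcongr
    _ = _ := by unfold BK; ring

/-! ### Principal values -/

/-- The regularised singular integral. -/
def Lam (κ : ℂ → ℂ) (Ω : Set ℂ) (u : ℂ → ℂ) (z : ℂ) (ρ : ℝ) : ℂ :=
  ∫ w in Ω, κ (z - w) * (u w - (ball z ρ).indicator (fun _ => u z) w)

/-- The assumptions under which the principal value exists at `z`. -/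
structure LocH (Ω : Set ℂ) (u : ℂ → ℂ) (z : ℂ) (ρ M A a : ℝ) : Prop where
  meas : MeasurableSet Ω
  vol : volume Ω ≠ ⊤
  um : AEStronglyMeasurable u (volume.restrict Ω)
  ub : ∀ w ∈ Ω, ‖u w‖ ≤ M
  rpos : 0 < ρ
  apos : 0 < a
  sub : ball z ρ ⊆ Ω
  hol : ∀ w ∈ ball z ρ, ‖u w - u z‖ ≤ A * ‖z - w‖ ^ a

lemma LocH.zmem {Ω u z ρ M A a} (h : LocH Ω u z ρ M A a) : z ∈ Ω :=
  h.sub (mem_ball_self h.rpos)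

lemma LocH.Mnn {Ω u z ρ M A a} (h : LocH Ω u z ρ M A a) : 0 ≤ M :=
  (norm_nonneg _).trans (h.ub z h.zmem)

lemma LocH.Ann {Ω u z ρ M A a} (h : LocH Ω u z ρ M A a) : 0 ≤ A := by
  have hr := h.rpos
  have h1 := h.hol (z + (ρ / 2 : ℝ)) (by simp [abs_of_pos hr]; linarith)
  have : 0 < ‖z - (z + (ρ / 2 : ℝ))‖ ^ a := by
    apply Real.rpow_pos_of_pos
    simp; linarith
  by_contra hA
  push Not at hA
  have := mul_neg_of_neg_of_pos hA this
  linarith [norm_nonneg (u (z + (ρ / 2 : ℝ)) - u z)]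

/-- the dominating function -/
def domF (C : ℝ) (z : ℂ) (ρ M A a : ℝ) (w : ℂ) : ℝ :=
  (ball z ρ).indicator (fun w => C * A * ‖z - w‖ ^ (a - 2)) w + C * M / ρ ^ 2

lemma domF_integrable {C : ℝ} {Ω u z ρ M A a} (h : LocH Ω u z ρ M A a) :
    IntegrableOn (domF C z ρ M A a) Ω := by
  refine Integrable.add ?_ (integrableOn_const h.vol)
  refine Integrable.integrableOn ?_
  rw [integrable_indicator_iff measurableSet_ball]
  exact (ball_pow_integrable h.apos z ρ).const_mul _

lemma LocH.dom {C : ℝ} {κ : ℂ → ℂ} (hκ : KerB κ C) {Ω u z ρ M A a} (h : LocH Ω u z ρ M A a)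
    {w : ℂ} (hw : w ∈ Ω) :
    ‖κ (z - w) * (u w - (ball z ρ).indicator (fun _ => u z) w)‖ ≤ domF C z ρ M A a w := by
  have hC := hκ.nn
  have hM := h.Mnn
  have hr := h.rpos
  rw [norm_mul, domF]
  by_cases hb : w ∈ ball z ρ
  · rw [indicator_of_mem hb, indicator_of_mem hb]
    have : ‖κ (z - w)‖ * ‖u w - u z‖ ≤ C * A * ‖z - w‖ ^ (a - 2) := by
      by_cases hz : z = w
      · subst hz
        have := hκ.bd 0
        simp at this
        have hA := h.Ann
        simp [this]; positivity
      have hp : 0 < ‖z - w‖ := by simpa [sub_eq_zero] using hz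
      calc _ ≤ C / ‖z - w‖ ^ 2 * (A * ‖z - w‖ ^ a) := by
            gcongr
            · exact hκ.bd _
            · exact h.hol w hb
        _ = _ := by
            rw [Real.rpow_sub hp]; norm_cast; field_simp
    have : 0 ≤ C * M / ρ ^ 2 := by positivity
    linarith
  · rw [indicator_of_notMem hb, indicator_of_notMem hb, sub_zero, zero_add]
    have hp : ρ ≤ ‖z - w‖ := by rw [cx_ball_mem] at hb; simpa using hb
    calc _ ≤ C / ‖z - w‖ ^ 2 * M := by
          gcongr
          · exact hκ.bd _
          · exact h.ub w hw
      _ ≤ C / ρ ^ 2 * M := by gcongr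
      _ = _ := by ring

lemma LocH.aesm {C : ℝ} {κ : ℂ → ℂ} (hκ : KerB κ C) {Ω u z ρ M A a} (h : LocH Ω u z ρ M A a) :
    AEStronglyMeasurable (fun w => κ (z - w) * (u w - (ball z ρ).indicator (fun _ => u z) w))
      (volume.restrict Ω) := by
  refine AEStronglyMeasurable.mul ?_ (h.um.sub ?_)
  · exact (hκ.meas.comp (by fun_prop)).aestronglyMeasurable
  · exact (measurable_const.indicator measurableSet_ball).aestronglyMeasurable

lemma LocH.integrable {C : ℝ} {κ : ℂ → ℂ} (hκ : KerB κ C) {Ω u z ρ M A a}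
    (h : LocH Ω u z ρ M A a) :
    IntegrableOn (fun w => κ (z - w) * (u w - (ball z ρ).indicator (fun _ => u z) w)) Ω :=
  Integrable.mono' (domF_integrable (C := C) h) (h.aesm hκ)
    ((ae_restrict_iff' h.meas).2 (ae_of_all _ fun _ hw => h.dom hκ hw))

/-- for bounded kernels the regularised integral is the plain integral -/
lemma LocH.bounded_eq {C B : ℝ} {κ : ℂ → ℂ} (hκ : KerB κ C) (hB : ∀ u, ‖κ u‖ ≤ B) {Ω u z ρ M A a}
    (h : LocH Ω u z ρ M A a) : ∫ w in Ω, κ (z - w) * u w = Lam κ Ω u z ρ := by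
  have hi := h.integrable hκ
  obtain ⟨ω, h1, h2⟩ := hκ.rot
  have h0 := ball_integral_zero_of_rot' h1 h2 z ρ
  have hK : IntegrableOn (fun w => κ (z - w)) (ball z ρ) := by
    refine Integrable.mono' (g := fun _ => B) (integrableOn_const (by finiteness)) ?_ ?_
    · exact (hκ.meas.comp (by fun_prop)).aestronglyMeasurable
    · exact ae_of_all _ fun w => hB _
  have h3 : IntegrableOn (fun w => (ball z ρ).indicator (fun w => κ (z - w)) w * u z) Ω := by
    refine Integrable.mul_const ?_ _
    exact ((integrable_indicator_iff measurableSet_ball).2 hK).integrableOn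
  have h4 : ∫ w in Ω, (ball z ρ).indicator (fun w => κ (z - w)) w * u z = 0 := by
    rw [integral_mul_const, integral_indicator measurableSet_ball,
      Measure.restrict_restrict measurableSet_ball, inter_eq_self_of_subset_left h.sub, h0, zero_mul]
  rw [← add_zero (Lam κ Ω u z ρ), ← h4, Lam, ← integral_add hi h3]
  congr 1
  ext w
  by_cases hw : w ∈ ball z ρ
  · simp only [indicator_of_mem hw]; ring
  · simp only [indicator_of_notMem hw]; ring

lemma LocH.tendsto_Lam {ι : Type*} {l : Filter ι} [l.IsCountablyGenerated] {C : ℝ} {κ : ℂ → ℂ}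
    {κd : ι → ℂ → ℂ} (hκd : ∀ᶠ i in l, KerB (κd i) C)
    (hl : ∀ u, u ≠ 0 → Tendsto (fun i => κd i u) l (𝓝 (κ u)))
    {Ω u z ρ M A a} (h : LocH Ω u z ρ M A a) :
    Tendsto (fun i => Lam (κd i) Ω u z ρ) l (𝓝 (Lam κ Ω u z ρ)) := by
  unfold Lam
  refine tendsto_integral_filter_of_dominated_convergence (domF C z ρ M A a) ?_ ?_
    (domF_integrable h) ?_
  · filter_upwards [hκd] with i hi using h.aesm hi
  · filter_upwards [hκd] with i hi
    exact (ae_restrict_iff' h.meas).2 (ae_of_all _ fun _ hw => h.dom hi hw)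
  · have : ∀ᵐ w ∂(volume.restrict Ω), w ≠ z := by
      refine ae_restrict_of_ae ?_
      simp [ae_iff]
    filter_upwards [this] with w hw
    exact (hl (z - w) (sub_ne_zero.2 (Ne.symm hw))).mul_const _

/-- sharp truncation of a kernel -/
def cutK (κ : ℂ → ℂ) (δ : ℝ) (u : ℂ) : ℂ := {v : ℂ | δ < ‖v‖}.indicator κ u

lemma cutK_KerB {C : ℝ} {κ : ℂ → ℂ} (hκ : KerB κ C) (δ : ℝ) : KerB (cutK κ δ) C := by
  have hm : MeasurableSet {v : ℂ | δ < ‖v‖} := measurableSet_lt measurable_const measurable_norm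
  refine ⟨hκ.nn, hκ.meas.indicator hm, fun u => ?_, ?_⟩
  · exact (norm_indicator_le_norm_self _ _).trans (hκ.bd u)
  · obtain ⟨ω, h1, h2⟩ := hκ.rot
    refine ⟨ω, h1, fun u => ?_⟩
    unfold cutK
    by_cases h : δ < ‖u‖
    · rw [indicator_of_mem (by simpa [h1] using h), indicator_of_mem (by simpa using h), h2]
    · rw [indicator_of_notMem (by simpa [h1] using h), indicator_of_notMem (by simpa using h)]; simp

lemma cutK_bd {C : ℝ} {κ : ℂ → ℂ} (hκ : KerB κ C) {δ : ℝ} (hδ : 0 < δ) (u : ℂ) :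
    ‖cutK κ δ u‖ ≤ C / δ ^ 2 := by
  have := hκ.nn
  unfold cutK
  by_cases h : δ < ‖u‖
  · rw [indicator_of_mem (by simpa using h)]
    exact (hκ.bd u).trans (by gcongr)
  · rw [indicator_of_notMem (by simpa using h)]; simp; positivity

lemma LocH.pv {C : ℝ} {κ : ℂ → ℂ} (hκ : KerB κ C) {Ω u z ρ M A a} (h : LocH Ω u z ρ M A a) :
    Tendsto (fun δ => ∫ w in {w ∈ Ω | δ < dist w z}, κ (z - w) * u w) (𝓝[>] (0:ℝ))
      (𝓝 (Lam κ Ω u z ρ)) := by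
  have h1 := h.tendsto_Lam (l := 𝓝[>] (0:ℝ)) (κ := κ) (κd := cutK κ) (C := C)
    (Eventually.of_forall fun δ => cutK_KerB hκ δ) (by
      intro u hu
      have hu' : 0 < ‖u‖ := by simpa using hu
      refine tendsto_const_nhds.congr' ?_
      have : Ioo 0 ‖u‖ ∈ 𝓝[>] (0:ℝ) := Ioo_mem_nhdsGT hu'
      filter_upwards [this] with δ hδ
      rw [cutK, indicator_of_mem (by simpa using hδ.2)])
  refine h1.congr' ?_
  filter_upwards [self_mem_nhdsWithin] with δ hδ
  rw [← h.bounded_eq (cutK_KerB hκ δ) (cutK_bd hκ hδ)]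
  have hm : MeasurableSet {w : ℂ | δ < dist w z} :=
    measurableSet_lt measurable_const (by fun_prop)
  have : {w ∈ Ω | δ < dist w z} = {w : ℂ | δ < dist w z} ∩ Ω := by ext; simp [and_comm]
  rw [this, ← Measure.restrict_restrict hm, ← integral_indicator hm]
  congr 1
  ext w
  unfold cutK
  have e : dist w z = ‖z - w‖ := by rw [dist_comm, dist_eq_norm]
  by_cases hw : δ < ‖z - w‖
  · rw [indicator_of_mem (by simpa using hw), indicator_of_mem (by simpa [e] using hw)]
  · rw [indicator_of_notMem (by simpa using hw), indicator_of_notMem (by simpa [e] using hw)]; simp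

lemma LocH.Tn_tendsto {n : ℕ} (hn : 1 ≤ n) {Ω u z ρ M A a} (h : LocH Ω u z ρ M A a) :
    Tendsto (bnTrunc Ω n u z) (𝓝[>] (0:ℝ)) (𝓝 (Lam (bnKer n) Ω u z ρ)) := h.pv (bn_ker hn)

lemma LocH.Tn_eq {n : ℕ} (hn : 1 ≤ n) {Ω u z ρ M A a} (h : LocH Ω u z ρ M A a) :
    TnOp Ω n u z = Lam (bnKer n) Ω u z ρ := (h.Tn_tendsto hn).limUnder_eq

lemma beurlingTrunc_eq (Ω : Set ℂ) (g : ℂ → ℂ) : beurlingTrunc Ω g = bnTrunc Ω 1 g := by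
  ext z δ
  unfold beurlingTrunc bnTrunc bnKer
  rw [← integral_const_mul]
  congr 1
  ext w
  simp
  ring

lemma BOm_eq (Ω : Set ℂ) (g : ℂ → ℂ) : BOm Ω g = TnOp Ω 1 g := by
  ext z; unfold BOm TnOp; rw [beurlingTrunc_eq]

lemma bnTrunc_congr {Ω : Set ℂ} (hm : MeasurableSet Ω) {n : ℕ} {f g : ℂ → ℂ}
    (h : ∀ w ∈ Ω, f w = g w) : bnTrunc Ω n f = bnTrunc Ω n g := by
  ext z δ
  have h1 : MeasurableSet {w : ℂ | δ < dist w z} := measurableSet_lt measurable_const (by fun_prop)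
  refine setIntegral_congr_fun (hm.inter h1) ?_
  intro w hw
  simp only [h w hw.1]

lemma Tn_congr {Ω : Set ℂ} (hm : MeasurableSet Ω) {n : ℕ} {f g : ℂ → ℂ}
    (h : ∀ w ∈ Ω, f w = g w) : TnOp Ω n f = TnOp Ω n g := by
  ext z; unfold TnOp; rw [bnTrunc_congr hm h]

/-! ### Hölder classes -/

/-- `f` is bounded by `M` in `Lip(α,Ω)`. -/
def HolB (α : ℝ) (Ω : Set ℂ) (f : ℂ → ℂ) (M : ℝ) : Prop :=
  (∀ z ∈ Ω, ‖f z‖ ≤ M) ∧ ∀ z ∈ Ω, ∀ w ∈ Ω, ‖f z - f w‖ ≤ M * ‖z - w‖ ^ α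

lemma HolB.mono {α Ω f M N} (h : HolB α Ω f M) (hMN : M ≤ N) : HolB α Ω f N :=
  ⟨fun z hz => (h.1 z hz).trans hMN, fun z hz w hw => (h.2 z hz w hw).trans (by gcongr)⟩

lemma HolB.congr {α Ω f g M} (h : HolB α Ω f M) (he : ∀ w ∈ Ω, f w = g w) : HolB α Ω g M :=
  ⟨fun z hz => by rw [← he z hz]; exact h.1 z hz,
   fun z hz w hw => by rw [← he z hz, ← he w hw]; exact h.2 z hz w hw⟩

lemma HolB.add {α Ω f g M N} (h : HolB α Ω f M) (h' : HolB α Ω g N) : HolB α Ω (f + g) (M + N) :=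
  ⟨fun z hz => (norm_add_le _ _).trans (add_le_add (h.1 z hz) (h'.1 z hz)),
   fun z hz w hw => by
    have : (f + g) z - (f + g) w = (f z - f w) + (g z - g w) := by simp; ring
    rw [this, add_mul]
    exact (norm_add_le _ _).trans (add_le_add (h.2 z hz w hw) (h'.2 z hz w hw))⟩

lemma HolB.smul {α Ω f M} (c : ℂ) (h : HolB α Ω f M) : HolB α Ω (c • f) (‖c‖ * M) :=
  ⟨fun z hz => by simp only [Pi.smul_apply, norm_smul]; gcongr; exact h.1 z hz,
   fun z hz w hw => by
    simp only [Pi.smul_apply, ← smul_sub, norm_smul, mul_assoc]; gcongr; exact h.2 z hz w hw⟩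

lemma HolB.continuousOn {α Ω f M} (ha : 0 < α) (h : HolB α Ω f M) : ContinuousOn f Ω := by
  intro z hz
  rw [ContinuousWithinAt, tendsto_iff_norm_sub_tendsto_zero]
  have h1 : Tendsto (fun w : ℂ => M * ‖w - z‖ ^ α) (𝓝[Ω] z) (𝓝 0) := by
    have : ContinuousAt (fun w : ℂ => M * ‖w - z‖ ^ α) z := by
      refine ContinuousAt.mul continuousAt_const (ContinuousAt.rpow_const (by fun_prop) (Or.inr ha.le))
    have h2 := this.tendsto
    simp [Real.zero_rpow ha.ne'] at h2
    exact h2.mono_left nhdsWithin_le_nhds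
  refine squeeze_zero' (Eventually.of_forall fun _ => norm_nonneg _) ?_ h1
  filter_upwards [self_mem_nhdsWithin] with w hw using h.2 w hw z hz

lemma HolB.locH {α Ω f M} (ha : 0 < α) (h : HolB α Ω f M) (ho : IsOpen Ω)
    (hb : Bornology.IsBounded Ω) {z : ℂ} {ρ : ℝ} (hr : 0 < ρ) (hs : ball z ρ ⊆ Ω) :
    LocH Ω f z ρ M M α where
  meas := ho.measurableSet
  vol := hb.measure_lt_top.ne
  um := (h.continuousOn ha).aestronglyMeasurable ho.measurableSet
  ub := h.1
  rpos := hr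
  apos := ha
  sub := hs
  hol := fun w hw => by
    have := h.2 w (hs hw) z (hs (mem_ball_self hr))
    rwa [norm_sub_rev w z] at this

lemma exists_ball {Ω : Set ℂ} (ho : IsOpen Ω) {z : ℂ} (hz : z ∈ Ω) :
    ∃ ρ > 0, ball z ρ ⊆ Ω := Metric.isOpen_iff.1 ho z hz

lemma HolB.Tn_tendsto {α Ω f M} (ha : 0 < α) (h : HolB α Ω f M) (ho : IsOpen Ω)
    (hb : Bornology.IsBounded Ω) {n : ℕ} (hn : 1 ≤ n) {z : ℂ} (hz : z ∈ Ω) :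
    Tendsto (bnTrunc Ω n f z) (𝓝[>] (0:ℝ)) (𝓝 (TnOp Ω n f z)) := by
  obtain ⟨ρ, hr, hs⟩ := exists_ball ho hz
  have := h.locH ha ho hb hr hs
  rw [this.Tn_eq hn]; exact this.Tn_tendsto hn

lemma HolB.Tn_add {α Ω f g M N} (ha : 0 < α) (h : HolB α Ω f M) (h' : HolB α Ω g N) (ho : IsOpen Ω)
    (hb : Bornology.IsBounded Ω) {n : ℕ} (hn : 1 ≤ n) {z : ℂ} (hz : z ∈ Ω) :
    TnOp Ω n (f + g) z = TnOp Ω n f z + TnOp Ω n g z := by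
  obtain ⟨ρ, hr, hs⟩ := exists_ball ho hz
  have h1 := h.locH ha ho hb hr hs
  have h2 := h'.locH ha ho hb hr hs
  have h3 := (h.add h').locH ha ho hb hr hs
  rw [h1.Tn_eq hn, h2.Tn_eq hn, h3.Tn_eq hn, Lam, Lam, Lam,
    ← integral_add (h1.integrable (bn_ker hn)) (h2.integrable (bn_ker hn))]
  congr 1
  ext w
  by_cases hw : w ∈ ball z ρ
  · simp only [indicator_of_mem hw, Pi.add_apply]; ring
  · simp only [indicator_of_notMem hw, Pi.add_apply]; ring

lemma HolB.Tn_smul {α Ω f M} (ha : 0 < α) (h : HolB α Ω f M) (ho : IsOpen Ω)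
    (hb : Bornology.IsBounded Ω) {n : ℕ} (hn : 1 ≤ n) (c : ℂ) {z : ℂ} (hz : z ∈ Ω) :
    TnOp Ω n (c • f) z = c * TnOp Ω n f z := by
  obtain ⟨ρ, hr, hs⟩ := exists_ball ho hz
  have h1 := h.locH ha ho hb hr hs
  have h3 := (h.smul c).locH ha ho hb hr hs
  rw [h1.Tn_eq hn, h3.Tn_eq hn, Lam, Lam, ← integral_const_mul]
  congr 1
  ext w
  by_cases hw : w ∈ ball z ρ
  · simp only [indicator_of_mem hw, Pi.smul_apply, smul_eq_mul]; ring
  · simp only [indicator_of_notMem hw, Pi.smul_apply, smul_eq_mul]; ring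

/-! ### Geometry of the domain -/

/-- distance to the complement -/
def dst (Ω : Set ℂ) (z : ℂ) : ℝ := infDist z Ωᶜ

/-- A boundary chart around `z`. -/
structure Chart (ε : ℝ) (Ω : Set ℂ) (z : ℂ) (ρ L : ℝ) (e : ℂ) (φ : ℝ → ℝ) : Prop where
  e1 : ‖e‖ = 1
  diff : Differentiable ℝ φ
  hol : ∀ x y, |deriv φ x - deriv φ y| ≤ L * |x - y| ^ ε
  bd : ∀ x, |x - (e * z).re| ≤ 1 → |deriv φ x| ≤ L
  iff : ∀ ζ ∈ ball z ρ, ζ ∈ Ω ↔ (e * ζ).im < φ ((e * ζ).re)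

lemma Chart.mono {ε Ω z ρ L e φ} (h : Chart ε Ω z ρ L e φ) {ρ' L' : ℝ} (hr : ρ' ≤ ρ) (hL : L ≤ L') :
    Chart ε Ω z ρ' L' e φ where
  e1 := h.e1
  diff := h.diff
  hol x y := (h.hol x y).trans (by gcongr)
  bd x hx := (h.bd x hx).trans hL
  iff ζ hζ := h.iff ζ (ball_subset_ball hr hζ)

structure Dom (ε : ℝ) (Ω : Set ℂ) (ρ L : ℝ) : Prop where
  e0 : 0 < ε
  e1 : ε < 1
  op : IsOpen Ω
  bdd : Bornology.IsBounded Ω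
  r0 : 0 < ρ
  r1 : ρ ≤ 1
  L1 : 1 ≤ L
  ch : ∀ z ∈ Ω, dst Ω z < ρ → ∃ e φ, Chart ε Ω z ρ L e φ

lemma compl_nonempty_of_bdd {Ω : Set ℂ} (hb : Bornology.IsBounded Ω) : (Ωᶜ).Nonempty := by
  rw [nonempty_compl]
  intro h
  rw [h] at hb
  exact NormedSpace.unbounded_univ ℝ ℂ hb

lemma dst_nonneg (Ω : Set ℂ) (z : ℂ) : 0 ≤ dst Ω z := infDist_nonneg

lemma dst_ball (Ω : Set ℂ) (z : ℂ) : ball z (dst Ω z) ⊆ Ω := by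
  have := ball_infDist_compl_subset (s := Ω) (x := z)
  exact this

lemma dst_lip (Ω : Set ℂ) (z w : ℂ) : dst Ω z ≤ dst Ω w + ‖z - w‖ := by
  rw [← dist_eq_norm]; exact infDist_le_infDist_add_dist

lemma dst_pos {Ω : Set ℂ} (ho : IsOpen Ω) (hb : Bornology.IsBounded Ω) {z : ℂ} (hz : z ∈ Ω) :
    0 < dst Ω z := by
  refine (ho.isClosed_compl.notMem_iff_infDist_pos (compl_nonempty_of_bdd hb)).1 ?_
  simpa using hz

lemma le_dst {Ω : Set ℂ} (hb : Bornology.IsBounded Ω) {z : ℂ} {r : ℝ} (h : ball z r ⊆ Ω) :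
    r ≤ dst Ω z := by
  refine (le_infDist (compl_nonempty_of_bdd hb)).2 ?_
  intro y hy
  by_contra hc
  push Not at hc
  exact hy (h (by rwa [mem_ball, dist_comm]))

lemma dst_le_of_notMem {Ω : Set ℂ} {z b : ℂ} (hb : b ∉ Ω) : dst Ω z ≤ ‖z - b‖ := by
  rw [← dist_eq_norm]; exact infDist_le_dist_of_mem hb

lemma exists_of_dst_lt {Ω : Set ℂ} (hb : Bornology.IsBounded Ω) {z : ℂ} {r : ℝ} (h : dst Ω z < r) :
    ∃ b, b ∉ Ω ∧ ‖z - b‖ < r := by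
  obtain ⟨b, h1, h2⟩ := (infDist_lt_iff (compl_nonempty_of_bdd hb)).1 h
  exact ⟨b, h1, by rwa [dist_eq_norm] at h2⟩

lemma exists_Dom {ε : ℝ} (hε0 : 0 < ε) (hε1 : ε < 1) {Ω : Set ℂ} (ho : IsOpen Ω)
    (hb : Bornology.IsBounded Ω) (hΩ : HasC1HolderBoundaryC ε Ω) : ∃ ρ L, Dom ε Ω ρ L := by
  have hcomp : IsCompact (frontier Ω) :=
    Metric.isCompact_of_isClosed_isBounded isClosed_frontier
      (hb.closure.subset frontier_subset_closure)
  have key : ∃ ρ L : ℝ, 0 < ρ ∧ ρ ≤ 1 ∧ 1 ≤ L ∧ ∀ b ∈ frontier Ω, ∀ z, ‖z - b‖ < ρ →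
      ∃ e φ, Chart ε Ω z ρ L e φ := by
    refine hcomp.induction_on (p := fun s => ∃ ρ L : ℝ, 0 < ρ ∧ ρ ≤ 1 ∧ 1 ≤ L ∧ ∀ b ∈ s, ∀ z,
      ‖z - b‖ < ρ → ∃ e φ, Chart ε Ω z ρ L e φ) ?_ ?_ ?_ ?_
    · exact ⟨1, 1, by norm_num, le_rfl, le_rfl, by simp⟩
    · rintro s t hst ⟨ρ, L, h1, h2, h3, h4⟩
      exact ⟨ρ, L, h1, h2, h3, fun b hb => h4 b (hst hb)⟩
    · rintro s t ⟨ρ, L, h1, h2, h3, h4⟩ ⟨ρ', L', h1', h2', h3', h4'⟩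
      refine ⟨min ρ ρ', max L L', lt_min h1 h1', (min_le_left _ _).trans h2,
        h3.trans (le_max_left _ _), ?_⟩
      rintro b (hb | hb) z hz
      · obtain ⟨e, φ, h⟩ := h4 b hb z (hz.trans_le (min_le_left _ _))
        exact ⟨e, φ, h.mono (min_le_left _ _) (le_max_left _ _)⟩
      · obtain ⟨e, φ, h⟩ := h4' b hb z (hz.trans_le (min_le_right _ _))
        exact ⟨e, φ, h.mono (min_le_right _ _) (le_max_right _ _)⟩
    · intro a ha
      obtain ⟨r, hr, e, he, φ, hφ, ⟨c, hc⟩, hset⟩ := hΩ a ha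
      have hhol : ∀ x y, |deriv φ x - deriv φ y| ≤ c * |x - y| ^ ε := by
        intro x y
        have := hc.dist_le (mem_univ x) (mem_univ y)
        rwa [Real.dist_eq, Real.dist_eq, Real.coe_toNNReal _ hε0.le] at this
      refine ⟨ball a (r / 4) ∩ frontier Ω, by
          rw [inter_comm]; exact inter_mem_nhdsWithin _ (ball_mem_nhds a (by positivity)), min 1 (r / 4),
        max 1 (c + (|deriv φ (e * a).re| + c * (2 + r) ^ ε)), by positivity, min_le_left _ _,
        le_max_left _ _, ?_⟩
      rintro b ⟨hb1, -⟩ z hz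
      have hz' : ‖z - b‖ < r / 4 := hz.trans_le (min_le_right _ _)
      have hza : ‖z - a‖ < r / 2 := by
        have h1 : ‖b - a‖ < r / 4 := by simpa [dist_eq_norm] using hb1
        have := norm_add_le (z - b) (b - a)
        simp at this
        linarith
      have hpos : 0 ≤ |deriv φ (e * a).re| + c * (2 + r) ^ ε := by positivity
      refine ⟨e, φ, he, hφ.differentiable (by norm_num), ?_, ?_, ?_⟩
      · intro x y
        refine (hhol x y).trans ?_
        gcongr
        refine le_trans ?_ (le_max_right _ _)
        linarith
      · intro x hx
        refine le_trans ?_ (le_max_right _ _)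
        have h1 : |x - (e * a).re| ≤ 2 + r := by
          have h2 : |(e * z).re - (e * a).re| ≤ r / 2 := by
            rw [← Complex.sub_re, ← mul_sub]
            refine (Complex.abs_re_le_norm _).trans ?_
            rw [norm_mul, he, one_mul]; exact hza.le
          have := abs_sub_le x (e * z).re (e * a).re
          linarith
        have h3 := hhol x (e * a).re
        have h4 : |x - (e * a).re| ^ ε ≤ (2 + r) ^ ε := by gcongr
        have h5 : (c:ℝ) * |x - (e * a).re| ^ ε ≤ c * (2 + r) ^ ε := by gcongr
        have h6 := abs_sub_abs_le_abs_sub (deriv φ x) (deriv φ (e * a).re)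
        have := c.2
        simp only [NNReal.val_eq_coe] at this
        linarith
      · intro ζ hζ
        have hζa : ζ ∈ ball a r := by
          rw [mem_ball, dist_eq_norm] at hζ ⊢
          have h1 := hζ.trans_le (min_le_right _ _)
          have := norm_add_le (ζ - z) (z - a)
          simp at this
          linarith
        have h1 : ζ ∈ Ω ∩ ball a r ↔ ζ ∈ {z ∈ ball a r | (e * z).im < φ ((e * z).re)} := by rw [hset]
        exact ⟨fun h => (h1.1 ⟨h, hζa⟩).2, fun h => (h1.2 ⟨hζa, h⟩).1⟩
  obtain ⟨ρ, L, h1, h2, h3, h4⟩ := key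
  refine ⟨ρ, L, hε0, hε1, ho, hb, h1, h2, h3, ?_⟩
  intro z hz hd
  obtain ⟨b, hb1, hb2⟩ := exists_of_dst_lt hb hd
  obtain ⟨y, hy1, hy2⟩ : ∃ y, y ∈ ball z ρ ∧ y ∈ frontier Ω := by
    by_contra hcon
    push Not at hcon
    have hfr : ∀ y ∈ ball z ρ, y ∉ Ω → y ∈ (closure Ω)ᶜ := fun y hy hyo hyc =>
      hcon y hy (by rw [ho.frontier_eq]; exact ⟨hyc, hyo⟩)
    have hbm : b ∈ ball z ρ := by rwa [mem_ball, dist_comm, dist_eq_norm]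
    obtain ⟨x, -, hx1, hx2⟩ := (convex_ball z ρ).isPreconnected Ω (closure Ω)ᶜ ho
      isClosed_closure.isOpen_compl
      (fun y hy => by
        by_cases hyo : y ∈ Ω
        · exact Or.inl hyo
        · exact Or.inr (hfr y hy hyo))
      ⟨z, mem_ball_self h1, hz⟩ ⟨b, hbm, hfr b hbm hb1⟩
    exact hx2 (subset_closure hx1)
  refine h4 y hy2 z ?_
  rwa [mem_ball, dist_comm, dist_eq_norm] at hy1

section chart
variable {ε : ℝ} {Ω : Set ℂ} {z : ℂ} {ρ L : ℝ} {e : ℂ} {φ : ℝ → ℝ}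

lemma abs_re_e (he : ‖e‖ = 1) (a b : ℂ) : |(e * a).re - (e * b).re| ≤ ‖a - b‖ := by
  rw [← Complex.sub_re, ← mul_sub]
  refine (Complex.abs_re_le_norm _).trans ?_
  rw [norm_mul, he, one_mul]

lemma abs_im_e (he : ‖e‖ = 1) (a b : ℂ) : |(e * a).im - (e * b).im| ≤ ‖a - b‖ := by
  rw [← Complex.sub_im, ← mul_sub]
  refine (Complex.abs_im_le_norm _).trans ?_
  rw [norm_mul, he, one_mul]

lemma Chart.lip (h : Chart ε Ω z ρ L e φ) {x y : ℝ} (hx : |x - (e * z).re| ≤ 1)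
    (hy : |y - (e * z).re| ≤ 1) : |φ x - φ y| ≤ L * |x - y| := by
  have := (convex_closedBall (e * z).re 1).norm_image_sub_le_of_norm_deriv_le (f := φ) (C := L)
    (fun t _ => h.diff t) (fun t ht => h.bd t ht)
    (x := y) (y := x) hy hx
  simpa using this

lemma Chart.taylor (h : Chart ε Ω z ρ L e φ) (hL : 0 ≤ L) (he : 0 < ε) (x x0 : ℝ) :
    |φ x - φ x0 - deriv φ x0 * (x - x0)| ≤ L * |x - x0| ^ (1 + ε) := by
  let g : ℝ → ℝ := fun t => φ t - deriv φ x0 * t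
  have hg : ∀ t, HasDerivAt g (deriv φ t - deriv φ x0) t := fun t => by
    have := (h.diff t).hasDerivAt.sub ((hasDerivAt_id t).const_mul (deriv φ x0))
    rw [mul_one] at this
    exact this
  have := (convex_closedBall x0 |x - x0|).norm_image_sub_le_of_norm_hasDerivWithin_le (f := g)
    (C := L * |x - x0| ^ ε) (fun t _ => (hg t).hasDerivWithinAt) (fun t ht => by
      refine (h.hol t x0).trans ?_
      have : |t - x0| ≤ |x - x0| := by simpa [Real.dist_eq] using ht
      gcongr) (x := x0) (y := x) (by simp) (by simp [Real.dist_eq])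
  rw [Real.rpow_one_add' (abs_nonneg _) (by linarith)]
  calc _ = ‖g x - g x0‖ := by rw [Real.norm_eq_abs]; congr 1; simp only [g]; ring
    _ ≤ _ := this
    _ = _ := by rw [Real.norm_eq_abs]; ring

/-- inward direction -/
def nu (e : ℂ) : ℂ := -Complex.I * (starRingEnd ℂ) e

lemma e_nu (he : ‖e‖ = 1) : e * nu e = -Complex.I := by
  have : e * (starRingEnd ℂ) e = 1 := by
    rw [Complex.mul_conj, Complex.normSq_eq_norm_sq, he]; simp
  unfold nu
  linear_combination (-Complex.I) * this

lemma nu_norm (he : ‖e‖ = 1) : ‖nu e‖ = 1 := by simp [nu, he]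

lemma Chart.cone (h : Chart ε Ω z ρ L e φ) (hL : 1 ≤ L) (hρ0 : 0 < ρ) (hρ : ρ ≤ 1) {z' : ℂ} (hz' : z' ∈ Ω)
    (hzz : ‖z' - z‖ < ρ / 8) {t : ℝ} (ht0 : 0 ≤ t) (ht : t ≤ ρ / 8) :
    ball (z' + t * nu e) (t / (1 + L)) ⊆ Ω := by
  intro ζ hζ
  rw [mem_ball, dist_eq_norm] at hζ
  set δ := ζ - (z' + t * nu e) with hδ
  have hLp : 0 < 1 + L := by linarith
  have htl : t / (1 + L) ≤ t := div_le_self ht0 (by linarith)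
  have hζe : ζ = z' + t * nu e + δ := by simp [δ]
  have h1 : ‖ζ - z‖ < ρ := by
    have : ζ - z = (z' - z) + (t * nu e) + δ := by rw [hζe]; ring
    rw [this]
    refine lt_of_le_of_lt (norm_add₃_le) ?_
    rw [norm_mul, nu_norm h.e1, Complex.norm_real, Real.norm_of_nonneg ht0]
    linarith
  have hm : ζ ∈ ball z ρ := by rwa [mem_ball, dist_eq_norm]
  have hm' : z' ∈ ball z ρ := by rw [mem_ball, dist_eq_norm]; linarith
  rw [h.iff ζ hm]
  have hz'' := (h.iff z' hm').1 hz'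
  have e1 : e * ζ = e * z' - t * Complex.I + e * δ := by
    rw [hζe]; linear_combination (t:ℂ) * e_nu h.e1
  have hre : (e * ζ).re = (e * z').re + (e * δ).re := by rw [e1]; simp
  have him : (e * ζ).im = (e * z').im - t + (e * δ).im := by rw [e1]; simp
  have hd1 : |(e * δ).re| ≤ ‖δ‖ := by
    simpa [h.e1] using Complex.abs_re_le_norm (e * δ)
  have hd2 : |(e * δ).im| ≤ ‖δ‖ := by
    simpa [h.e1] using Complex.abs_im_le_norm (e * δ)
  have hl := h.lip (x := (e * z').re) (y := (e * ζ).re)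
    ((abs_re_e h.e1 _ _).trans (by linarith)) ((abs_re_e h.e1 _ _).trans (by linarith))
  have hab : |(e * z').re - (e * ζ).re| = |(e * δ).re| := by
    rw [hre]; rw [← abs_neg]; congr 1; ring
  rw [hab] at hl
  have h3 : L * |(e * δ).re| ≤ L * ‖δ‖ := by gcongr
  have h4 := (abs_le.1 hl).2
  have h5 := (abs_le.1 hd2).2
  have h6 : (1 + L) * ‖δ‖ ≤ t := by
    have := mul_le_mul_of_nonneg_left hζ.le hLp.le
    rwa [mul_div_cancel₀ _ hLp.ne'] at this
  rw [him]
  nlinarith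

/-- The signed height over the tangent line at the point under `z`. -/
def sht (z e : ℂ) (φ : ℝ → ℝ) (ζ : ℂ) : ℝ :=
  (e * ζ).im - (φ (e * z).re + deriv φ (e * z).re * ((e * ζ).re - (e * z).re))

lemma Chart.T1 (h : Chart ε Ω z ρ L e φ) (ζ ξ : ℂ) :
    |sht z e φ ζ - sht z e φ ξ| ≤ (1 + L) * ‖ζ - ξ‖ := by
  have h1 := abs_re_e h.e1 ζ ξ
  have h2 := abs_im_e h.e1 ζ ξ
  have h3 := h.bd (e * z).re (by simp)
  have : sht z e φ ζ - sht z e φ ξ = ((e * ζ).im - (e * ξ).im)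
    - deriv φ (e * z).re * ((e * ζ).re - (e * ξ).re) := by unfold sht; ring
  rw [this]
  refine (abs_sub _ _).trans ?_
  rw [abs_mul]
  have : |deriv φ (e * z).re| * |(e * ζ).re - (e * ξ).re| ≤ L * ‖ζ - ξ‖ := by
    gcongr
    exact (abs_nonneg _).trans h3
  linarith

lemma Chart.T2 (h : Chart ε Ω z ρ L e φ) (hρ : 0 < ρ) (hz : z ∈ Ω) (hd : dst Ω z < ρ) :
    sht z e φ z ≤ - dst Ω z := by
  have hs : sht z e φ z = (e * z).im - φ (e * z).re := by simp [sht]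
  have h0 := (h.iff z (mem_ball_self hρ)).1 hz
  set t := φ (e * z).re - (e * z).im with ht
  have htp : 0 < t := by linarith
  by_cases hc : t < ρ
  · have hn : ‖z - (z - t * nu e)‖ = t := by
      simp [nu_norm h.e1, abs_of_pos htp]
    have hb : z - t * nu e ∉ Ω := by
      rw [h.iff _ (by rw [mem_ball, dist_comm, dist_eq_norm, hn]; exact hc)]
      have : e * (z - t * nu e) = e * z + t * Complex.I := by
        linear_combination (-(t:ℂ)) * e_nu h.e1
      rw [this]
      have e2 : (e * z + t * Complex.I).re = (e * z).re := by
        rw [Complex.add_re, Complex.re_ofReal_mul]; simp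
      have e3 : (e * z + t * Complex.I).im = (e * z).im + t := by
        rw [Complex.add_im, Complex.im_ofReal_mul]; simp
      rw [e2, e3]
      linarith
    have := dst_le_of_notMem (z := z) hb
    rw [hn] at this
    linarith
  · linarith

lemma Chart.T3 (h : Chart ε Ω z ρ L e φ) (hL : 0 ≤ L) (he : 0 < ε) {ζ : ℂ} (hζ : ζ ∈ ball z ρ)
    (hn : ζ ∉ Ω) : -(L * |(e * ζ).re - (e * z).re| ^ (1 + ε)) ≤ sht z e φ ζ := by
  rw [h.iff ζ hζ] at hn
  have := (abs_le.1 (h.taylor hL he (e * ζ).re (e * z).re)).1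
  unfold sht
  linarith

lemma Chart.T4 (h : Chart ε Ω z ρ L e φ) (hL : 0 ≤ L) (he : 0 < ε) {ζ : ℂ} (hζ : ζ ∈ ball z ρ)
    (hn : ζ ∈ Ω) : sht z e φ ζ ≤ L * |(e * ζ).re - (e * z).re| ^ (1 + ε) := by
  rw [h.iff ζ hζ] at hn
  have := (abs_le.1 (h.taylor hL he (e * ζ).re (e * z).re)).2
  unfold sht
  linarith

lemma sht_cont (z e : ℂ) (φ : ℝ → ℝ) : Continuous (sht z e φ) := by
  unfold sht
  fun_prop

end chart

/-! ### Slab integrals -/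

lemma rot_mp {e : ℂ} (he : ‖e‖ = 1) : MeasurePreserving (fun ζ : ℂ => e * ζ) volume volume := by
  let a : Circle := ⟨e, by simp [Submonoid.unitSphere, he]⟩
  exact (rotation a).measurePreserving

lemma lintegral_coord {e : ℂ} (he : ‖e‖ = 1) {G : ℝ × ℝ → ℝ≥0∞} (hG : Measurable G) :
    ∫⁻ ζ : ℂ, G ((e * ζ).re, (e * ζ).im) = ∫⁻ x : ℝ, ∫⁻ y : ℝ, G (x, y) := by
  have h1 := (Complex.volume_preserving_equiv_real_prod.comp (rot_mp he)).lintegral_comp hG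
  have h2 := lintegral_prod (μ := (volume : Measure ℝ)) (ν := (volume : Measure ℝ)) G hG.aemeasurable
  rw [← h2]
  exact h1

lemma lintegral_slab {e : ℂ} (he : ‖e‖ = 1) {l b : ℝ → ℝ} {k : ℝ → ℝ≥0∞} (hl : Measurable l)
    (hb : Measurable b) (hk : Measurable k) :
    ∫⁻ ζ : ℂ, {ζ : ℂ | |(e * ζ).im - l (e * ζ).re| ≤ b (e * ζ).re}.indicator
      (fun ζ => k (e * ζ).re) ζ = ∫⁻ x : ℝ, k x * ENNReal.ofReal (2 * b x) := by
  let S : Set (ℝ × ℝ) := {p | |p.2 - l p.1| ≤ b p.1}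
  have hS : MeasurableSet S := by
    apply measurableSet_le
    · exact (by fun_prop : Measurable fun p : ℝ × ℝ => p.2 - l p.1).norm
    · fun_prop
  have hG : Measurable (S.indicator (fun p => k p.1)) := (by fun_prop : Measurable fun p : ℝ × ℝ => k p.1).indicator hS
  have h := lintegral_coord he hG
  have e1 : ∀ ζ : ℂ, {ζ : ℂ | |(e * ζ).im - l (e * ζ).re| ≤ b (e * ζ).re}.indicator
      (fun ζ => k (e * ζ).re) ζ = S.indicator (fun p => k p.1) ((e * ζ).re, (e * ζ).im) := by
    intro ζ; simp [indicator, S]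
  simp only [e1, h]
  congr 1
  ext x
  have : ∀ y, S.indicator (fun p => k p.1) (x, y) = (Icc (l x - b x) (l x + b x)).indicator (fun _ => k x) y := by
    intro y
    have : (x, y) ∈ S ↔ y ∈ Icc (l x - b x) (l x + b x) := by
      simp only [S, mem_ofPred_eq, abs_le, mem_Icc]
      constructor <;> rintro ⟨h1, h2⟩ <;> constructor <;> linarith
    by_cases hy : (x, y) ∈ S
    · rw [indicator_of_mem hy, indicator_of_mem (this.1 hy)]
    · rw [indicator_of_notMem hy, indicator_of_notMem (fun h' => hy (this.2 h'))]
  simp only [this]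
  rw [lintegral_indicator measurableSet_Icc, setLIntegral_const, Real.volume_Icc]
  congr 2; ring

lemma line_integrable {a d : ℝ} (ha : a < -1) (hd : 0 < d) (x0 : ℝ) :
    Integrable (fun x : ℝ => (|x - x0| + d) ^ a) := by
  have h : Integrable (fun x : ℝ => (fun y => (y + d) ^ a) ‖x‖) := by
    rw [integrable_fun_norm_addHaar (volume : Measure ℝ) (f := fun y => (y + d) ^ a)]
    simpa using integrableOn_add_rpow_Ioi_of_lt ha (by linarith : -d < 0)
  exact h.comp_sub_right x0

lemma line_integral {a d : ℝ} (ha : a < -1) (hd : 0 < d) (x0 : ℝ) :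
    ∫ x : ℝ, (|x - x0| + d) ^ a = 2 * (-d ^ (a + 1) / (a + 1)) := by
  rw [integral_sub_right_eq_self (fun x : ℝ => (|x| + d) ^ a) x0,
    integral_comp_abs (f := fun x => (x + d) ^ a), ← integral_Ioi_rpow_of_lt ha hd,
    ← integral_indicator measurableSet_Ioi, ← integral_indicator measurableSet_Ioi,
    ← integral_add_right_eq_self ((Ioi d).indicator fun x => x ^ a) d]
  congr 2
  ext x
  by_cases hx : 0 < x
  · rw [indicator_of_mem (by simpa using hx), indicator_of_mem (by simpa using hx)]
  · rw [indicator_of_notMem (by simpa using hx), indicator_of_notMem (by simpa using hx)]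

lemma thin_bound {ε : ℝ} (h1 : ε < 1) {e z : ℂ} (he : ‖e‖ = 1) {l : ℝ → ℝ}
    (hl : Measurable l) {A c d : ℝ} (hA : 0 ≤ A) (hc : 0 < c) (hc1 : c ≤ 1) (hd : 0 < d) {N : Set ℂ}
    (hNm : MeasurableSet N)
    (hN : ∀ ζ ∈ N, |(e * ζ).im - l (e * ζ).re| ≤ A * (|(e * ζ).re - (e * z).re| + d) ^ (1 + ε) ∧
      c * d ≤ ‖z - ζ‖) :
    IntegrableOn (fun ζ => 1 / ‖z - ζ‖ ^ 3) N ∧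
      ∫ ζ in N, 1 / ‖z - ζ‖ ^ 3 ≤ 32 * A / (c ^ 3 * (1 - ε)) * d ^ (ε - 1) := by
  set x0 := (e * z).re
  set R := 32 * A / (c ^ 3 * (1 - ε)) * d ^ (ε - 1) with hR
  have h1' : 0 < 1 - ε := by linarith
  have hR0 : 0 ≤ R := by positivity
  let b : ℝ → ℝ := fun x => A * (|x - x0| + d) ^ (1 + ε)
  let k : ℝ → ℝ≥0∞ := fun x => ENNReal.ofReal ((2 / c) ^ 3 * ((|x - x0| + d) ^ 3)⁻¹)
  have habs : Measurable fun x : ℝ => |x - x0| := (by fun_prop : Measurable fun x : ℝ => x - x0).norm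
  have hb : Measurable b := by fun_prop
  have hk : Measurable k := by fun_prop
  have hpt : ∀ ζ, N.indicator (fun ζ => ENNReal.ofReal (1 / ‖z - ζ‖ ^ 3)) ζ ≤
      {ζ : ℂ | |(e * ζ).im - l (e * ζ).re| ≤ b (e * ζ).re}.indicator (fun ζ => k (e * ζ).re) ζ := by
    intro ζ
    by_cases hζ : ζ ∈ N
    · obtain ⟨h2, h3⟩ := hN ζ hζ
      rw [indicator_of_mem hζ, indicator_of_mem (by exact h2)]
      apply ENNReal.ofReal_le_ofReal
      have h4 : |(e * ζ).re - x0| ≤ ‖z - ζ‖ := by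
        rw [norm_sub_rev]; exact abs_re_e he ζ z
      have h5 : c / 2 * (|(e * ζ).re - x0| + d) ≤ ‖z - ζ‖ := by
        have := abs_nonneg ((e * ζ).re - x0)
        nlinarith
      have h6 : 0 < |(e * ζ).re - x0| + d := by positivity
      calc 1 / ‖z - ζ‖ ^ 3 ≤ 1 / (c / 2 * (|(e * ζ).re - x0| + d)) ^ 3 := by gcongr
        _ = _ := by field_simp; try ring
    · rw [indicator_of_notMem hζ]; exact zero_le
  have hlin : ∫⁻ ζ in N, ENNReal.ofReal (1 / ‖z - ζ‖ ^ 3) ≤ ENNReal.ofReal R := by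
    rw [← lintegral_indicator hNm]
    refine (lintegral_mono hpt).trans ?_
    rw [lintegral_slab he hl hb hk]
    have : ∀ x, k x * ENNReal.ofReal (2 * b x) =
        ENNReal.ofReal (16 * A / c ^ 3 * (|x - x0| + d) ^ (ε - 2)) := by
      intro x
      have h6 : 0 < |x - x0| + d := by positivity
      simp only [k]
      rw [← ENNReal.ofReal_mul (by positivity)]
      congr 1
      simp only [b]
      rw [show (1 + ε) = (ε - 2) + 3 by ring, Real.rpow_add h6]
      norm_cast
      field_simp
      ring
    simp only [this]
    rw [← ofReal_integral_eq_lintegral_ofReal]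
    · apply ENNReal.ofReal_le_ofReal
      rw [integral_const_mul, line_integral (by linarith) hd, hR]
      apply le_of_eq
      rw [show ε - 2 + 1 = ε - 1 by ring]
      have : ε - 1 ≠ 0 := by linarith
      have : 1 - ε ≠ 0 := by linarith
      rw [show ε - 1 = -(1 - ε) by ring]
      field_simp
      ring
    · exact (line_integrable (by linarith) hd x0).const_mul _
    · exact ae_of_all _ fun x => by positivity
  have hm : AEStronglyMeasurable (fun ζ : ℂ => 1 / ‖z - ζ‖ ^ 3) (volume.restrict N) := by
    refine Measurable.aestronglyMeasurable ?_
    fun_prop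
  refine ⟨⟨hm, ?_⟩, ?_⟩
  · rw [hasFiniteIntegral_iff_ofReal (ae_of_all _ fun x => by positivity)]
    exact hlin.trans_lt ENNReal.ofReal_lt_top
  · rw [integral_eq_lintegral_of_nonneg_ae (ae_of_all _ fun x => by positivity) hm]
    exact ENNReal.toReal_le_of_le_ofReal hR0 hlin

lemma Dom.collar {ε Ω ρ L} (D : Dom ε Ω ρ L) : ∃ C : ℝ, 0 ≤ C ∧ ∀ τ : ℝ, 0 < τ →
    volume.real {ζ ∈ Ω | dst Ω ζ < τ} ≤ C * τ := by
  have hr := D.r0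
  have hL := D.L1
  have hvol : volume Ω ≠ ⊤ := D.bdd.measure_lt_top.ne
  have htb : TotallyBounded Ω := ((Metric.isCompact_of_isClosed_isBounded isClosed_closure D.bdd.closure).totallyBounded).subset subset_closure
  obtain ⟨t, htΩ, htf, hcov⟩ := Metric.finite_approx_of_totallyBounded htb (ρ / 4) (by positivity)
  refine ⟨htf.toFinset.card * (4 * (1 + L)) + 8 / ρ * volume.real Ω, by positivity, ?_⟩
  intro τ hτ
  by_cases hc : τ < ρ / 8
  swap
  · calc _ ≤ volume.real Ω := measureReal_mono (fun x hx => hx.1) hvol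
      _ ≤ 8 / ρ * volume.real Ω * τ := by
        have : 1 ≤ 8 / ρ * τ := by
          rw [div_mul_eq_mul_div, le_div_iff₀ hr]; linarith
        have h0 : 0 ≤ volume.real Ω := measureReal_nonneg
        nlinarith
      _ ≤ _ := by
        gcongr
        have : 0 ≤ (htf.toFinset.card : ℝ) * (4 * (1 + L)) := by positivity
        linarith
  have hpiece : ∀ y ∈ t, volume ({ζ ∈ Ω | dst Ω ζ < τ} ∩ ball y (ρ / 4)) ≤
      ENNReal.ofReal (4 * (1 + L) * τ) := by
    intro y hy
    by_cases hne : ({ζ ∈ Ω | dst Ω ζ < τ} ∩ ball y (ρ / 4)).Nonempty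
    swap
    · rw [not_nonempty_iff_eq_empty.1 hne]; simp
    obtain ⟨ξ, ⟨hξ1, hξ2⟩, hξ3⟩ := hne
    have hyd : dst Ω y < ρ := by
      have := dst_lip Ω y ξ
      rw [cx_ball_mem, mem_Iio] at hξ3
      linarith
    obtain ⟨e, φ, ch⟩ := D.ch y (htΩ hy) hyd
    have hφ : Measurable φ := ch.diff.continuous.measurable
    let k : ℝ → ℝ≥0∞ := (Icc ((e * y).re - 1) ((e * y).re + 1)).indicator 1
    have hk : Measurable k := measurable_one.indicator measurableSet_Icc
    have hmain : volume ({ζ ∈ Ω | dst Ω ζ < τ} ∩ ball y (ρ / 4)) ≤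
        ∫⁻ ζ : ℂ, {ζ : ℂ | |(e * ζ).im - φ (e * ζ).re| ≤ (fun _ => (1 + L) * τ) (e * ζ).re}.indicator
          (fun ζ => k (e * ζ).re) ζ := by
      have hcm : MeasurableSet ({ζ ∈ Ω | dst Ω ζ < τ} ∩ ball y (ρ / 4)) := by
        refine MeasurableSet.inter ?_ measurableSet_ball
        refine D.op.measurableSet.inter ?_
        exact measurableSet_lt (continuous_infDist_pt _).measurable measurable_const
      rw [← lintegral_indicator_one hcm]
      refine lintegral_mono fun ζ => ?_
      by_cases hζ : ζ ∈ ({ζ ∈ Ω | dst Ω ζ < τ} ∩ ball y (ρ / 4))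
      swap
      · rw [indicator_of_notMem hζ]; exact zero_le
      obtain ⟨⟨hζ1, hζ2⟩, hζ3⟩ := hζ
      rw [cx_ball_mem, mem_Iio, norm_sub_rev] at hζ3
      obtain ⟨b, hb1, hb2⟩ := exists_of_dst_lt D.bdd hζ2
      have hby : ‖b - y‖ < ρ := by
        have := norm_add_le (b - ζ) (ζ - y)
        simp only [sub_add_sub_cancel] at this
        rw [norm_sub_rev b ζ] at this
        linarith
      have hbΩ := mt (ch.iff b (by rwa [mem_ball, dist_eq_norm])).2 hb1
      have hζΩ := (ch.iff ζ (by rw [mem_ball, dist_eq_norm]; linarith)).1 hζ1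
      have hr1 := D.r1
      have hX := (abs_re_e ch.e1 ζ y)
      have hl := ch.lip (x := (e * ζ).re) (y := (e * b).re) (hX.trans (by linarith))
        ((abs_re_e ch.e1 b y).trans (by linarith))
      have h1 := abs_re_e ch.e1 ζ b
      have h2 := abs_im_e ch.e1 ζ b
      have hm : ζ ∈ {ζ : ℂ | |(e * ζ).im - φ (e * ζ).re| ≤ (fun _ => (1 + L) * τ) (e * ζ).re} := by
        simp only [mem_ofPred_eq]
        rw [abs_le]
        have h3 : L * |(e * ζ).re - (e * b).re| ≤ L * τ := by gcongr; linarith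
        have h4 := (abs_le.1 hl).2
        have h5 := (abs_le.1 h2).1
        constructor <;> nlinarith
      have hm0 : ζ ∈ ({ζ ∈ Ω | dst Ω ζ < τ} ∩ ball y (ρ / 4)) :=
        ⟨⟨hζ1, hζ2⟩, by rwa [cx_ball_mem, mem_Iio, norm_sub_rev]⟩
      rw [indicator_of_mem hm0, indicator_of_mem hm]
      have : (e * ζ).re ∈ Icc ((e * y).re - 1) ((e * y).re + 1) := by
        have := abs_le.1 (hX.trans (by linarith : ‖ζ - y‖ ≤ 1))
        constructor <;> linarith [this.1, this.2]
      simp only [k, indicator_of_mem this, Pi.one_apply, le_refl]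
    refine hmain.trans ?_
    rw [lintegral_slab ch.e1 hφ measurable_const hk, lintegral_mul_const _ hk]
    simp only [k]
    rw [lintegral_indicator_one measurableSet_Icc, Real.volume_Icc, ← ENNReal.ofReal_mul (by linarith)]
    apply ENNReal.ofReal_le_ofReal
    apply le_of_eq; ring
  have hsub : {ζ ∈ Ω | dst Ω ζ < τ} ⊆ ⋃ y ∈ htf.toFinset, {ζ ∈ Ω | dst Ω ζ < τ} ∩ ball y (ρ / 4) := by
    intro ζ hζ
    have := hcov hζ.1
    simp only [mem_iUnion] at this ⊢
    obtain ⟨y, hy, hy2⟩ := this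
    exact ⟨y, by simpa using hy, hζ, hy2⟩
  have hle : volume {ζ ∈ Ω | dst Ω ζ < τ} ≤ ENNReal.ofReal (htf.toFinset.card * (4 * (1 + L) * τ)) := by
    refine (measure_mono hsub).trans ((measure_biUnion_finset_le _ _).trans ?_)
    refine (Finset.sum_le_sum (fun y hy => hpiece y (by simpa using hy))).trans ?_
    rw [Finset.sum_const, nsmul_eq_mul, ENNReal.ofReal_mul (p := (htf.toFinset.card : ℝ)) (by positivity),
      ENNReal.ofReal_natCast]
  have h3 := ENNReal.toReal_le_of_le_ofReal (by positivity) hle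
  have h0 : 0 ≤ 8 / ρ * volume.real Ω * τ := by positivity
  have : volume.real {ζ ∈ Ω | dst Ω ζ < τ} ≤ htf.toFinset.card * (4 * (1 + L) * τ) := h3
  linarith

/-! ### The chain lemma -/

lemma Dom.chain {ε Ω ρ L} (D : Dom ε Ω ρ L) {κ β : ℝ} (hκ0 : 0 < κ) (hκ1 : κ < 1) (hβ0 : 0 < β) : ∃ c0 : ℝ, 0 < c0 ∧ ∃ C : ℝ, 0 ≤ C ∧ ∀ (A : ℝ) (u : ℂ → ℂ), 0 ≤ A →
      (∀ z ∈ Ω, ∀ z1, ‖z - z1‖ ≤ κ * dst Ω z → ‖u z - u z1‖ ≤ A * ‖z - z1‖ ^ β) →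
      (∀ z ∈ Ω, c0 ≤ dst Ω z → ‖u z‖ ≤ A) → HolB β Ω u (C * A) := by
  have hr := D.r0
  have hr1 := D.r1
  have hL := D.L1
  set c := 1 / (1 + L) with hc
  have hc0 : 0 < c := by positivity
  have hc1 : c < 1 := by rw [hc, div_lt_one (by linarith)]; linarith
  set lam := 1 - κ * c with hlam
  have hkc : κ * c < 1 := by nlinarith
  have hkc0 : 0 < κ * c := by positivity
  have hl0 : 0 < lam := by linarith
  have hl1 : lam < 1 := by linarith
  have hlb : lam ^ β < 1 := Real.rpow_lt_one hl0.le hl1 hβ0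
  set q := 1 / (1 - lam ^ β) with hq
  have hq1 : 1 ≤ q := by
    rw [hq, le_div_iff₀ (by linarith)]
    have := Real.rpow_nonneg hl0.le β
    linarith
  have hqe : 1 + q * lam ^ β = q := by
    rw [hq]; field_simp [show 1 - lam ^ β ≠ 0 by linarith]; ring
  set h1 := κ * c * ρ / 16 with hh1
  have hh1p : 0 < h1 := by positivity
  refine ⟨c * ρ / 8, by positivity, max (1 + q) (max (2 * (1 + q) / h1 ^ β) (2 * q / (κ * c) ^ β + 1)),
    le_max_of_le_left (by linarith), ?_⟩
  intro A u hA hW hS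
  have hball : ∀ {z e φ}, Chart ε Ω z ρ L e φ → ∀ z' ∈ Ω, ‖z' - z‖ < ρ / 8 → ∀ t : ℝ, 0 ≤ t →
      t ≤ ρ / 8 → c * t ≤ dst Ω (z' + t * nu e) ∧ z' + t * nu e ∈ Ω := by
    intro z e φ ch z' hz' hzz t ht0 ht
    have := ch.cone hL hr hr1 hz' hzz ht0 ht
    constructor
    · have := le_dst D.bdd this
      rw [hc]; rwa [div_mul_eq_mul_div, one_mul]
    · rcases ht0.eq_or_lt with h | h
      · simpa [← h] using hz'
      · exact this (mem_ball_self (by positivity))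
  have hvert : ∀ {z e φ}, Chart ε Ω z ρ L e φ → ∀ z' ∈ Ω, ‖z' - z‖ < ρ / 8 → ∀ t : ℝ, 0 ≤ t →
      t ≤ ρ / 8 → ‖u (z' + t * nu e) - u z'‖ ≤ A * q * t ^ β := by
    intro z e φ ch z' hz' hzz
    have hd := dst_pos D.op D.bdd hz'
    have hind : ∀ n : ℕ, ∀ t : ℝ, 0 ≤ t → t ≤ ρ / 8 → lam ^ n * t ≤ κ * dst Ω z' →
        ‖u (z' + t * nu e) - u z'‖ ≤ A * q * t ^ β := by
      intro n
      induction n with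
      | zero =>
        intro t ht0 ht htd
        have hn : ‖z' - (z' + t * nu e)‖ = t := by simp [nu_norm ch.e1, abs_of_nonneg ht0]
        have := hW z' hz' (z' + t * nu e) (by rw [hn]; simpa using htd)
        rw [hn, norm_sub_rev] at this
        refine this.trans ?_
        have : A ≤ A * q := le_mul_of_one_le_right hA hq1
        gcongr
      | succ n ih =>
        intro t ht0 ht htd
        have h2 := ih (lam * t) (by positivity) (by nlinarith) (by rw [pow_succ] at htd; linarith)
        have hn : ‖(z' + t * nu e) - (z' + (lam * t : ℝ) * nu e)‖ = κ * c * t := by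
          have : (z' + t * nu e) - (z' + (lam * t : ℝ) * nu e) = ((κ * c * t : ℝ) : ℂ) * nu e := by
            rw [hlam]; push_cast; ring
          rw [this, norm_mul, nu_norm ch.e1, Complex.norm_real, Real.norm_of_nonneg (by positivity), mul_one]
        obtain ⟨h3, h4⟩ := hball ch z' hz' hzz t ht0 ht
        have h5 := hW _ h4 (z' + (lam * t : ℝ) * nu e) (by rw [hn, mul_assoc]; gcongr)
        rw [hn] at h5
        have h6 : (κ * c * t) ^ β ≤ t ^ β := by
          gcongr
          nlinarith
        have h7 : A * (κ * c * t) ^ β ≤ A * t ^ β := by gcongr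
        rw [Real.mul_rpow hl0.le ht0] at h2
        have h8 := norm_add_le (u (z' + t * nu e) - u (z' + (lam * t : ℝ) * nu e))
          (u (z' + (lam * t : ℝ) * nu e) - u z')
        simp only [sub_add_sub_cancel] at h8
        calc _ ≤ A * t ^ β + A * q * (lam ^ β * t ^ β) := by linarith
          _ = A * (1 + q * lam ^ β) * t ^ β := by ring
          _ = _ := by rw [hqe]
    intro t ht0 ht
    have hlim : Tendsto (fun n : ℕ => lam ^ n * t) atTop (𝓝 0) := by
      have := (tendsto_pow_atTop_nhds_zero_of_lt_one hl0.le hl1).mul_const t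
      simpa using this
    obtain ⟨n, hn⟩ := (hlim.eventually (gt_mem_nhds (by positivity : 0 < κ * dst Ω z'))).exists
    exact hind n t ht0 ht hn.le
  have hsup : ∀ z ∈ Ω, ‖u z‖ ≤ (1 + q) * A := by
    intro z hz
    have hqA : 0 ≤ q * A := by positivity
    by_cases hd : c * ρ / 8 ≤ dst Ω z
    · have := hS z hz hd
      linarith
    push Not at hd
    obtain ⟨e, φ, ch⟩ := D.ch z hz (by nlinarith)
    have h2 := hvert ch z hz (by simp; linarith) (ρ / 8) (by linarith) le_rfl
    obtain ⟨h3, h4⟩ := hball ch z hz (by simp; linarith) (ρ / 8) (by linarith) le_rfl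
    have h5 := hS _ h4 (by linarith)
    have h6 : (ρ / 8) ^ β ≤ 1 := Real.rpow_le_one (by linarith) (by linarith) hβ0.le
    have h7 : A * q * (ρ / 8) ^ β ≤ A * q := mul_le_of_le_one_right (by positivity) h6
    have h8 := norm_sub_norm_le (u z) (u (z + (ρ / 8 : ℝ) * nu e))
    rw [norm_sub_rev] at h8
    linarith
  constructor
  · intro z hz
    refine (hsup z hz).trans ?_
    gcongr
    exact le_max_left _ _
  intro z hz z' hz'
  set h := ‖z - z'‖ with hh
  have hh0 : 0 ≤ h := norm_nonneg _
  by_cases hbig : h1 ≤ h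
  · calc _ ≤ ‖u z‖ + ‖u z'‖ := norm_sub_le _ _
      _ ≤ 2 * (1 + q) / h1 ^ β * A * h1 ^ β := by
        have := hsup z hz
        have := hsup z' hz'
        have : 0 < h1 ^ β := by positivity
        field_simp
        linarith
      _ ≤ 2 * (1 + q) / h1 ^ β * A * h ^ β := by gcongr
      _ ≤ _ := by
        gcongr
        exact (le_max_left _ _).trans (le_max_right _ _)
  push Not at hbig
  have hfin : ‖u z - u z'‖ ≤ (2 * q / (κ * c) ^ β + 1) * A * h ^ β := by
    have hpos : 0 ≤ 2 * q / (κ * c) ^ β := by positivity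
    by_cases hd : ρ ≤ dst Ω z
    · have h2 := hW z hz z' (by
        have : κ * c * ρ ≤ κ * ρ := by
          have : κ * ρ * c ≤ κ * ρ := mul_le_of_le_one_right (by positivity) hc1.le
          linarith
        have : κ * ρ ≤ κ * dst Ω z := by gcongr
        linarith [hh1])
      refine h2.trans ?_
      have : A ≤ (2 * q / (κ * c) ^ β + 1) * A := le_mul_of_one_le_left hA (by linarith)
      gcongr
    push Not at hd
    obtain ⟨e, φ, ch⟩ := D.ch z hz hd
    set t := h / (κ * c) with ht
    have ht0 : 0 ≤ t := by positivity
    have ht1 : t ≤ ρ / 8 := by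
      rw [ht, div_le_iff₀ hkc0]; nlinarith
    have hzz : ‖z' - z‖ < ρ / 8 := by
      rw [norm_sub_rev, ← hh]
      nlinarith
    have a1 := hvert ch z hz (by simp; linarith) t ht0 ht1
    have a2 := hvert ch z' hz' hzz t ht0 ht1
    obtain ⟨a3, a4⟩ := hball ch z hz (by simp; linarith) t ht0 ht1
    have hn : ‖(z + t * nu e) - (z' + t * nu e)‖ = h := by rw [add_sub_add_right_eq_sub]
    have a5 := hW _ a4 (z' + t * nu e) (by
      rw [hn]
      have : h = κ * (c * t) := by rw [ht]; field_simp
      rw [this]; gcongr)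
    rw [hn] at a5
    have htb : t ^ β = h ^ β / (κ * c) ^ β := Real.div_rpow hh0 hkc0.le β
    have : u z - u z' = -(u (z + t * nu e) - u z) + (u (z + t * nu e) - u (z' + t * nu e))
      + (u (z' + t * nu e) - u z') := by ring
    rw [this]
    refine norm_add₃_le.trans ?_
    rw [norm_neg]
    calc _ ≤ A * q * t ^ β + A * h ^ β + A * q * t ^ β := by linarith
      _ = _ := by rw [htb]; field_simp; ring
  refine hfin.trans ?_
  gcongr
  exact (le_max_right _ _).trans (le_max_right _ _)

/-! ### Half plane integrals -/

/-- Holomorphic on the closed upper half plane with quadratic decay. -/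
def LZ (F : ℂ → ℂ) : Prop :=
  (∀ ξ : ℂ, 0 ≤ ξ.im → DifferentiableAt ℂ F ξ) ∧
    ∃ R C : ℝ, 1 ≤ R ∧ 0 ≤ C ∧ ∀ ξ : ℂ, 0 ≤ ξ.im → R ≤ ‖ξ‖ → ‖F ξ‖ ≤ C / ‖ξ‖ ^ 2

lemma LZ.sub {F G : ℂ → ℂ} (hF : LZ F) (hG : LZ G) : LZ (fun ξ => F ξ - G ξ) := by
  obtain ⟨hF1, R, C, hR, hC, hF2⟩ := hF
  obtain ⟨hG1, R', C', hR', hC', hG2⟩ := hG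
  refine ⟨fun ξ hξ => (hF1 ξ hξ).sub (hG1 ξ hξ), max R R', C + C', hR.trans (le_max_left _ _),
    by positivity, fun ξ hξ hn => ?_⟩
  rw [add_div]
  exact (norm_sub_le _ _).trans (add_le_add (hF2 ξ hξ ((le_max_left _ _).trans hn))
    (hG2 ξ hξ ((le_max_right _ _).trans hn)))

lemma LZ.mul {F G : ℂ → ℂ} (hF : LZ F) (hG : LZ G) : LZ (fun ξ => F ξ * G ξ) := by
  obtain ⟨hF1, R, C, hR, hC, hF2⟩ := hF
  obtain ⟨hG1, R', C', hR', hC', hG2⟩ := hG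
  refine ⟨fun ξ hξ => (hF1 ξ hξ).mul (hG1 ξ hξ), max R R', C * C', hR.trans (le_max_left _ _),
    by positivity, fun ξ hξ hn => ?_⟩
  have h1 : 1 ≤ ‖ξ‖ := (hR.trans (le_max_left _ _)).trans hn
  rw [norm_mul]
  calc _ ≤ C / ‖ξ‖ ^ 2 * (C' / ‖ξ‖ ^ 2) := by
        gcongr
        · exact hF2 ξ hξ ((le_max_left _ _).trans hn)
        · exact hG2 ξ hξ ((le_max_right _ _).trans hn)
    _ ≤ C / ‖ξ‖ ^ 2 * (C' / 1) := by
        gcongr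
        exact one_le_pow₀ h1
    _ = _ := by ring

lemma LZ.const_mul {F : ℂ → ℂ} (c : ℂ) (hF : LZ F) : LZ (fun ξ => c * F ξ) := by
  obtain ⟨hF1, R, C, hR, hC, hF2⟩ := hF
  refine ⟨fun ξ hξ => (hF1 ξ hξ).const_mul c, R, ‖c‖ * C, hR, by positivity, fun ξ hξ hn => ?_⟩
  rw [norm_mul, mul_div_assoc]
  gcongr
  exact hF2 ξ hξ hn

lemma LZ.zero {F : ℂ → ℂ} (hF : LZ F) : ∫ x : ℝ, F x = 0 := by
  by_cases hi : Integrable (fun x : ℝ => F x)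
  swap
  · exact integral_undef hi
  obtain ⟨hF1, R0, C, hR0, hC, hF2⟩ := hF
  have h1 := intervalIntegral_tendsto_integral hi (tendsto_neg_atTop_atBot) tendsto_id
    (l := (atTop : Filter ℝ))
  have h2 : Tendsto (fun R : ℝ => ∫ x : ℝ in (-R)..R, F x) atTop (𝓝 0) := by
    have hb : Tendsto (fun R : ℝ => 4 * C / R) atTop (𝓝 0) := tendsto_const_nhds.div_atTop tendsto_id
    refine squeeze_zero_norm' ?_ hb
    filter_upwards [eventually_ge_atTop R0] with R hR
    have hRp : 0 < R := by linarith
    have hrect := Complex.integral_boundary_rect_eq_zero_of_differentiableOn F (-R : ℂ) (R + R * Complex.I)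
      (by
        intro ξ hξ
        refine (hF1 ξ ?_).differentiableWithinAt
        have := hξ.2
        simp [uIcc_of_le hRp.le] at this
        exact this.1)
    simp at hrect
    have b1 : ‖∫ x : ℝ in (-R)..R, F (x + R * Complex.I)‖ ≤ C / R ^ 2 * |R - (-R)| := by
      refine intervalIntegral.norm_integral_le_of_norm_le_const fun x _ => ?_
      have hn : R ≤ ‖(x + R * Complex.I : ℂ)‖ := by
        have := Complex.abs_im_le_norm (x + R * Complex.I : ℂ)
        simp [abs_of_pos hRp] at this
        exact this
      refine (hF2 _ (by simp; linarith) (hR.trans hn)).trans (by gcongr)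
    have b2 : ‖∫ y : ℝ in (0:ℝ)..R, F (R + y * Complex.I)‖ ≤ C / R ^ 2 * |R - 0| := by
      refine intervalIntegral.norm_integral_le_of_norm_le_const fun y hy => ?_
      rw [uIoc_of_le hRp.le] at hy
      have hn : R ≤ ‖(R + y * Complex.I : ℂ)‖ := by
        have := Complex.abs_re_le_norm (R + y * Complex.I : ℂ)
        simp [abs_of_pos hRp] at this
        exact this
      refine (hF2 _ (by simp; linarith [hy.1]) (hR.trans hn)).trans (by gcongr)
    have b3 : ‖∫ y : ℝ in (0:ℝ)..R, F (-R + y * Complex.I)‖ ≤ C / R ^ 2 * |R - 0| := by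
      refine intervalIntegral.norm_integral_le_of_norm_le_const fun y hy => ?_
      rw [uIoc_of_le hRp.le] at hy
      have hn : R ≤ ‖(-R + y * Complex.I : ℂ)‖ := by
        have := Complex.abs_re_le_norm (-R + y * Complex.I : ℂ)
        simp [abs_of_pos hRp] at this
        exact this
      refine (hF2 _ (by simp; linarith [hy.1]) (hR.trans hn)).trans (by gcongr)
    have e1 : ∫ x : ℝ in (-R)..R, F x = (∫ x : ℝ in (-R)..R, F (x + R * Complex.I))
      - Complex.I * (∫ y : ℝ in (0:ℝ)..R, F (R + y * Complex.I))
      + Complex.I * ∫ y : ℝ in (0:ℝ)..R, F (-R + y * Complex.I) := by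
      linear_combination hrect
    rw [e1]
    refine (norm_add_le _ _).trans ((add_le_add (norm_sub_le _ _) le_rfl).trans ?_)
    rw [norm_mul, norm_mul, Complex.norm_I, one_mul, one_mul]
    rw [show R - -R = 2 * R by ring, abs_of_pos (by positivity)] at b1
    rw [sub_zero, abs_of_pos hRp] at b2 b3
    calc _ ≤ C / R ^ 2 * (2 * R) + C / R ^ 2 * R + C / R ^ 2 * R := by linarith
      _ = _ := by field_simp; ring
  exact tendsto_nhds_unique h1 h2

/-- extension of the kernel from a horizontal line -/
def gk (k : ℕ) (Z : ℂ) (t : ℝ) (ξ : ℂ) : ℂ :=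
  ((-1 : ℂ) ^ k * k / Real.pi) * ((ξ - ((starRingEnd ℂ) Z + t * Complex.I)) ^ (k - 1)
    / (ξ - (Z - t * Complex.I)) ^ (k + 1))

lemma gk_eq {k : ℕ} (hk : 1 ≤ k) (Z : ℂ) (t x : ℝ) :
    bnKer k (Z - (x + t * Complex.I)) = gk k Z t x := by
  unfold bnKer gk
  have h1 : (starRingEnd ℂ) (Z - (x + t * Complex.I))
    = -1 * (x - ((starRingEnd ℂ) Z + t * Complex.I)) := by simp; ring
  have h2 : Z - (x + t * Complex.I) = -1 * (x - (Z - t * Complex.I)) := by ring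
  rw [h1, h2, mul_pow, mul_pow]
  obtain ⟨m, rfl⟩ : ∃ m, k = m + 1 := ⟨k - 1, by omega⟩
  simp only [add_tsub_cancel_right]
  rw [show (-1 : ℂ) ^ (m + 1 + 1) = (-1) ^ m by rw [pow_succ, pow_succ]; ring]
  have h3 : (-1 : ℂ) ^ m ≠ 0 := pow_ne_zero _ (by norm_num)
  rw [mul_div_assoc, mul_div_mul_left _ _ h3]

lemma gk_LZ {k : ℕ} (hk : 1 ≤ k) {Z : ℂ} {t : ℝ} (h : Z.im < t) : LZ (gk k Z t) := by
  unfold gk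
  refine LZ.const_mul _ ?_
  set a := (starRingEnd ℂ) Z + t * Complex.I
  set b := Z - t * Complex.I
  have hb : b.im < 0 := by simp [b]; exact h
  obtain ⟨m, rfl⟩ : ∃ m, k = m + 1 := ⟨k - 1, by omega⟩
  simp only [add_tsub_cancel_right]
  refine ⟨fun ξ hξ => ?_, 2 * (‖a‖ + ‖b‖ + 1), 2 ^ m * 2 ^ (m + 2), ?_, by positivity, ?_⟩
  · have : ξ - b ≠ 0 := by
      intro h0
      have := congrArg Complex.im h0
      simp only [Complex.sub_im, Complex.zero_im] at this
      linarith
    have h2 : (ξ - b) ^ (m + 1 + 1) ≠ 0 := pow_ne_zero _ this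
    fun_prop (disch := assumption)
  · have := norm_nonneg a
    have := norm_nonneg b
    linarith
  · intro ξ hξ hn
    have na := norm_nonneg a
    have nb := norm_nonneg b
    have h1 : ‖ξ - a‖ ≤ 2 * ‖ξ‖ := (norm_sub_le _ _).trans (by linarith)
    have h2 : ‖ξ‖ / 2 ≤ ‖ξ - b‖ := by
      have := norm_sub_norm_le ξ b
      linarith
    have h3 : 0 < ‖ξ‖ := by linarith
    rw [norm_div, norm_pow, norm_pow]
    calc _ ≤ (2 * ‖ξ‖) ^ m / (‖ξ‖ / 2) ^ (m + 1 + 1) := by gcongr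
      _ = _ := by
        rw [mul_pow, div_pow]
        field_simp
        ring

lemma half_zero0 {f : ℂ → ℂ} {t0 : ℝ}
    (h : ∀ t : ℝ, t0 < t → ∃ F, LZ F ∧ ∀ x : ℝ, f (x + t * Complex.I) = F x) :
    ∫ ζ in {ζ : ℂ | t0 < ζ.im}, f ζ = 0 := by
  have hm : MeasurableSet {ζ : ℂ | t0 < ζ.im} :=
    measurableSet_lt measurable_const Complex.measurable_im
  rw [← integral_indicator hm]
  by_cases hi : Integrable ({ζ : ℂ | t0 < ζ.im}.indicator f)
  swap
  · exact integral_undef hi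
  have hmp := Complex.volume_preserving_equiv_real_prod.symm
  have e1 := hmp.integral_comp Complex.measurableEquivRealProd.symm.measurableEmbedding
    ({ζ : ℂ | t0 < ζ.im}.indicator f)
  have hi2 := (hmp.integrable_comp_emb
    Complex.measurableEquivRealProd.symm.measurableEmbedding).2 hi
  rw [← e1]
  have e2 := integral_prod_symm (μ := (volume : Measure ℝ)) (ν := (volume : Measure ℝ)) _ hi2
  refine Eq.trans e2 ?_
  have : ∀ y : ℝ, ∫ x : ℝ, ({ζ : ℂ | t0 < ζ.im}.indicator f ∘
      ⇑Complex.measurableEquivRealProd.symm) (x, y) = 0 := by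
    intro y
    have e3 : ∀ x : ℝ, Complex.measurableEquivRealProd.symm (x, y) = x + y * Complex.I := by
      intro x
      apply Complex.ext <;> simp
    simp only [Function.comp, e3]
    by_cases hy : t0 < y
    · obtain ⟨F, hF, hF2⟩ := h y hy
      rw [← hF.zero]
      congr 1
      ext x
      rw [indicator_of_mem (by simpa using hy), hF2]
    · have : ∀ x : ℝ, {ζ : ℂ | t0 < ζ.im}.indicator f (x + y * Complex.I) = 0 := fun x =>
        indicator_of_notMem (by simpa using hy) _
      simp [this]
  simp only [this, integral_zero]

lemma half_zero1 {f : ℂ → ℂ} {e : ℂ} (he : ‖e‖ = 1) {t0 : ℝ}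
    (h : ∀ t : ℝ, t0 < t → ∃ F, LZ F ∧ ∀ x : ℝ, f ((starRingEnd ℂ) e * (x + t * Complex.I)) = F x) :
    ∫ ζ in {ζ : ℂ | t0 < (e * ζ).im}, f ζ = 0 := by
  have h2 := half_zero0 (f := fun ξ => f ((starRingEnd ℂ) e * ξ)) h
  have hm : MeasurableSet {ζ : ℂ | t0 < ζ.im} :=
    measurableSet_lt measurable_const Complex.measurable_im
  have hm' : MeasurableSet {ζ : ℂ | t0 < (e * ζ).im} :=
    measurableSet_lt measurable_const (Complex.measurable_im.comp (by fun_prop))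
  rw [← integral_indicator hm] at h2
  rw [← integral_indicator hm', ← h2,
    ← integral_rot_eq e he ({ζ : ℂ | t0 < ζ.im}.indicator fun ξ => f ((starRingEnd ℂ) e * ξ))]
  congr 1
  ext ζ
  have hee : (starRingEnd ℂ) e * (e * ζ) = ζ := by
    rw [← mul_assoc, mul_comm _ e, Complex.mul_conj, Complex.normSq_eq_norm_sq, he]; simp
  by_cases hζ : t0 < (e * ζ).im
  · rw [indicator_of_mem (by exact hζ), indicator_of_mem (by exact hζ), hee]
  · rw [indicator_of_notMem (by exact hζ), indicator_of_notMem (by exact hζ)]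

lemma bn_line {k : ℕ} (hk : 1 ≤ k) {e : ℂ} (he : ‖e‖ = 1) (z : ℂ) (t x : ℝ) :
    bnKer k (z - (starRingEnd ℂ) e * (x + t * Complex.I)) = e ^ (2 * k) * gk k (e * z) t x := by
  have hee : (starRingEnd ℂ) e * (e * z) = z := by
    rw [← mul_assoc, mul_comm _ e, Complex.mul_conj, Complex.normSq_eq_norm_sq, he]; simp
  have h1 := bn_rot hk (ω := (starRingEnd ℂ) e) (by simpa using he) (e * z - (x + t * Complex.I))
  rw [Complex.conj_conj] at h1
  rw [← gk_eq hk, ← h1, mul_sub, hee]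

lemma bn_even {k : ℕ} (hk : 1 ≤ k) (u : ℂ) : bnKer k (-u) = bnKer k u := by
  have := bn_rot hk (ω := -1) (by simp) u
  simpa using this

/-- The half plane with linear functional `E`. -/
def HP (E : ℂ) (t0 : ℝ) : Set ℂ := {ζ : ℂ | t0 < (E * ζ).im}

lemma HP_meas (E : ℂ) (t0 : ℝ) : MeasurableSet (HP E t0) :=
  measurableSet_lt measurable_const (Complex.measurable_im.comp (by fun_prop))

lemma HP_unit {E : ℂ} (hE : E ≠ 0) (t0 : ℝ) : HP E t0 = {ζ : ℂ | t0 / ‖E‖ < (E / ‖E‖ * ζ).im} := by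
  have hp : 0 < ‖E‖ := by simpa using hE
  ext ζ
  have : (E / ‖E‖ * ζ).im = (E * ζ).im / ‖E‖ := by
    rw [div_mul_eq_mul_div, Complex.div_ofReal_im]
  simp only [HP, mem_ofPred_eq, this]
  rw [div_lt_div_iff_of_pos_right hp]

lemma unit_im_le {E : ℂ} (hE : E ≠ 0) {t0 : ℝ} {z : ℂ} (h : (E * z).im ≤ t0) :
    (E / ‖E‖ * z).im ≤ t0 / ‖E‖ := by
  have hp : 0 < ‖E‖ := by simpa using hE
  rw [div_mul_eq_mul_div, Complex.div_ofReal_im]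
  gcongr

lemma HP_zero2 {k : ℕ} (hk : 1 ≤ k) {E : ℂ} (hE : E ≠ 0) {t0 : ℝ} {z z1 : ℂ}
    (hz : (E * z).im ≤ t0) (hz1 : (E * z1).im ≤ t0) :
    ∫ ζ in HP E t0, (bnKer k (z - ζ) - bnKer k (z1 - ζ)) = 0 := by
  have he : ‖E / ‖E‖‖ = 1 := by simp [hE]
  rw [HP_unit hE]
  apply half_zero1 he
  intro t ht
  refine ⟨_, ((gk_LZ hk ((unit_im_le hE hz).trans_lt ht)).const_mul ((E / ‖E‖) ^ (2 * k))).sub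
    ((gk_LZ hk ((unit_im_le hE hz1).trans_lt ht)).const_mul ((E / ‖E‖) ^ (2 * k))), fun x => ?_⟩
  rw [bn_line hk he, bn_line hk he]

lemma HP_zero1 {m : ℕ} (hm : 1 ≤ m) {E : ℂ} (hE : E ≠ 0) {t0 : ℝ} {z z1 w : ℂ}
    (hz : (E * z).im ≤ t0) (hz1 : (E * z1).im ≤ t0) (hw : (E * w).im ≤ t0) :
    ∫ ζ in HP E t0, (bnKer 1 (z - ζ) - bnKer 1 (z1 - ζ)) * bnKer m (ζ - w) = 0 := by
  have he : ‖E / ‖E‖‖ = 1 := by simp [hE]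
  rw [HP_unit hE]
  apply half_zero1 he
  intro t ht
  refine ⟨_, (((gk_LZ le_rfl ((unit_im_le hE hz).trans_lt ht)).const_mul ((E / ‖E‖) ^ (2 * 1))).sub
    ((gk_LZ le_rfl ((unit_im_le hE hz1).trans_lt ht)).const_mul ((E / ‖E‖) ^ (2 * 1)))).mul
      ((gk_LZ hm ((unit_im_le hE hw).trans_lt ht)).const_mul ((E / ‖E‖) ^ (2 * m))), fun x => ?_⟩
  rw [bn_line le_rfl he, bn_line le_rfl he, ← bn_even hm, neg_sub, bn_line hm he]

/-- the tangent functional -/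
def tanE (z e : ℂ) (φ : ℝ → ℝ) : ℂ := e * (1 - deriv φ (e * z).re * Complex.I)
def tanT (z e : ℂ) (φ : ℝ → ℝ) : ℝ := φ (e * z).re - deriv φ (e * z).re * (e * z).re

lemma sht_eq (z e : ℂ) (φ : ℝ → ℝ) (ζ : ℂ) :
    sht z e φ ζ = (tanE z e φ * ζ).im - tanT z e φ := by
  have : tanE z e φ * ζ = e * ζ - deriv φ (e * z).re * (Complex.I * (e * ζ)) := by
    unfold tanE; ring
  rw [this, Complex.sub_im, Complex.im_ofReal_mul, Complex.I_mul_im, sht, tanT]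
  ring

lemma tanE_ne {z e : ℂ} (he : ‖e‖ = 1) (φ : ℝ → ℝ) : tanE z e φ ≠ 0 := by
  unfold tanE
  have h0 : e ≠ 0 := by intro h; simp [h] at he
  refine mul_ne_zero h0 fun h => ?_
  have := congrArg Complex.re h
  simp at this

lemma mem_HP_iff (z e : ℂ) (φ : ℝ → ℝ) (ζ : ℂ) :
    ζ ∈ HP (tanE z e φ) (tanT z e φ) ↔ 0 < sht z e φ ζ := by
  rw [sht_eq, sub_pos]; rfl

/-! ### The tangent half plane comparison -/

lemma int_sub_sets {f : ℂ → ℂ} {S T : Set ℂ} (hS : MeasurableSet S) (hT : MeasurableSet T)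
    (h1 : IntegrableOn f S) (h2 : IntegrableOn f T) :
    (∫ w in S, f w) - ∫ w in T, f w = (∫ w in S \ T, f w) - ∫ w in T \ S, f w := by
  rw [← integral_inter_add_sdiff hT h1, ← integral_inter_add_sdiff hS h2, inter_comm]
  ring

/-- the thin set -/
def Wset (Ω : Set ℂ) (L : ℝ) (z e : ℂ) (φ : ℝ → ℝ) (τ : ℝ) : Set ℂ :=
  {ζ | (ζ ∈ Ω ∧ -((1 + L) * τ) < sht z e φ ζ) ∨ (ζ ∉ Ω ∧ sht z e φ ζ ≤ 0)}

lemma Wset_meas {Ω : Set ℂ} (ho : IsOpen Ω) (L : ℝ) (z e : ℂ) (φ : ℝ → ℝ) (τ : ℝ) :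
    MeasurableSet (Wset Ω L z e φ τ) := by
  have hs := (sht_cont z e φ).measurable
  exact (ho.measurableSet.inter (measurableSet_lt measurable_const hs)).union
    (ho.measurableSet.compl.inter (measurableSet_le hs measurable_const))

lemma cpow3 (z w : ℂ) : ‖z - w‖ ^ (-2 - 1 : ℝ) = 1 / ‖z - w‖ ^ 3 := by
  rw [show (-2 - 1 : ℝ) = -((3 : ℕ) : ℝ) by norm_num, Real.rpow_neg (norm_nonneg _),
    Real.rpow_natCast, one_div]

lemma compl3_integrable (z : ℂ) {r : ℝ} (hr : 0 < r) :
    IntegrableOn (fun w : ℂ => 1 / ‖z - w‖ ^ 3) (ball z r)ᶜ := by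
  have := compl_pow_integrable one_pos z hr
  simpa only [cpow3] using this

lemma compl3_integral (z : ℂ) {r : ℝ} (hr : 0 < r) :
    ∫ w in (ball z r)ᶜ, 1 / ‖z - w‖ ^ 3 = 2 * Real.pi / r := by
  have := compl_pow_integral one_pos z hr
  simp only [cpow3] at this
  rw [this, Real.rpow_neg hr.le, Real.rpow_one]
  ring

lemma Wset_far {ε Ω ρ L} (D : Dom ε Ω ρ L) {z : ℂ} (hz : z ∈ Ω) (hd : dst Ω z < ρ)
    {e φ} (h : Chart ε Ω z ρ L e φ) {τ : ℝ}  (hτ2 : τ ≤ dst Ω z / (2 * (1 + L))) {ζ : ℂ}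
    (hζ : ζ ∈ Wset Ω L z e φ τ) : 1 / (2 * (1 + L)) * dst Ω z ≤ ‖z - ζ‖ := by
  have hL := D.L1
  have hd0 := dst_nonneg Ω z
  have h2 := h.T2 D.r0 hz hd
  rcases hζ with ⟨_, h1⟩ | ⟨h1, _⟩
  · have h3 := h.T1 ζ z
    have h4 := (le_abs_self _).trans h3
    rw [norm_sub_rev] at h4
    rw [le_div_iff₀ (by positivity)] at hτ2
    rw [one_div, inv_mul_le_iff₀ (by positivity)]
    nlinarith
  · refine le_trans ?_ (dst_le_of_notMem h1)
    refine mul_le_of_le_one_left hd0 ?_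
    rw [div_le_one (by positivity)]
    linarith

lemma thinW {ε Ω ρ L} (D : Dom ε Ω ρ L) : ∃ C : ℝ, 0 ≤ C ∧ ∀ z ∈ Ω, dst Ω z < ρ → ∀ e φ,
    Chart ε Ω z ρ L e φ → ∀ τ : ℝ, 0 ≤ τ → τ ≤ dst Ω z ^ (1 + ε) → τ ≤ dst Ω z / (2 * (1 + L)) →
    IntegrableOn (fun ζ => 1 / ‖z - ζ‖ ^ 3) (Wset Ω L z e φ τ) ∧
    ∫ ζ in Wset Ω L z e φ τ, 1 / ‖z - ζ‖ ^ 3 ≤ C * dst Ω z ^ (ε - 1) := by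
  have hL := D.L1
  have hε0 := D.e0
  have hε1 := D.e1
  have hρ := D.r0
  have h1ε : 0 < 1 - ε := by linarith
  refine ⟨32 * (1 + L) / ((1 / (2 * (1 + L))) ^ 3 * (1 - ε)) + 2 * Real.pi / ρ, by positivity, ?_⟩
  intro z hz hd e φ h τ hτ0 hτ1 hτ2
  have hdp := dst_pos D.op D.bdd hz
  set W := Wset Ω L z e φ τ
  have hW : MeasurableSet W := Wset_meas D.op L z e φ τ
  have hc1 : 1 / (2 * (1 + L)) ≤ 1 := by rw [div_le_one (by positivity)]; linarith
  have t1 := thin_bound (ε := ε) hε1 (z := z) h.e1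
    (l := fun x => φ (e * z).re + deriv φ (e * z).re * (x - (e * z).re)) (by fun_prop)
    (A := 1 + L) (c := 1 / (2 * (1 + L))) (d := dst Ω z) (by positivity) (by positivity) hc1 hdp
    (N := W ∩ ball z ρ) (hW.inter measurableSet_ball) (by
      intro ζ hζ
      refine ⟨?_, Wset_far D hz hd h hτ2 hζ.1⟩
      set X := |(e * ζ).re - (e * z).re|
      have hX : 0 ≤ X := abs_nonneg _
      have e1 : L * X ^ (1 + ε) ≤ (1 + L) * (X + dst Ω z) ^ (1 + ε) := by
        gcongr <;> linarith
      have e2 : (1 + L) * τ ≤ (1 + L) * (X + dst Ω z) ^ (1 + ε) := by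
        gcongr
        refine hτ1.trans ?_
        gcongr; linarith
      have e3 : 0 ≤ (1 + L) * (X + dst Ω z) ^ (1 + ε) := by positivity
      change |sht z e φ ζ| ≤ _
      rcases hζ.1 with ⟨q1, q2⟩ | ⟨q1, q2⟩
      · have := h.T4 (by linarith) hε0 hζ.2 q1
        rw [abs_le]; constructor <;> linarith
      · have := h.T3 (by linarith) hε0 hζ.2 q1
        rw [abs_le]; constructor <;> linarith)
  have t2 : IntegrableOn (fun ζ => 1 / ‖z - ζ‖ ^ 3) (W \ ball z ρ) :=
    (compl3_integrable z hρ).mono_set fun x hx => hx.2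
  have t3 : ∫ ζ in W \ ball z ρ, 1 / ‖z - ζ‖ ^ 3 ≤ 2 * Real.pi / ρ := by
    rw [← compl3_integral z hρ]
    refine setIntegral_mono_set (compl3_integrable z hρ) (ae_of_all _ fun _ => by positivity) ?_
    exact LE.le.eventuallyLE fun x hx => hx.2
  have t4 : IntegrableOn (fun ζ => 1 / ‖z - ζ‖ ^ 3) W := by
    rw [← inter_union_sdiff W (ball z ρ)]
    exact t1.1.union t2
  refine ⟨t4, ?_⟩
  rw [← integral_inter_add_sdiff measurableSet_ball t4, add_mul]
  refine add_le_add t1.2 (t3.trans (le_mul_of_one_le_right (by positivity) ?_))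
  exact Real.one_le_rpow_of_pos_of_le_one_of_nonpos hdp (hd.le.trans D.r1) (by linarith)

/-- the difference kernel -/
lemma bn_diff' {k : ℕ} (hk : 1 ≤ k) {z z1 w : ℂ} (h : ‖z - z1‖ ≤ ‖z - w‖ / 2) :
    ‖bnKer k (z - w) - bnKer k (z1 - w)‖ ≤ BK k * ‖z - z1‖ * (1 / ‖z - w‖ ^ 3) := by
  have e1 : (z - w) - (z1 - w) = z - z1 := by ring
  have := bn_diff hk (u := z - w) (v := z1 - w) (by rw [e1]; exact h)
  rw [e1] at this
  rw [mul_one_div]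
  exact this

lemma dk_meas (k : ℕ) (z z1 : ℂ) : Measurable (fun w => bnKer k (z - w) - bnKer k (z1 - w)) :=
  ((bn_meas k).comp (measurable_const.sub measurable_id)).sub
    ((bn_meas k).comp (measurable_const.sub measurable_id))

lemma dk_integrable {k : ℕ} (hk : 1 ≤ k) {z z1 : ℂ} {S : Set ℂ} (hS : MeasurableSet S)
    (hi : IntegrableOn (fun ζ => 1 / ‖z - ζ‖ ^ 3) S) (hf : ∀ w ∈ S, ‖z - z1‖ ≤ ‖z - w‖ / 2) :
    IntegrableOn (fun w => bnKer k (z - w) - bnKer k (z1 - w)) S := by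
  refine Integrable.mono' (hi.const_mul (BK k * ‖z - z1‖)) (dk_meas k z z1).aestronglyMeasurable ?_
  exact (ae_restrict_iff' hS).2 (ae_of_all _ fun w hw => bn_diff' hk (hf w hw))

lemma dk_bound {k : ℕ} (hk : 1 ≤ k) {z z1 : ℂ} {S : Set ℂ} (hS : MeasurableSet S)
    (hi : IntegrableOn (fun ζ => 1 / ‖z - ζ‖ ^ 3) S) (hf : ∀ w ∈ S, ‖z - z1‖ ≤ ‖z - w‖ / 2) :
    ‖∫ w in S, (bnKer k (z - w) - bnKer k (z1 - w))‖ ≤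
      BK k * ‖z - z1‖ * ∫ w in S, 1 / ‖z - w‖ ^ 3 := by
  rw [← integral_const_mul]
  refine norm_integral_le_of_norm_le (hi.const_mul _) ?_
  exact (ae_restrict_iff' hS).2 (ae_of_all _ fun w hw => bn_diff' hk (hf w hw))

lemma compl_far (Ω : Set ℂ) (z : ℂ) : Ωᶜ ⊆ (ball z (dst Ω z))ᶜ :=
  compl_subset_compl.2 (dst_ball Ω z)

/-- points of the half plane are far from `z` -/
lemma HP_far {ε Ω ρ L} (D : Dom ε Ω ρ L) {z : ℂ} (hz : z ∈ Ω) (hd : dst Ω z < ρ)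
    {e φ} (h : Chart ε Ω z ρ L e φ) :
    HP (tanE z e φ) (tanT z e φ) ⊆ (ball z (dst Ω z / (1 + L)))ᶜ := by
  have hL := D.L1
  intro ζ hζ hb
  rw [mem_HP_iff] at hζ
  have h2 := h.T2 D.r0 hz hd
  have h4 := (le_abs_self _).trans (h.T1 ζ z)
  rw [mem_ball, dist_eq_norm, lt_div_iff₀ (by positivity)] at hb
  nlinarith

lemma HP_near {ε Ω ρ L} (D : Dom ε Ω ρ L) {z z1 : ℂ} (hz : z ∈ Ω) (hd : dst Ω z < ρ)
    {e φ} (h : Chart ε Ω z ρ L e φ) (h1 : ‖z - z1‖ ≤ dst Ω z / (1 + L)) :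
    (tanE z e φ * z1).im ≤ tanT z e φ := by
  have hL := D.L1
  have h2 := h.T2 D.r0 hz hd
  have h4 := (le_abs_self _).trans (h.T1 z1 z)
  rw [le_div_iff₀ (by positivity)] at h1
  have := sht_eq z e φ z1
  rw [norm_sub_rev] at h4
  nlinarith

/-- Whitney constant -/
def kap (L : ℝ) : ℝ := 1 / (8 * (1 + L))
lemma kap_pos {L : ℝ} (hL : 1 ≤ L) : 0 < kap L := by unfold kap; positivity
lemma kap_le {L : ℝ} (hL : 1 ≤ L) : kap L ≤ 1 / 16 := by
  unfold kap; exact one_div_le_one_div_of_le (by norm_num) (by linarith)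

lemma kap_mul {L d h : ℝ} (hL : 1 ≤ L) (hd : 0 ≤ d) (hh : h ≤ kap L * d) :
    h ≤ d / 16 ∧ h ≤ d / (1 + L) ∧ h ≤ d / (1 + L) / 2 ∧ h ≤ 1 / (2 * (1 + L)) * d / 2 := by
  have := kap_le hL
  have h0 : 0 ≤ d / (1 + L) := by positivity
  have e1 : kap L * d = d / (1 + L) / 8 := by unfold kap; field_simp
  have e2 : 1 / (2 * (1 + L)) * d / 2 = d / (1 + L) / 4 := by field_simp; ring
  refine ⟨?_, ?_, ?_, ?_⟩
  · nlinarith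
  · linarith
  · linarith
  · rw [e2]; linarith

lemma ext_diff {ε Ω ρ L} (D : Dom ε Ω ρ L) {k : ℕ} (hk : 1 ≤ k) : ∃ C : ℝ, 0 ≤ C ∧ ∀ z ∈ Ω, ∀ z1,
    ‖z - z1‖ ≤ kap L * dst Ω z →
    IntegrableOn (fun w => bnKer k (z - w) - bnKer k (z1 - w)) Ωᶜ ∧
    ‖∫ w in Ωᶜ, (bnKer k (z - w) - bnKer k (z1 - w))‖ ≤ C * ‖z - z1‖ * dst Ω z ^ (ε - 1) := by
  have hL := D.L1
  have hε0 := D.e0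
  have hρ := D.r0
  obtain ⟨C, hC, hT⟩ := thinW D
  have hB := BK_nonneg k
  refine ⟨BK k * C + BK k * C + BK k * (2 * Real.pi * ρ ^ (-ε)), by positivity, ?_⟩
  intro z hz z1 hzz
  have hdp := dst_pos D.op D.bdd hz
  obtain ⟨k1, k2, k3, k4⟩ := kap_mul hL hdp.le hzz
  have hcm : MeasurableSet Ωᶜ := D.op.measurableSet.compl
  have hci : IntegrableOn (fun ζ => 1 / ‖z - ζ‖ ^ 3) Ωᶜ :=
    (compl3_integrable z hdp).mono_set (compl_far Ω z)
  have hcf : ∀ w ∈ Ωᶜ, ‖z - z1‖ ≤ ‖z - w‖ / 2 := fun w hw => by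
    have := dst_le_of_notMem (z := z) hw
    linarith
  have hI := dk_integrable hk hcm hci hcf
  refine ⟨hI, ?_⟩
  have hn := norm_nonneg (z - z1)
  have hp : 0 < dst Ω z ^ (ε - 1) := by positivity
  by_cases hd : dst Ω z < ρ
  · obtain ⟨e, φ, h⟩ := D.ch z hz hd
    set H := HP (tanE z e φ) (tanT z e φ)
    have hHm : MeasurableSet H := HP_meas _ _
    have hHf := HP_far D hz hd h
    have hHi : IntegrableOn (fun ζ => 1 / ‖z - ζ‖ ^ 3) H :=
      (compl3_integrable z (by positivity)).mono_set hHf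
    have hHff : ∀ w ∈ H, ‖z - z1‖ ≤ ‖z - w‖ / 2 := fun w hw => by
      have := hHf hw
      rw [mem_compl_iff, mem_ball, dist_comm, dist_eq_norm, not_lt] at this
      linarith
    have hz0 : ∫ w in H, (bnKer k (z - w) - bnKer k (z1 - w)) = 0 :=
      HP_zero2 hk (tanE_ne h.e1 φ) (HP_near D hz hd h (by simp; positivity)) (HP_near D hz hd h k2)
    have e1 := int_sub_sets hcm hHm hI (dk_integrable hk hHm hHi hHff)
    rw [hz0, sub_zero] at e1
    obtain ⟨w1, w2⟩ := hT z hz hd e φ h 0 le_rfl (by positivity) (by positivity)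
    have s1 : Ωᶜ \ H ⊆ Wset Ω L z e φ 0 := fun ζ hζ => by
      right
      refine ⟨hζ.1, ?_⟩
      have := hζ.2
      rw [mem_HP_iff] at this
      linarith
    have s2 : H \ Ωᶜ ⊆ Wset Ω L z e φ 0 := fun ζ hζ => by
      left
      refine ⟨not_not.1 hζ.2, ?_⟩
      have := hζ.1
      rw [mem_HP_iff] at this
      linarith
    have b1 := dk_bound hk (hcm.diff hHm) (w1.mono_set s1) (z1 := z1) fun w hw => hcf w hw.1
    have b2 := dk_bound hk (hHm.diff hcm) (w1.mono_set s2) (z1 := z1) fun w hw => hHff w hw.1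
    have m1 : ∫ w in Ωᶜ \ H, 1 / ‖z - w‖ ^ 3 ≤ C * dst Ω z ^ (ε - 1) :=
      (setIntegral_mono_set w1 (ae_of_all _ fun _ => by positivity) s1.eventuallyLE).trans w2
    have m2 : ∫ w in H \ Ωᶜ, 1 / ‖z - w‖ ^ 3 ≤ C * dst Ω z ^ (ε - 1) :=
      (setIntegral_mono_set w1 (ae_of_all _ fun _ => by positivity) s2.eventuallyLE).trans w2
    rw [e1]
    calc _ ≤ BK k * ‖z - z1‖ * (C * dst Ω z ^ (ε - 1)) + BK k * ‖z - z1‖ * (C * dst Ω z ^ (ε - 1)) := by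
          refine (norm_sub_le _ _).trans (add_le_add (b1.trans ?_) (b2.trans ?_)) <;> gcongr
      _ ≤ (BK k * C + BK k * C) * ‖z - z1‖ * dst Ω z ^ (ε - 1) := by ring_nf; rfl
      _ ≤ _ := by
        gcongr ?_ * _ * _
        have : 0 ≤ BK k * (2 * Real.pi * ρ ^ (-ε)) := by positivity
        linarith
  · push Not at hd
    have b1 := dk_bound hk hcm hci hcf
    have m1 : ∫ w in Ωᶜ, 1 / ‖z - w‖ ^ 3 ≤ 2 * Real.pi / dst Ω z := by
      rw [← compl3_integral z hdp]
      exact setIntegral_mono_set (compl3_integrable z hdp) (ae_of_all _ fun _ => by positivity)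
        (compl_far Ω z).eventuallyLE
    have m2 : 1 / dst Ω z ≤ ρ ^ (-ε) * dst Ω z ^ (ε - 1) := by
      have : 1 / dst Ω z = dst Ω z ^ (-ε) * dst Ω z ^ (ε - 1) := by
        rw [← Real.rpow_add hdp]; ring_nf; rw [Real.rpow_neg_one]
      rw [this]
      gcongr ?_ * _
      exact Real.rpow_le_rpow_of_nonpos hρ hd (by linarith)
    calc _ ≤ BK k * ‖z - z1‖ * (2 * Real.pi * (1 / dst Ω z)) := by
          refine b1.trans ?_
          rw [mul_one_div]
          gcongr
      _ ≤ BK k * ‖z - z1‖ * (2 * Real.pi * (ρ ^ (-ε) * dst Ω z ^ (ε - 1))) := by gcongr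
      _ = (BK k * (2 * Real.pi * ρ ^ (-ε))) * ‖z - z1‖ * dst Ω z ^ (ε - 1) := by ring
      _ ≤ _ := by
        gcongr ?_ * _ * _
        have : 0 ≤ BK k * C := by positivity
        linarith

/-! ### The operators `T_k` are bounded on Hölder spaces -/

lemma ker_far_le {κ : ℂ → ℂ} {C : ℝ} (hκ : KerB κ C) {z w : ℂ} {r : ℝ} (hr : 0 < r)
    (hw : w ∉ ball z r) : ‖κ (z - w)‖ ≤ C / r ^ 2 := by
  rw [mem_ball, dist_comm, dist_eq_norm, not_lt] at hw
  refine (hκ.bd _).trans ?_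
  have := hκ.nn
  gcongr

lemma ker_far_int {κ : ℂ → ℂ} {C : ℝ} (hκ : KerB κ C) {z : ℂ} {r : ℝ} (hr : 0 < r) {S : Set ℂ}
    (hS : MeasurableSet S) (hv : volume S ≠ ⊤) (hSr : ∀ w ∈ S, w ∉ ball z r) :
    IntegrableOn (fun w => κ (z - w)) S := by
  refine Integrable.mono' (g := fun _ => C / r ^ 2) (integrableOn_const hv)
    (hκ.meas.comp (measurable_const.sub measurable_id)).aestronglyMeasurable ?_
  exact (ae_restrict_iff' hS).2 (ae_of_all _ fun w hw => ker_far_le hκ hr (hSr w hw))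

lemma ann_zero {κ : ℂ → ℂ} {C : ℝ} (hκ : KerB κ C) (z : ℂ) (r R : ℝ) :
    ∫ w in ball z R \ ball z r, κ (z - w) = 0 := by
  obtain ⟨ω, hω, h⟩ := hκ.rot
  have h1 := ball_integral_zero_of_rot' (f := {v : ℂ | r ≤ ‖v‖}.indicator κ) hω (by
    intro u
    by_cases hu : r ≤ ‖u‖
    · rw [indicator_of_mem (by simpa [hω] using hu), indicator_of_mem (by exact hu), h]
    · rw [indicator_of_notMem (by simpa [hω] using hu), indicator_of_notMem (by exact hu), neg_zero])
    z R
  rw [← h1, show ball z R \ ball z r = ball z R ∩ (ball z r)ᶜ from rfl,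
    ← setIntegral_indicator measurableSet_ball.compl]
  congr 1
  ext w
  by_cases hu : r ≤ ‖z - w‖
  · rw [indicator_of_mem (by rw [mem_compl_iff, mem_ball, dist_comm, dist_eq_norm]; exact hu.not_gt),
      indicator_of_mem (by exact hu)]
  · rw [indicator_of_notMem (by rw [mem_compl_iff, mem_ball, dist_comm, dist_eq_norm]; simpa using hu),
      indicator_of_notMem (by exact hu)]

lemma one_locH {Ω : Set ℂ} (ho : IsOpen Ω) (hb : Bornology.IsBounded Ω) {z : ℂ} {r : ℝ} (hr : 0 < r)
    (hs : ball z r ⊆ Ω) : LocH Ω 1 z r 1 1 1 where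
  meas := ho.measurableSet
  vol := hb.measure_lt_top.ne
  um := aestronglyMeasurable_const
  ub := fun w hw => by simp
  rpos := hr
  apos := one_pos
  sub := hs
  hol := fun w hw => by simp

lemma X_near {Ω : Set ℂ} (ho : IsOpen Ω) (hb : Bornology.IsBounded Ω) {k : ℕ} (hk : 1 ≤ k) {z : ℂ}
    (hz : z ∈ Ω) : TnOp Ω k 1 z = ∫ w in Ω \ ball z (dst Ω z), bnKer k (z - w) := by
  have hd := dst_pos ho hb hz
  rw [(one_locH ho hb hd (dst_ball Ω z)).Tn_eq hk, Lam,
    show Ω \ ball z (dst Ω z) = Ω ∩ (ball z (dst Ω z))ᶜ from rfl,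
    ← setIntegral_indicator measurableSet_ball.compl]
  congr 1
  ext w
  by_cases hw : w ∈ ball z (dst Ω z)
  · rw [indicator_of_mem hw, indicator_of_notMem (by simpa using hw)]; simp
  · rw [indicator_of_notMem hw, indicator_of_mem (by simpa using hw)]; simp

lemma X_repr {Ω : Set ℂ} (ho : IsOpen Ω) (hb : Bornology.IsBounded Ω) {k : ℕ} (hk : 1 ≤ k) {z : ℂ}
    (hz : z ∈ Ω) {R : ℝ} (hR : Ω ⊆ ball z R) :
    TnOp Ω k 1 z = - ∫ w in ball z R \ Ω, bnKer k (z - w) := by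
  have hd := dst_pos ho hb hz
  have hbal := dst_ball Ω z
  rw [X_near ho hb hk hz, eq_neg_iff_add_eq_zero, ← ann_zero (bn_ker hk) z (dst Ω z) R]
  rw [← setIntegral_union]
  · congr 2
    ext w
    simp only [mem_union, Set.mem_sdiff]
    have h1 : w ∈ Ω → w ∈ ball z R := fun h => hR h
    have h2 : w ∈ ball z (dst Ω z) → w ∈ Ω := fun h => hbal h
    tauto
  · rw [Set.disjoint_left]
    intro w hw hw2
    exact hw2.2 hw.1
  · exact measurableSet_ball.diff ho.measurableSet
  · exact ker_far_int (bn_ker hk) hd (ho.measurableSet.diff measurableSet_ball)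
      ((measure_mono sdiff_subset).trans_lt hb.measure_lt_top).ne fun w hw => hw.2
  · exact ker_far_int (bn_ker hk) hd (measurableSet_ball.diff ho.measurableSet)
      ((measure_mono sdiff_subset).trans_lt measure_ball_lt_top).ne fun w hw h => hw.2 (hbal h)

lemma vol_ann (z : ℂ) {R h : ℝ} (h0 : 0 ≤ h) (hR : h ≤ R) :
    volume.real (ball z R \ ball z (R - h)) ≤ 2 * Real.pi * R * h := by
  have e : ∀ r : ℝ, 0 ≤ r → volume.real (ball z r) = Real.pi * r ^ 2 := fun r hr => by
    rw [measureReal_def, Complex.volume_ball]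
    simp [hr]
    ring
  rw [measureReal_sdiff (ball_subset_ball (by linarith)) measurableSet_ball, e _ (by linarith),
    e _ (by linarith)]
  have := Real.pi_pos
  nlinarith [mul_nonneg this.le (sq_nonneg h)]

lemma two_balls {κ : ℂ → ℂ} {C : ℝ} (hκ : KerB κ C) {z z1 x : ℂ} {R h : ℝ} (hh : ‖z - z1‖ ≤ h)
    (hx : x = z ∨ x = z1) (hR0 : 0 < R) (hR : 2 * h ≤ R) :
    ‖∫ w in ball z R \ ball z1 R, κ (x - w)‖ ≤ C * 8 * Real.pi / R * h := by
  have h0 : 0 ≤ h := (norm_nonneg _).trans hh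
  have hsub : ball z R \ ball z1 R ⊆ ball z R \ ball z (R - h) := by
    refine fun w hw => ⟨hw.1, fun hw2 => hw.2 ?_⟩
    rw [mem_ball, dist_eq_norm] at *
    have : w - z1 = (w - z) + (z - z1) := by ring
    rw [this]
    exact (norm_add_le _ _).trans_lt (by linarith)
  have hC := hκ.nn
  have hfin : volume (ball z R \ ball z1 R) < ⊤ := (measure_mono sdiff_subset).trans_lt measure_ball_lt_top
  have hfin' : volume (ball z R \ ball z (R - h)) ≠ ⊤ :=
    ((measure_mono sdiff_subset).trans_lt measure_ball_lt_top).ne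
  have h1 := norm_setIntegral_le_of_norm_le_const (f := fun w => κ (x - w)) (C := C / (R / 2) ^ 2)
    hfin fun w hw => ker_far_le hκ (half_pos hR0) (by
      rcases hx with rfl | rfl
      · intro h2; exact (hsub hw).2 (ball_subset_ball (by linarith) h2)
      · intro h2; exact hw.2 (ball_subset_ball (by linarith) h2))
  refine h1.trans ?_
  calc _ ≤ C / (R / 2) ^ 2 * (2 * Real.pi * R * h) := by
        gcongr
        exact (measureReal_mono hsub hfin').trans (vol_ann z h0 (by linarith))
    _ = _ := by field_simp; ring

lemma exists_R {Ω : Set ℂ} (hb : Bornology.IsBounded Ω) : ∃ R : ℝ, 1 ≤ R ∧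
    (∀ z ∈ Ω, Ω ⊆ ball z R) ∧ ∀ z ∈ Ω, dst Ω z ≤ R := by
  obtain ⟨R0, h0⟩ := hb.subset_ball 0
  have key : ∀ z ∈ Ω, Ω ⊆ ball z (2 * max R0 1) := fun z hz w hw => by
    have h1 := h0 hz
    have h2 := h0 hw
    rw [mem_ball, dist_eq_norm, sub_zero] at h1 h2
    rw [mem_ball, dist_eq_norm]
    have := le_max_left R0 1
    exact (norm_sub_le _ _).trans_lt (by linarith)
  refine ⟨2 * max R0 1, by linarith [le_max_right R0 1], key, fun z hz => ?_⟩
  by_contra hc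
  push Not at hc
  set R := 2 * max R0 1
  have hR : 0 < R := by linarith [le_max_right R0 1]
  have : z + (R : ℂ) ∈ ball z (dst Ω z) := by
    rw [mem_ball, dist_eq_norm]; simp [abs_of_pos hR]; exact hc
  have := key z hz (dst_ball Ω z this)
  rw [mem_ball, dist_eq_norm] at this
  simp [abs_of_pos hR] at this

lemma X_diff {ε Ω ρ L} (D : Dom ε Ω ρ L) {k : ℕ} (hk : 1 ≤ k) : ∃ C : ℝ, 0 ≤ C ∧ ∀ z ∈ Ω, ∀ z1,
    ‖z - z1‖ ≤ kap L * dst Ω z →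
    ‖TnOp Ω k 1 z - TnOp Ω k 1 z1‖ ≤ C * ‖z - z1‖ * dst Ω z ^ (ε - 1) := by
  have hL := D.L1
  obtain ⟨C1, hC1, h1⟩ := ext_diff D hk
  obtain ⟨R, hR1, hRb, hRd⟩ := exists_R D.bdd
  have hB := BK_nonneg k
  have hR0 : 0 < R := by linarith
  set C2 := BK k * 2 * Real.pi / R + BK k * 8 * Real.pi / R * 2 with hC2
  have hC20 : 0 ≤ C2 := by positivity
  refine ⟨C1 + C2 * R ^ (1 - ε), by positivity, ?_⟩
  intro z hz z1 hzz
  have hdp := dst_pos D.op D.bdd hz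
  obtain ⟨k1, k2, k3, k4⟩ := kap_mul hL hdp.le hzz
  have hz1 : z1 ∈ Ω := dst_ball Ω z (by rw [mem_ball, dist_comm, dist_eq_norm]; linarith)
  have hdR := hRd z hz
  set h := ‖z - z1‖ with hh
  have hh0 : 0 ≤ h := norm_nonneg _
  obtain ⟨hI, hIb⟩ := h1 z hz z1 hzz
  rw [X_repr D.op D.bdd hk hz (hRb z hz), X_repr D.op D.bdd hk hz1 (hRb z1 hz1)]
  have hΩm := D.op.measurableSet
  have hd1 : 0 < dst Ω z / 2 := by positivity
  have hfar1 : ∀ w, w ∉ Ω → w ∉ ball z1 (dst Ω z / 2) := fun w hw hw2 => by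
    apply hw
    apply dst_ball Ω z
    rw [mem_ball, dist_eq_norm] at *
    have : w - z = (w - z1) - (z - z1) := by ring
    rw [this]
    exact (norm_sub_le _ _).trans_lt (by linarith)
  have hfar0 : ∀ w, w ∉ Ω → w ∉ ball z (dst Ω z) := fun w hw hw2 => hw (dst_ball Ω z hw2)
  have fin : ∀ x : ℂ, volume (ball x R \ Ω) ≠ ⊤ := fun x =>
    ((measure_mono sdiff_subset).trans_lt measure_ball_lt_top).ne
  have ms : ∀ x : ℂ, MeasurableSet (ball x R \ Ω) := fun x => measurableSet_ball.diff hΩm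
  have i00 : IntegrableOn (fun w => bnKer k (z - w)) (ball z R \ Ω) :=
    ker_far_int (bn_ker hk) hdp (ms z) (fin z) fun w hw => hfar0 w hw.2
  have i10 : IntegrableOn (fun w => bnKer k (z1 - w)) (ball z R \ Ω) :=
    ker_far_int (bn_ker hk) hd1 (ms z) (fin z) fun w hw => hfar1 w hw.2
  have i11 : IntegrableOn (fun w => bnKer k (z1 - w)) (ball z1 R \ Ω) :=
    ker_far_int (bn_ker hk) hd1 (ms z1) (fin z1) fun w hw => hfar1 w hw.2
  have e1 := integral_sub i00 i10
  have e2 := int_sub_sets (ms z) (ms z1) i10 i11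
  have q1 : (ball z R \ Ω) \ (ball z1 R \ Ω) = ball z R \ ball z1 R := by
    ext w
    simp only [Set.mem_sdiff]
    have : w ∈ Ω → w ∈ ball z1 R := fun hw => hRb z1 hz1 hw
    tauto
  have q2 : (ball z1 R \ Ω) \ (ball z R \ Ω) = ball z1 R \ ball z R := by
    ext w
    simp only [Set.mem_sdiff]
    have : w ∈ Ω → w ∈ ball z R := fun hw => hRb z hz hw
    tauto
  rw [q1, q2] at e2
  have b1 := two_balls (bn_ker hk) (le_refl ‖z - z1‖) (x := z1) (R := R) (.inr rfl) hR0
    (by rw [← hh]; linarith)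
  have b2 := two_balls (bn_ker hk) (z := z1) (z1 := z) (h := h) (by rw [norm_sub_rev])
    (x := z1) (R := R) (.inl rfl) hR0 (by linarith)
  rw [← hh] at b1
  -- split the exterior integral
  have e3 := integral_inter_add_sdiff (s := Ωᶜ) (t := ball z R) measurableSet_ball hI
  have q3 : Ωᶜ ∩ ball z R = ball z R \ Ω := by rw [inter_comm]; rfl
  have q4 : Ωᶜ \ ball z R = (ball z R)ᶜ := by
    ext w
    simp only [Set.mem_sdiff, mem_compl_iff]
    have : w ∈ Ω → w ∈ ball z R := fun hw => hRb z hz hw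
    tauto
  rw [q3, q4] at e3
  have b3 := dk_bound hk (z := z) (z1 := z1) measurableSet_ball.compl (compl3_integrable z hR0)
    fun w hw => by
      rw [mem_compl_iff, mem_ball, dist_comm, dist_eq_norm, not_lt] at hw
      linarith
  rw [compl3_integral z hR0, ← hh] at b3
  have efin : (- ∫ w in ball z R \ Ω, bnKer k (z - w)) - (- ∫ w in ball z1 R \ Ω, bnKer k (z1 - w)) =
      - (∫ w in Ωᶜ, (bnKer k (z - w) - bnKer k (z1 - w)))
      + (∫ w in (ball z R)ᶜ, (bnKer k (z - w) - bnKer k (z1 - w)))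
      - (∫ w in ball z R \ ball z1 R, bnKer k (z1 - w))
      + ∫ w in ball z1 R \ ball z R, bnKer k (z1 - w) := by
    linear_combination -e3 + e1 - e2
  rw [efin]
  have hfinal : C2 * h ≤ C2 * R ^ (1 - ε) * h * dst Ω z ^ (ε - 1) := by
    have h1ε : 0 ≤ 1 - ε := by linarith [D.e1]
    have : 1 ≤ R ^ (1 - ε) * dst Ω z ^ (ε - 1) := by
      have : (1 : ℝ) = dst Ω z ^ (1 - ε) * dst Ω z ^ (ε - 1) := by
        rw [← Real.rpow_add hdp]; ring_nf; simp
      refine this.trans_le ?_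
      gcongr
    calc _ = C2 * h * 1 := by ring
      _ ≤ C2 * h * (R ^ (1 - ε) * dst Ω z ^ (ε - 1)) := by gcongr
      _ = _ := by ring
  calc _ ≤ C1 * h * dst Ω z ^ (ε - 1) + BK k * h * (2 * Real.pi / R) + BK k * 8 * Real.pi / R * h
          + BK k * 8 * Real.pi / R * h := by
        refine (norm_add_le _ _).trans (add_le_add ((norm_sub_le _ _).trans (add_le_add
          ((norm_add_le _ _).trans (add_le_add ?_ b3)) b1)) b2)
        rw [norm_neg]; exact hIb
    _ = C1 * h * dst Ω z ^ (ε - 1) + C2 * h := by rw [hC2]; ring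
    _ ≤ _ := by rw [add_mul, add_mul]; linarith

lemma whit_pow {d h β γ R : ℝ} (hd : 0 < d) (hh : 0 ≤ h) (hhd : h ≤ d) (hβ : 0 < β) (hβγ : β ≤ γ) (hβ1 : β ≤ 1)
    (hdR : d ≤ R) : h * d ^ (γ - 1) ≤ R ^ (γ - β) * h ^ β := by
  rcases hh.eq_or_lt with rfl | hp
  · simp [Real.zero_rpow hβ.ne']
  have e1 : d ^ (γ - 1) = d ^ (γ - β) * d ^ (β - 1) := by
    rw [← Real.rpow_add hd]; ring_nf
  have e2 : h ^ β = h * h ^ (β - 1) := by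
    rw [← Real.rpow_one_add' hh (by simpa using hβ.ne')]; ring_nf
  have e3 : d ^ (β - 1) ≤ h ^ (β - 1) := Real.rpow_le_rpow_of_nonpos hp hhd (by linarith)
  have e4 : d ^ (γ - β) ≤ R ^ (γ - β) := Real.rpow_le_rpow hd.le hdR (by linarith)
  have hR0 : 0 ≤ R := by linarith
  rw [e1, e2]
  calc _ ≤ h * (R ^ (γ - β) * h ^ (β - 1)) := by gcongr
    _ = _ := by ring

lemma X_whit {ε Ω ρ L} (D : Dom ε Ω ρ L) {k : ℕ} (hk : 1 ≤ k) {β : ℝ} (hβ : 0 < β) (hβε : β ≤ ε) :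
    ∃ C : ℝ, 0 ≤ C ∧ ∀ z ∈ Ω, ∀ z1, ‖z - z1‖ ≤ kap L * dst Ω z →
    ‖TnOp Ω k 1 z - TnOp Ω k 1 z1‖ ≤ C * ‖z - z1‖ ^ β := by
  obtain ⟨C, hC, h⟩ := X_diff D hk
  obtain ⟨R, hR1, hRb, hRd⟩ := exists_R D.bdd
  refine ⟨C * R ^ (ε - β), by positivity, fun z hz z1 hzz => (h z hz z1 hzz).trans ?_⟩
  have hdp := dst_pos D.op D.bdd hz
  obtain ⟨k1, -⟩ := kap_mul D.L1 hdp.le hzz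
  rw [mul_assoc, mul_assoc]
  refine mul_le_mul_of_nonneg_left ?_ hC
  exact whit_pow hdp (norm_nonneg _) (by linarith) hβ hβε (by linarith [D.e1]) (hRd z hz)

lemma X_bd {ε Ω ρ L} (D : Dom ε Ω ρ L) {k : ℕ} (hk : 1 ≤ k) :
    ∃ C : ℝ, 0 ≤ C ∧ ∀ z ∈ Ω, ‖TnOp Ω k 1 z‖ ≤ C := by
  obtain ⟨C, hC, h⟩ := X_whit D hk D.e0 le_rfl
  have hL := D.L1
  obtain ⟨c0, hc0, C2, hC2, h2⟩ := D.chain (kap_pos hL) (by linarith [kap_le hL]) D.e0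
  have hB := BK_nonneg k
  set A := C + BK k / c0 ^ 2 * volume.real Ω
  have hA : 0 ≤ BK k / c0 ^ 2 * volume.real Ω := by positivity
  refine ⟨C2 * A, by positivity, (h2 A (TnOp Ω k 1) (by positivity) (fun z hz z1 hzz =>
    (h z hz z1 hzz).trans ?_) ?_).1⟩
  · gcongr
    linarith
  · intro z hz hd
    rw [X_near D.op D.bdd hk hz]
    have hfin : volume (Ω \ ball z (dst Ω z)) < ⊤ :=
      (measure_mono sdiff_subset).trans_lt D.bdd.measure_lt_top
    have := norm_setIntegral_le_of_norm_le_const (f := fun w => bnKer k (z - w)) hfin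
      fun w hw => ker_far_le (bn_ker hk) hc0 fun h3 => hw.2 (ball_subset_ball hd h3)
    refine this.trans ((?_ : _ ≤ BK k / c0 ^ 2 * volume.real Ω).trans (by linarith))
    gcongr
    · exact D.bdd.measure_lt_top.ne
    · exact sdiff_subset

lemma HolB.nonneg {α Ω f M} (h : HolB α Ω f M) {z : ℂ} (hz : z ∈ Ω) : 0 ≤ M :=
  (norm_nonneg _).trans (h.1 z hz)

lemma rp_div2 {x α : ℝ} (hx : 0 ≤ x) (hα : α ≠ 2) : x ^ (α - 2) = x ^ α / x ^ 2 := by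
  rw [Real.rpow_sub' hx (sub_ne_zero.2 hα)]; norm_cast

lemma TA_pointwise {k : ℕ} (hk : 1 ≤ k) {α M : ℝ} (hα0 : 0 < α) (hα1 : α < 1) {Ω : Set ℂ} {g : ℂ → ℂ} {z z1 : ℂ}
    (hM : 0 ≤ M) (hz1 : z1 ∈ Ω) (hg : ∀ w ∈ Ω, ‖g w‖ ≤ M * ‖z - w‖ ^ α)
    (hg1 : ∀ w ∈ Ω, ‖g w - g z1‖ ≤ M * ‖z1 - w‖ ^ α) (hh : 0 < ‖z - z1‖) {w : ℂ} (hw : w ∈ Ω) :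
    ‖bnKer k (z - w) * g w - bnKer k (z1 - w) * (g w - (ball z1 ‖z - z1‖).indicator (fun _ => g z1) w)‖
    ≤ (ball z (2 * ‖z - z1‖)).indicator (fun w => BK k * M * ‖z - w‖ ^ (α - 2)) w
      + (ball z1 (3 * ‖z - z1‖)).indicator (fun w => 2 * BK k * M * ‖z1 - w‖ ^ (α - 2)) w
      + (ball z (2 * ‖z - z1‖))ᶜ.indicator (fun w => BK k * M * ‖z - z1‖ * ‖z - w‖ ^ (-2 - (1 - α))) w := by
  have hB := BK_nonneg k
  set h := ‖z - z1‖ with hhd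
  have tri1 : ‖z1 - w‖ ≤ ‖z - w‖ + h := by
    have : z1 - w = (z - w) - (z - z1) := by ring
    rw [this]; exact norm_sub_le _ _
  have tri2 : ‖z - w‖ ≤ ‖z1 - w‖ + h := by
    have : z - w = (z1 - w) + (z - z1) := by ring
    rw [this]; exact norm_add_le _ _
  by_cases c1 : w ∈ ball z (2 * h)
  · have c1n : w ∉ (ball z (2*h))ᶜ := fun hc => hc c1
    rw [indicator_of_mem c1, indicator_of_notMem c1n]
    have c1' := c1
    rw [mem_ball, dist_comm, dist_eq_norm] at c1'
    have c3 : w ∈ ball z1 (3 * h) := by rw [mem_ball, dist_comm, dist_eq_norm]; linarith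
    rw [indicator_of_mem c3, add_zero]
    refine (norm_sub_le _ _).trans (add_le_add ?_ ?_)
    · rw [norm_mul, rp_div2 (norm_nonneg _) (by linarith)]
      calc _ ≤ BK k / ‖z - w‖ ^ 2 * (M * ‖z - w‖ ^ α) := by
            gcongr
            · exact bn_bd hk _
            · exact hg w hw
        _ = _ := by ring
    · rw [norm_mul, rp_div2 (norm_nonneg _) (by linarith)]
      calc _ ≤ BK k / ‖z1 - w‖ ^ 2 * (2 * M * ‖z1 - w‖ ^ α) := by
            gcongr
            · exact bn_bd hk _
            · by_cases c2 : w ∈ ball z1 h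
              · rw [indicator_of_mem c2]
                refine (hg1 w hw).trans ?_
                have : 0 ≤ M * ‖z1 - w‖ ^ α := by positivity
                linarith
              · rw [indicator_of_notMem c2, sub_zero]
                rw [mem_ball, dist_comm, dist_eq_norm, not_lt] at c2
                refine (hg w hw).trans ?_
                have : ‖z - w‖ ^ α ≤ 2 * ‖z1 - w‖ ^ α := by
                  calc _ ≤ (2 * ‖z1 - w‖) ^ α := by gcongr; linarith
                    _ = 2 ^ α * ‖z1 - w‖ ^ α := Real.mul_rpow (by norm_num) (norm_nonneg _)
                    _ ≤ _ := by
                      gcongr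
                      calc (2:ℝ) ^ α ≤ 2 ^ (1:ℝ) := by gcongr; norm_num
                        _ = 2 := by norm_num
                nlinarith
        _ = _ := by ring
  · have c1m : w ∈ (ball z (2*h))ᶜ := c1
    rw [indicator_of_notMem c1, indicator_of_mem c1m, zero_add]
    have c1' := c1
    rw [mem_ball, dist_comm, dist_eq_norm, not_lt] at c1'
    have c2 : w ∉ ball z1 h := by rw [mem_ball, dist_comm, dist_eq_norm, not_lt]; linarith
    rw [indicator_of_notMem c2, sub_zero, ← sub_mul, norm_mul]
    refine le_trans ?_ (le_add_of_nonneg_left (indicator_nonneg (fun _ _ => by positivity) _))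
    have hp : 0 < ‖z - w‖ := by linarith
    have e : ‖z - w‖ ^ (-2 - (1 - α)) = ‖z - w‖ ^ α * (1 / ‖z - w‖ ^ 3) := by
      rw [← cpow3, ← Real.rpow_add hp]; ring_nf
    calc _ ≤ BK k * h * (1 / ‖z - w‖ ^ 3) * (M * ‖z - w‖ ^ α) := by
          gcongr
          · exact bn_diff' hk (by linarith)
          · exact hg w hw
      _ = _ := by rw [e]; ring

lemma TA_int {α : ℝ} (hα0 : 0 < α) (hα1 : α < 1) (a b c : ℝ) (z z1 : ℂ) {h : ℝ} (hh : 0 < h) :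
    Integrable (fun w => (ball z (2 * h)).indicator (fun w => a * ‖z - w‖ ^ (α - 2)) w
      + (ball z1 (3 * h)).indicator (fun w => b * ‖z1 - w‖ ^ (α - 2)) w
      + (ball z (2 * h))ᶜ.indicator (fun w => c * ‖z - w‖ ^ (-2 - (1 - α))) w) ∧
    ∫ w, ((ball z (2 * h)).indicator (fun w => a * ‖z - w‖ ^ (α - 2)) w
      + (ball z1 (3 * h)).indicator (fun w => b * ‖z1 - w‖ ^ (α - 2)) w
      + (ball z (2 * h))ᶜ.indicator (fun w => c * ‖z - w‖ ^ (-2 - (1 - α))) w) =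
    a * (2 * Real.pi / α * (2 * h) ^ α) + b * (2 * Real.pi / α * (3 * h) ^ α)
      + c * (2 * Real.pi / (1 - α) * (2 * h) ^ (-(1 - α))) := by
  have h1 := ((ball_pow_integrable hα0 z (2 * h)).const_mul a)
  have h2 := ((ball_pow_integrable hα0 z1 (3 * h)).const_mul b)
  have h3 := ((compl_pow_integrable (s := 1 - α) (by linarith) z (r := 2 * h) (by linarith)).const_mul c)
  have i1 := IntegrableOn.integrable_indicator h1 measurableSet_ball
  have i2 := IntegrableOn.integrable_indicator h2 measurableSet_ball
  have i3 := IntegrableOn.integrable_indicator h3 measurableSet_ball.compl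
  refine ⟨(i1.add i2).add i3, ?_⟩
  have i12 : Integrable (fun w => (ball z (2 * h)).indicator (fun w => a * ‖z - w‖ ^ (α - 2)) w
      + (ball z1 (3 * h)).indicator (fun w => b * ‖z1 - w‖ ^ (α - 2)) w) := i1.add i2
  rw [integral_add i12 i3, integral_add i1 i2, integral_indicator measurableSet_ball,
    integral_indicator measurableSet_ball, integral_indicator measurableSet_ball.compl,
    integral_const_mul, integral_const_mul, integral_const_mul, ball_pow_integral hα0 _ (by linarith),
    ball_pow_integral hα0 _ (by linarith), compl_pow_integral (by linarith) _ (by linarith)]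

lemma TA_whit {k : ℕ} (hk : 1 ≤ k) {α : ℝ} (hα0 : 0 < α) (hα1 : α < 1) : ∃ C : ℝ, 0 ≤ C ∧
    ∀ (M : ℝ) (Ω : Set ℂ) (g : ℂ → ℂ), IsOpen Ω → Bornology.IsBounded Ω → HolB α Ω g M →
    ∀ z ∈ Ω, ∀ z1, g z = 0 → ‖z - z1‖ ≤ dst Ω z / 16 →
      ‖TnOp Ω k g z - TnOp Ω k g z1‖ ≤ C * M * ‖z - z1‖ ^ α := by
  have hB := BK_nonneg k
  have hα' : 0 < 1 - α := by linarith
  refine ⟨BK k * (2 * Real.pi / α * 2) + 2 * BK k * (2 * Real.pi / α * 3)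
    + BK k * (2 * Real.pi / (1 - α)), by positivity, ?_⟩
  intro M Ω g ho hb hg z hz z1 hgz hzz
  have hM := hg.nonneg hz
  have hd := dst_pos ho hb hz
  rcases (norm_nonneg (z - z1)).eq_or_lt with h0 | hh
  · have : z = z1 := by rwa [eq_comm, norm_sub_eq_zero_iff] at h0
    subst this
    simp [Real.zero_rpow hα0.ne']
  have hz1 : z1 ∈ Ω := dst_ball Ω z (by rw [mem_ball, dist_comm, dist_eq_norm]; linarith)
  have hsub : ball z1 ‖z - z1‖ ⊆ Ω := fun w hw => by
    apply dst_ball Ω z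
    rw [mem_ball, dist_eq_norm] at *
    have : w - z = (w - z1) - (z - z1) := by ring
    rw [this]
    exact (norm_sub_le _ _).trans_lt (by linarith)
  have l0 := hg.locH hα0 ho hb hd (dst_ball Ω z)
  have l1 := hg.locH hα0 ho hb hh hsub
  rw [l0.Tn_eq hk, l1.Tn_eq hk, Lam, Lam]
  have i0 := l0.integrable (bn_ker hk)
  rw [← integral_sub i0 (l1.integrable (bn_ker hk))]
  set h := ‖z - z1‖ with hhd
  obtain ⟨j1, j2⟩ := TA_int hα0 hα1 (BK k * M) (2 * BK k * M) (BK k * M * h) z z1 hh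
  refine (norm_integral_le_of_norm_le j1.integrableOn ((ae_restrict_iff' ho.measurableSet).2
    (ae_of_all _ fun w hw => ?_))).trans ?_
  · have := TA_pointwise hk hα0 hα1 (z := z) (z1 := z1) hM hz1 (fun w hw => by
      have := hg.2 w hw z hz
      rwa [hgz, sub_zero, norm_sub_rev] at this)
      (fun w hw => by have := hg.2 w hw z1 hz1; rwa [norm_sub_rev w z1] at this) (by rw [← hhd]; exact hh) hw
    rw [hgz]
    simp only [indicator_zero, sub_zero]
    exact this
  · refine (setIntegral_le_integral j1 (ae_of_all _ fun w => ?_)).trans ?_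
    · refine add_nonneg (add_nonneg ?_ ?_) ?_ <;>
      exact indicator_nonneg (fun _ _ => by positivity) _
    rw [j2]
    have e1 : (2 * h) ^ α ≤ 2 * h ^ α := by
      rw [Real.mul_rpow (by norm_num) hh.le]
      gcongr
      calc (2:ℝ) ^ α ≤ 2 ^ (1:ℝ) := by gcongr; norm_num
        _ = 2 := by norm_num
    have e2 : (3 * h) ^ α ≤ 3 * h ^ α := by
      rw [Real.mul_rpow (by norm_num) hh.le]
      gcongr
      calc (3:ℝ) ^ α ≤ 3 ^ (1:ℝ) := by gcongr; norm_num
        _ = 3 := by norm_num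
    have e3 : h * (2 * h) ^ (-(1 - α)) ≤ h ^ α := by
      calc _ ≤ h * h ^ (-(1 - α)) := by
            gcongr ?_ * ?_
            exact Real.rpow_le_rpow_of_nonpos hh (by linarith) (by linarith)
        _ = h ^ α := by
          rw [← Real.rpow_one_add' hh.le (by simpa using hα0.ne')]; ring_nf
    calc _ = BK k * M * (2 * Real.pi / α * (2 * h) ^ α) + 2 * BK k * M * (2 * Real.pi / α * (3 * h) ^ α)
        + BK k * M * (2 * Real.pi / (1 - α)) * (h * (2 * h) ^ (-(1 - α))) := by ring
      _ ≤ BK k * M * (2 * Real.pi / α * (2 * h ^ α)) + 2 * BK k * M * (2 * Real.pi / α * (3 * h ^ α))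
        + BK k * M * (2 * Real.pi / (1 - α)) * h ^ α := by gcongr
      _ = _ := by ring

lemma const_holB {α : ℝ} {Ω : Set ℂ} (c : ℂ) : HolB α Ω (c • 1) ‖c‖ :=
  ⟨fun z hz => by simp, fun z hz w hw => by simp; positivity⟩

lemma TA_split {α Ω f M} (ha : 0 < α) (h : HolB α Ω f M) (ho : IsOpen Ω)
    (hb : Bornology.IsBounded Ω) {k : ℕ} (hk : 1 ≤ k) (c : ℂ) {z : ℂ} (hz : z ∈ Ω) :
    TnOp Ω k f z = TnOp Ω k (fun w => f w - c) z + c * TnOp Ω k 1 z := by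
  have h1 : HolB α Ω (fun w => f w - c) (M + ‖-c‖) := by
    have := h.add (const_holB (-c) (α := α) (Ω := Ω))
    refine this.congr fun w hw => ?_
    simp [sub_eq_add_neg]
  have h2 := h1.Tn_add ha (const_holB c) ho hb hk hz
  have h3 := (const_holB (α := α) (Ω := Ω) 1).Tn_smul ha ho hb hk c hz
  rw [one_smul] at h3
  rw [← h3, ← h2]
  congr 1
  ext w
  simp

lemma sub_const_holB {α Ω f M} (h : HolB α Ω f M) {z : ℂ} (hz : z ∈ Ω) :
    HolB α Ω (fun w => f w - f z) (2 * M) := by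
  have hM := h.nonneg hz
  refine ⟨fun w hw => (norm_sub_le _ _).trans ?_, fun w hw v hv => ?_⟩
  · linarith [h.1 w hw, h.1 z hz]
  · have := h.2 w hw v hv
    have : 0 ≤ M * ‖w - v‖ ^ α := by positivity
    rw [sub_sub_sub_cancel_right]
    linarith

/-- **Theorem A**. -/
theorem TA {ε Ω ρ L} (D : Dom ε Ω ρ L) {k : ℕ} (hk : 1 ≤ k) {α : ℝ} (hα0 : 0 < α) (hα1 : α ≤ ε) :
    ∃ C : ℝ, 0 ≤ C ∧ ∀ (M : ℝ) (f : ℂ → ℂ), 0 ≤ M → HolB α Ω f M → HolB α Ω (TnOp Ω k f) (C * M) := by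
  have hL := D.L1
  have hαl : α < 1 := by linarith [D.e1]
  obtain ⟨C1, hC1, h1⟩ := X_whit D hk hα0 hα1
  obtain ⟨C2, hC2, h2⟩ := X_bd D hk
  obtain ⟨C3, hC3, h3⟩ := TA_whit hk hα0 hαl
  obtain ⟨c0, hc0, C4, hC4, h4⟩ := D.chain (kap_pos hL) (by linarith [kap_le hL]) hα0
  have hB := BK_nonneg k
  set V := 2 * Real.pi / α + volume.real Ω
  have hV : 0 ≤ V := by positivity
  set A := C3 * 2 + C1 + (BK k * V + C2) with hA
  refine ⟨C4 * A, by positivity, fun M f hM hf => ?_⟩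
  rw [mul_assoc]
  refine h4 (A * M) _ (by positivity) ?_ ?_
  · intro z hz z1 hzz
    have hdp := dst_pos D.op D.bdd hz
    obtain ⟨k1, -⟩ := kap_mul hL hdp.le hzz
    have hz1 : z1 ∈ Ω := dst_ball Ω z (by rw [mem_ball, dist_comm, dist_eq_norm]; linarith)
    rw [TA_split hα0 hf D.op D.bdd hk (f z) hz, TA_split hα0 hf D.op D.bdd hk (f z) hz1]
    have q1 := h3 (2 * M) Ω _ D.op D.bdd (sub_const_holB hf hz) z hz z1 (sub_self _) k1
    have q2 := h1 z hz z1 hzz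
    have e1 : ∀ a b c d x : ℂ, (a + x * b) - (c + x * d) = (a - c) + x * (b - d) := by intros; ring
    rw [e1]
    have hp : 0 ≤ ‖z - z1‖ ^ α := by positivity
    have hp2 : 0 ≤ (BK k * V + C2) * M * ‖z - z1‖ ^ α := by positivity
    calc _ ≤ C3 * (2 * M) * ‖z - z1‖ ^ α + M * (C1 * ‖z - z1‖ ^ α) := by
          refine (norm_add_le _ _).trans (add_le_add q1 ?_)
          rw [norm_mul]
          gcongr
          exact hf.1 z hz
      _ = (C3 * 2 + C1) * M * ‖z - z1‖ ^ α := by ring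
      _ ≤ A * M * ‖z - z1‖ ^ α := by rw [hA]; linarith
  · intro z hz _
    have hdp := dst_pos D.op D.bdd hz
    have hvol := D.bdd.measure_lt_top (μ := volume).ne
    rw [TA_split hα0 hf D.op D.bdd hk (f z) hz]
    have l0 := (sub_const_holB hf hz).locH hα0 D.op D.bdd hdp (dst_ball Ω z)
    have q1 : ‖TnOp Ω k (fun w => f w - f z) z‖ ≤ BK k * V * M := by
      rw [l0.Tn_eq hk, Lam]
      refine (norm_integral_le_of_norm_le ((riesz_integrable hα0 (by linarith) D.op.measurableSet
        hvol z).const_mul (BK k * M)) ((ae_restrict_iff' D.op.measurableSet).2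
        (ae_of_all _ fun w hw => ?_))).trans ?_
      · simp only [sub_self, indicator_zero, sub_zero]
        rw [norm_mul, rp_div2 (norm_nonneg _) (by linarith)]
        calc _ ≤ BK k / ‖z - w‖ ^ 2 * (M * ‖z - w‖ ^ α) := by
              gcongr
              · exact bn_bd hk _
              · rw [norm_sub_rev z]; exact hf.2 w hw z hz
          _ = _ := by ring
      · rw [integral_const_mul]
        have := riesz_bound hα0 (by linarith) D.op.measurableSet hvol z
        calc _ ≤ BK k * M * V := by gcongr
          _ = _ := by ring
    have hp : 0 ≤ (C3 * 2 + C1) * M := by positivity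
    calc _ ≤ BK k * V * M + M * C2 := by
          refine (norm_add_le _ _).trans (add_le_add q1 ?_)
          rw [norm_mul]
          gcongr
          · exact hf.1 z hz
          · exact h2 z hz
      _ ≤ A * M := by rw [hA]; linarith

/-- the real linear map with Wirtinger coefficients `x`, `y`. -/
def WD (x y : ℂ) : ℂ →L[ℝ] ℂ :=
  x • (ContinuousLinearMap.id ℝ ℂ) + y • (Complex.conjCLE : ℂ →L[ℝ] ℂ)

lemma WD_apply (x y v : ℂ) : WD x y v = x * v + y * (starRingEnd ℂ) v := by
  simp [WD]

def HW (f : ℂ → ℂ) (x y u : ℂ) : Prop := HasFDerivAt f (WD x y) u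

lemma HW.congr {f x y u x' y'} (h : HW f x y u) (hx : x = x') (hy : y = y') : HW f x' y' u := by
  subst hx hy; exact h

lemma HW_id (u : ℂ) : HW (fun u => u) 1 0 u := by
  refine (hasFDerivAt_id (𝕜 := ℝ) u).congr_fderiv ?_
  ext v <;> simp [WD_apply]

lemma HW_conj (u : ℂ) : HW (fun u => (starRingEnd ℂ) u) 0 1 u := by
  refine ((Complex.conjCLE : ℂ →L[ℝ] ℂ).hasFDerivAt (x := u)).congr_fderiv ?_
  ext v <;> simp [WD_apply]

lemma HW_const (c u : ℂ) : HW (fun _ => c) 0 0 u := by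
  refine (hasFDerivAt_const (𝕜 := ℝ) c u).congr_fderiv ?_
  ext v <;> simp [WD_apply]

lemma HW.add {f g x y x' y' u} (h : HW f x y u) (h' : HW g x' y' u) :
    HW (fun u => f u + g u) (x + x') (y + y') u := by
  refine (HasFDerivAt.add h h').congr_fderiv ?_
  refine ContinuousLinearMap.ext fun v => ?_
  rw [ContinuousLinearMap.add_apply]; simp only [WD_apply]; ring

lemma HW.mul {f g x y x' y' u} (h : HW f x y u) (h' : HW g x' y' u) :
    HW (fun u => f u * g u) (f u * x' + g u * x) (f u * y' + g u * y) u := by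
  refine (HasFDerivAt.mul h h').congr_fderiv ?_
  refine ContinuousLinearMap.ext fun v => ?_
  rw [ContinuousLinearMap.add_apply, ContinuousLinearMap.smul_apply, ContinuousLinearMap.smul_apply]
  simp only [WD_apply, smul_eq_mul]; ring

lemma HW.const_mul {f x y u} (c : ℂ) (h : HW f x y u) : HW (fun u => c * f u) (c * x) (c * y) u :=
  ((HW_const c u).mul h).congr (by ring) (by ring)

lemma HW.comp_holo {f x y u} {φ : ℂ → ℂ} {φ' : ℂ} (h : HW f x y u) (hφ : HasDerivAt φ φ' (f u)) :
    HW (fun u => φ (f u)) (φ' * x) (φ' * y) u := by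
  have := (hφ.hasFDerivAt.restrictScalars ℝ).comp u h
  refine this.congr_fderiv ?_
  refine ContinuousLinearMap.ext fun v => ?_
  simp only [ContinuousLinearMap.comp_apply, WD_apply]
  simp [WD_apply]; ring

lemma HW.shift {f x y} (z u : ℂ) (h : HW f x y (z - u)) : HW (fun u => f (z - u)) (-x) (-y) u := by
  have h2 : HasFDerivAt (fun u : ℂ => z - u) (-(ContinuousLinearMap.id ℝ ℂ)) u :=
    (hasFDerivAt_id (𝕜 := ℝ) u).const_sub z
  have := HasFDerivAt.comp u h h2
  refine this.congr_fderiv ?_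
  refine ContinuousLinearMap.ext fun v => ?_
  simp [WD_apply]; ring

/-- Integration by parts for Wirtinger derivatives. -/
lemma HW_parts {f g fz fy gz gy : ℂ → ℂ} (hf : ∀ u, HW f (fz u) (fy u) u)
    (hg : ∀ u, HW g (gz u) (gy u) u) (i0 : Integrable (fun u => f u * g u))
    (i1 : Integrable (fun u => fz u * g u)) (i2 : Integrable (fun u => fy u * g u))
    (i3 : Integrable (fun u => f u * gz u)) (i4 : Integrable (fun u => f u * gy u)) :
    ∫ u, f u * gz u = - ∫ u, fz u * g u ∧ ∫ u, f u * gy u = - ∫ u, fy u * g u := by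
  have key : ∀ v : ℂ, (∫ u, f u * gz u) * v + (∫ u, f u * gy u) * (starRingEnd ℂ) v =
      -((∫ u, fz u * g u) * v + (∫ u, fy u * g u) * (starRingEnd ℂ) v) := by
    intro v
    have e1 : ∀ u, fderiv ℝ f u v = fz u * v + fy u * (starRingEnd ℂ) v := fun u => by
      rw [HasFDerivAt.fderiv (hf u), WD_apply]
    have e2 : ∀ u, fderiv ℝ g u v = gz u * v + gy u * (starRingEnd ℂ) v := fun u => by
      rw [HasFDerivAt.fderiv (hg u), WD_apply]
    have a1 := (i3.mul_const v)
    have a2 := (i4.mul_const ((starRingEnd ℂ) v))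
    have a3 := (i1.mul_const v)
    have a4 := (i2.mul_const ((starRingEnd ℂ) v))
    have b1 : (fun u => fderiv ℝ f u v * g u) = fun u => fz u * g u * v + fy u * g u * (starRingEnd ℂ) v := by
      ext u; rw [e1]; ring
    have b2 : (fun u => f u * fderiv ℝ g u v) = fun u => f u * gz u * v + f u * gy u * (starRingEnd ℂ) v := by
      ext u; rw [e2]; ring
    have := integral_mul_fderiv_eq_neg_fderiv_mul_of_integrable (μ := volume) (f := f) (g := g) (v := v)
      (by rw [b1]; exact a3.add a4) (by rw [b2]; exact a1.add a2) i0
      (fun x _ => (hf x).differentiableAt) (fun x _ => (hg x).differentiableAt)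
    rw [b1, b2, integral_add a1 a2, integral_add a3 a4] at this
    simpa only [integral_mul_const] using this
  have k1 := key 1
  have k2 := key Complex.I
  simp only [map_one, mul_one, Complex.conj_I] at k1 k2
  have hI : Complex.I * Complex.I = -1 := Complex.I_mul_I
  constructor
  · linear_combination k1 / 2 - Complex.I * k2 / 2 + (((∫ u, f u * gz u) - (∫ u, f u * gy u)) +
      ((∫ u, fz u * g u) - (∫ u, fy u * g u))) / 2 * hI
  · linear_combination k1 / 2 + Complex.I * k2 / 2 - (((∫ u, f u * gz u) - (∫ u, f u * gy u)) +
      ((∫ u, fz u * g u) - (∫ u, fy u * g u))) / 2 * hI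

/-! kernels -/
def Rd (δ : ℝ) (u : ℂ) : ℝ := ‖u‖ ^ 2 + δ ^ 2

lemma Rd_pos {δ : ℝ} (hδ : 0 < δ) (u : ℂ) : 0 < Rd δ u := by unfold Rd; positivity

def EK (a b k : ℕ) (δ : ℝ) (u : ℂ) : ℂ := (starRingEnd ℂ) u ^ a * u ^ b / (Rd δ u : ℂ) ^ k

lemma Rd_eq (δ : ℝ) (u : ℂ) : (Rd δ u : ℂ) = u * (starRingEnd ℂ) u + (δ : ℂ) ^ 2 := by
  rw [Complex.mul_conj, Complex.normSq_eq_norm_sq]; simp [Rd]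

lemma EK_norm {a b k : ℕ} {δ : ℝ} (u : ℂ) : ‖EK a b k δ u‖ = ‖u‖ ^ (a + b) / Rd δ u ^ k := by
  have : 0 ≤ Rd δ u := by unfold Rd; positivity
  rw [EK, norm_div, norm_mul, norm_pow, norm_pow, norm_pow, Complex.norm_conj, Complex.norm_real,
    Real.norm_of_nonneg this, pow_add]

lemma EK_meas (a b k : ℕ) (δ : ℝ) : Measurable (EK a b k δ) := by
  unfold EK Rd
  have : Measurable (fun u : ℂ => (starRingEnd ℂ) u) := Complex.continuous_conj.measurable
  fun_prop

lemma EK_cont (a b k : ℕ) {δ : ℝ} (hδ : 0 < δ) : Continuous (EK a b k δ) := by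
  have h : ∀ u, (Rd δ u : ℂ) ^ k ≠ 0 := fun u => pow_ne_zero _ (by exact_mod_cast (Rd_pos hδ u).ne')
  refine Continuous.div ?_ ?_ h
  · have := Complex.continuous_conj
    fun_prop
  · unfold Rd; fun_prop

lemma EK_rot {a b k : ℕ} {δ : ℝ} {ω : ℂ} (hω : ‖ω‖ = 1) (u : ℂ) :
    EK a b k δ (ω * u) = (starRingEnd ℂ) ω ^ a * ω ^ b * EK a b k δ u := by
  simp only [EK, Rd, norm_mul, hω, one_mul, map_mul, mul_pow]; ring

lemma EK_deriv (a b k : ℕ) {δ : ℝ} (hδ : 0 < δ) (u : ℂ) :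
    HW (EK a b k δ) (b * EK a (b - 1) k δ u - k * EK (a + 1) b (k + 1) δ u)
      (a * EK (a - 1) b k δ u - k * EK a (b + 1) (k + 1) δ u) u := by
  have hR : (Rd δ u : ℂ) ≠ 0 := by exact_mod_cast (Rd_pos hδ u).ne'
  have e : EK a b k δ = fun u => (starRingEnd ℂ) u ^ a * u ^ b * ((u * (starRingEnd ℂ) u + (δ : ℂ) ^ 2) ^ k)⁻¹ := by
    ext u; rw [EK, Rd_eq]; rfl
  have h1 := (HW_conj u).comp_holo (hasDerivAt_pow a _)
  have h2 := (HW_id u).comp_holo (hasDerivAt_pow b _)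
  have h3 := (((HW_id u).mul (HW_conj u)).add (HW_const ((δ : ℂ) ^ 2) u)).comp_holo (hasDerivAt_pow k _)
  have hk0 : (u * (starRingEnd ℂ) u + (δ : ℂ) ^ 2) ^ k ≠ 0 := by rw [← Rd_eq]; exact pow_ne_zero _ hR
  have h4 := h3.comp_holo (hasDerivAt_inv hk0)
  have := (h1.mul h2).mul h4
  rw [e]
  simp only [← Rd_eq] at this ⊢
  rcases k with _ | k
  · refine this.congr ?_ ?_ <;> simp [EK] <;> ring
  · refine this.congr ?_ ?_
    · simp only [EK, Nat.add_sub_cancel]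
      field_simp
      push_cast; ring
    · simp only [EK, Nat.add_sub_cancel]
      field_simp
      push_cast; ring

/-! decay -/
def Dec (j : ℕ) (F : ℂ → ℂ) : Prop := ∃ C : ℝ, ∀ u, ‖F u‖ * (1 + ‖u‖) ^ j ≤ C

lemma Dec.add {j F G} (h : Dec j F) (h' : Dec j G) : Dec j (fun u => F u + G u) := by
  obtain ⟨C, h⟩ := h
  obtain ⟨D, h'⟩ := h'
  refine ⟨C + D, fun u => ?_⟩
  refine le_trans ?_ (add_le_add (h u) (h' u))
  rw [← add_mul]; gcongr; exact norm_add_le _ _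

lemma Dec.const_mul {j F} (c : ℂ) (h : Dec j F) : Dec j (fun u => c * F u) := by
  obtain ⟨C, h⟩ := h
  refine ⟨‖c‖ * C, fun u => ?_⟩
  rw [norm_mul, mul_assoc]; gcongr; exact h u

lemma Dec.sub {j F G} (h : Dec j F) (h' : Dec j G) : Dec j (fun u => F u - G u) := by
  have := h.add (h'.const_mul (-1))
  simpa [sub_eq_add_neg] using this

lemma Dec.mul {i j F G} (h : Dec i F) (h' : Dec j G) : Dec (i + j) (fun u => F u * G u) := by
  obtain ⟨C, h⟩ := h
  obtain ⟨D, h'⟩ := h'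
  refine ⟨C * D, fun u => ?_⟩
  rw [norm_mul, pow_add, mul_mul_mul_comm]
  exact mul_le_mul (h u) (h' u) (by positivity) ((by positivity : (0:ℝ) ≤ ‖F u‖ * (1 + ‖u‖) ^ i).trans (h u))

lemma Dec.mono {i j F} (h : Dec j F) (hij : i ≤ j) : Dec i F := by
  obtain ⟨C, h⟩ := h
  refine ⟨C, fun u => le_trans ?_ (h u)⟩
  gcongr
  linarith [norm_nonneg u]

lemma Dec.shift {j F} (z : ℂ) (h : Dec j F) : Dec j (fun u => F (z - u)) := by
  obtain ⟨C, h⟩ := h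
  refine ⟨(1 + ‖z‖) ^ j * C, fun u => ?_⟩
  have : 1 + ‖u‖ ≤ (1 + ‖z‖) * (1 + ‖z - u‖) := by
    have : ‖u‖ ≤ ‖z‖ + ‖z - u‖ := by
      have : u = z - (z - u) := by ring
      conv_lhs => rw [this]
      exact norm_sub_le _ _
    nlinarith [norm_nonneg z, norm_nonneg (z - u)]
  calc _ ≤ ‖F (z - u)‖ * ((1 + ‖z‖) * (1 + ‖z - u‖)) ^ j := by gcongr
    _ = (1 + ‖z‖) ^ j * (‖F (z - u)‖ * (1 + ‖z - u‖) ^ j) := by rw [mul_pow]; ring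
    _ ≤ _ := by gcongr; exact h _

lemma Dec.integrable {F} (h : Dec 3 F) (hm : Measurable F) : Integrable F := by
  obtain ⟨C, h⟩ := h
  have := (integrable_one_add_norm (E := ℂ) (μ := volume) (r := 3) (by simp; norm_num)).const_mul C
  refine this.mono' hm.aestronglyMeasurable (ae_of_all _ fun u => ?_)
  have hp : 0 < 1 + ‖u‖ := by positivity
  rw [Real.rpow_neg hp.le, ← div_eq_mul_inv, le_div_iff₀ (by positivity)]
  exact_mod_cast h u

lemma EK_dec {a b k j : ℕ} (h : a + b + j ≤ 2 * k) {δ : ℝ} (hδ : 0 < δ) : Dec j (EK a b k δ) := by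
  obtain ⟨i, hi⟩ := Nat.exists_eq_add_of_le h
  refine ⟨(1 + 1 / δ) ^ j / δ ^ i, fun u => ?_⟩
  rw [EK_norm]
  have hR := Rd_pos hδ u
  set r := Real.sqrt (Rd δ u) with hr
  have hr0 : 0 < r := Real.sqrt_pos.2 hR
  have hrr : Rd δ u = r ^ 2 := (Real.sq_sqrt hR.le).symm
  have h1 : ‖u‖ ≤ r := by
    apply Real.le_sqrt_of_sq_le; unfold Rd; nlinarith
  have h2 : δ ≤ r := by
    apply Real.le_sqrt_of_sq_le; unfold Rd; nlinarith [sq_nonneg ‖u‖]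
  have h3 : 1 + ‖u‖ ≤ (1 + 1 / δ) * r := by
    have : 1 ≤ 1 / δ * r := by rw [one_div, inv_mul_eq_div, le_div_iff₀ hδ]; linarith
    nlinarith
  rw [hrr, ← pow_mul]
  calc _ ≤ r ^ (a + b) / r ^ (2 * k) * ((1 + 1 / δ) * r) ^ j := by gcongr
    _ = (1 + 1 / δ) ^ j / r ^ i := by
        rw [hi, pow_add, pow_add, mul_pow]; field_simp; ring
    _ ≤ _ := by gcongr

lemma EK_le0 {a b k j : ℕ} (h : a + b = 2 * j) (hk : k = j + 1) {δ : ℝ} (hδ : 0 < δ) (u : ℂ) :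
    ‖EK a b k δ u‖ ≤ 1 / Rd δ u := by
  have hR := Rd_pos hδ u
  rw [EK_norm, h, hk, pow_mul, pow_succ (Rd δ u), ← div_div]
  gcongr
  rw [div_le_one (by positivity)]
  gcongr
  unfold Rd; nlinarith

lemma EK_le1 {a b k j : ℕ} (h : a + b = 2 * j + 1) (hk : k = j + 2) {δ : ℝ} (hδ : 0 < δ) (u : ℂ) :
    ‖EK a b k δ u‖ ≤ ‖u‖ / Rd δ u ^ 2 := by
  have hR := Rd_pos hδ u
  rw [EK_norm, h, hk, pow_succ, pow_mul, pow_add, mul_div_mul_comm]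
  apply mul_le_of_le_one_left (by positivity)
  rw [div_le_one (by positivity)]
  gcongr
  unfold Rd; nlinarith

def c0 (m : ℕ) : ℂ := (-1) ^ m / Real.pi

lemma c0_norm (m : ℕ) : ‖c0 m‖ ≤ 1 := by
  rw [c0, norm_div, norm_pow, norm_neg, norm_one, one_pow, Complex.norm_real,
    Real.norm_of_nonneg Real.pi_pos.le, div_le_one Real.pi_pos]
  linarith [Real.pi_gt_three]

def pK (m : ℕ) (δ : ℝ) (u : ℂ) : ℂ :=
  c0 m * ((2 * m + 1) * EK (2 * m) 0 (m + 1) δ u + (-(m + 1)) * EK (2 * m + 1) 1 (m + 2) δ u)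

def qK (m : ℕ) (δ : ℝ) (u : ℂ) : ℂ := (- c0 m * (m + 1)) * EK (2 * m + 2) 0 (m + 2) δ u

def pz (m : ℕ) (δ : ℝ) (u : ℂ) : ℂ :=
  c0 m * ((2 * m + 1) * (-(m + 1) * EK (2 * m + 1) 0 (m + 2) δ u) +
    (-(m + 1)) * (EK (2 * m + 1) 0 (m + 2) δ u - (m + 2) * EK (2 * m + 2) 1 (m + 3) δ u))

def py (m : ℕ) (δ : ℝ) (u : ℂ) : ℂ :=
  c0 m * ((2 * m + 1) * (2 * m * EK (2 * m - 1) 0 (m + 1) δ u - (m + 1) * EK (2 * m) 1 (m + 2) δ u) +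
    (-(m + 1)) * ((2 * m + 1) * EK (2 * m) 1 (m + 2) δ u - (m + 2) * EK (2 * m + 1) 2 (m + 3) δ u))

lemma pK_deriv (m : ℕ) {δ : ℝ} (hδ : 0 < δ) (u : ℂ) : HW (pK m δ) (pz m δ u) (py m δ u) u := by
  have := (((EK_deriv (2 * m) 0 (m + 1) hδ u).const_mul (2 * m + 1)).add
    ((EK_deriv (2 * m + 1) 1 (m + 2) hδ u).const_mul (-(m + 1)))).const_mul (c0 m)
  refine this.congr ?_ ?_
  · simp only [pz, Nat.sub_self]; push_cast; ring
  · simp only [py, Nat.add_sub_cancel]; push_cast; ring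

def qz (m : ℕ) (δ : ℝ) (u : ℂ) : ℂ :=
  (- c0 m * (m + 1)) * (- (m + 2) * EK (2 * m + 3) 0 (m + 3) δ u)

lemma qK_deriv (m : ℕ) {δ : ℝ} (hδ : 0 < δ) (u : ℂ) : HW (qK m δ) (qz m δ u) (pz m δ u) u := by
  have := (EK_deriv (2 * m + 2) 0 (m + 2) hδ u).const_mul (- c0 m * (m + 1))
  refine this.congr ?_ ?_
  · simp only [qz]; push_cast; ring
  · simp only [pz]
    have e : 2 * m + 2 - 1 = 2 * m + 1 := by omega
    rw [e]; push_cast; ring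

def hK (η : ℝ) (u : ℂ) : ℂ := (1 / Real.pi) * EK 1 0 1 η u
def b1K (η : ℝ) (u : ℂ) : ℂ := (-(1 / Real.pi)) * EK 2 0 2 η u
def PK (η : ℝ) (u : ℂ) : ℂ := (1 / Real.pi) * (EK 0 0 1 η u - EK 1 1 2 η u)

lemma hK_deriv {η : ℝ} (hη : 0 < η) (u : ℂ) : HW (hK η) (b1K η u) (PK η u) u := by
  refine ((EK_deriv 1 0 1 hη u).const_mul (1 / Real.pi)).congr ?_ ?_
  · simp only [b1K]; push_cast; ring
  · simp only [PK]; push_cast; ring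

lemma HW.continuousAt {f x y u} (h : HW f x y u) : ContinuousAt f u := HasFDerivAt.continuousAt h

lemma pK_cont (m : ℕ) {δ : ℝ} (hδ : 0 < δ) : Continuous (pK m δ) :=
  continuous_iff_continuousAt.2 fun u => (pK_deriv m hδ u).continuousAt
lemma qK_cont (m : ℕ) {δ : ℝ} (hδ : 0 < δ) : Continuous (qK m δ) :=
  continuous_iff_continuousAt.2 fun u => (qK_deriv m hδ u).continuousAt
lemma hK_cont {δ : ℝ} (hδ : 0 < δ) : Continuous (hK δ) :=
  continuous_iff_continuousAt.2 fun u => (hK_deriv hδ u).continuousAt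

lemma pK_meas (m : ℕ) (δ : ℝ) : Measurable (pK m δ) := by
  unfold pK; have := EK_meas; fun_prop
lemma qK_meas (m : ℕ) (δ : ℝ) : Measurable (qK m δ) := by
  unfold qK; have := EK_meas; fun_prop
lemma hK_meas (δ : ℝ) : Measurable (hK δ) := by
  unfold hK; have := EK_meas; fun_prop
lemma b1K_meas (δ : ℝ) : Measurable (b1K δ) := by
  unfold b1K; have := EK_meas; fun_prop
lemma PK_meas (δ : ℝ) : Measurable (PK δ) := by
  unfold PK; have := EK_meas; fun_prop
lemma pz_meas (m : ℕ) (δ : ℝ) : Measurable (pz m δ) := by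
  unfold pz; have := EK_meas; fun_prop
lemma py_meas (m : ℕ) (δ : ℝ) : Measurable (py m δ) := by
  unfold py; have := EK_meas; fun_prop
lemma qz_meas (m : ℕ) (δ : ℝ) : Measurable (qz m δ) := by
  unfold qz; have := EK_meas; fun_prop

lemma pK_dec (m : ℕ) {δ : ℝ} (hδ : 0 < δ) : Dec 2 (pK m δ) :=
  (((EK_dec (by omega) hδ).const_mul _).add ((EK_dec (by omega) hδ).const_mul _)).const_mul _
lemma qK_dec (m : ℕ) {δ : ℝ} (hδ : 0 < δ) : Dec 2 (qK m δ) := (EK_dec (by omega) hδ).const_mul _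
lemma pz_dec (m : ℕ) {δ : ℝ} (hδ : 0 < δ) : Dec 2 (pz m δ) :=
  ((((EK_dec (by omega) hδ).const_mul _).const_mul _).add
    (((EK_dec (by omega) hδ).sub ((EK_dec (by omega) hδ).const_mul _)).const_mul _)).const_mul _
lemma py_dec (m : ℕ) {δ : ℝ} (hδ : 0 < δ) : Dec 2 (py m δ) :=
  (((((EK_dec (by omega) hδ).const_mul _).sub ((EK_dec (by omega) hδ).const_mul _)).const_mul _).add
    ((((EK_dec (by omega) hδ).const_mul _).sub ((EK_dec (by omega) hδ).const_mul _)).const_mul _)).const_mul _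
lemma qz_dec (m : ℕ) {δ : ℝ} (hδ : 0 < δ) : Dec 2 (qz m δ) :=
  ((EK_dec (by omega) hδ).const_mul _).const_mul _
lemma hK_dec {δ : ℝ} (hδ : 0 < δ) : Dec 1 (hK δ) := (EK_dec (by omega) hδ).const_mul _
lemma b1K_dec {δ : ℝ} (hδ : 0 < δ) : Dec 2 (b1K δ) := (EK_dec (by omega) hδ).const_mul _
lemma PK_eq {δ : ℝ} (hδ : 0 < δ) (u : ℂ) : PK δ u = (δ ^ 2 / Real.pi) * EK 0 0 2 δ u := by
  have hR : (Rd δ u : ℂ) ≠ 0 := by exact_mod_cast (Rd_pos hδ u).ne'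
  have := Rd_eq δ u
  simp only [PK, EK]
  field_simp
  rw [this]; ring
lemma PK_dec {δ : ℝ} (hδ : 0 < δ) : Dec 4 (PK δ) := by
  have : PK δ = fun u => (δ ^ 2 / Real.pi : ℂ) * EK 0 0 2 δ u := funext fun u => PK_eq hδ u
  rw [this]
  exact (EK_dec (by omega) hδ).const_mul _

lemma conv_id (m : ℕ) {δ η : ℝ} (hδ : 0 < δ) (hη : 0 < η) (x : ℂ) :
    ∫ u, b1K η (x - u) * pK m δ u = ∫ u, PK η (x - u) * qK m δ u := by
  have hf := fun u => (hK_deriv hη (x - u)).shift x u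
  have ms : Measurable (fun u : ℂ => x - u) := by fun_prop
  have i : ∀ {F G : ℂ → ℂ}, Dec 1 F → Dec 2 G → Measurable F → Measurable G →
      Integrable (fun u => F (x - u) * G u) := fun hF hG mF mG =>
    ((hF.shift x).mul hG).integrable ((mF.comp ms).mul mG)
  have b1 := (b1K_dec hη).mono (i := 1) (by omega)
  have P1 := (PK_dec hη).mono (i := 1) (by omega)
  have A := (HW_parts hf (fun u => pK_deriv m hδ u)
    (i (hK_dec hη) (pK_dec m hδ) (hK_meas η) (pK_meas m δ))
    (by simp only [neg_mul]; exact (i b1 (pK_dec m hδ) (b1K_meas η) (pK_meas m δ)).neg)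
    (by simp only [neg_mul]; exact (i P1 (pK_dec m hδ) (PK_meas η) (pK_meas m δ)).neg)
    (i (hK_dec hη) (pz_dec m hδ) (hK_meas η) (pz_meas m δ))
    (i (hK_dec hη) (py_dec m hδ) (hK_meas η) (py_meas m δ))).1
  have B := (HW_parts hf (fun u => qK_deriv m hδ u)
    (i (hK_dec hη) (qK_dec m hδ) (hK_meas η) (qK_meas m δ))
    (by simp only [neg_mul]; exact (i b1 (qK_dec m hδ) (b1K_meas η) (qK_meas m δ)).neg)
    (by simp only [neg_mul]; exact (i P1 (qK_dec m hδ) (PK_meas η) (qK_meas m δ)).neg)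
    (i (hK_dec hη) (qz_dec m hδ) (hK_meas η) (qz_meas m δ))
    (i (hK_dec hη) (pz_dec m hδ) (hK_meas η) (pz_meas m δ))).2
  simp only [neg_mul, integral_neg, neg_neg] at A B
  rw [← A, ← B]

/-! size bounds -/
lemma pK_bd (m : ℕ) {δ : ℝ} (hδ : 0 < δ) (u : ℂ) : ‖pK m δ u‖ ≤ BK (m + 1) / Rd δ u := by
  have hR := Rd_pos hδ u
  have e1 := EK_le0 (a := 2 * m) (b := 0) (k := m + 1) (j := m) (by ring) rfl hδ u
  have e2 := EK_le0 (a := 2 * m + 1) (b := 1) (k := m + 2) (j := m + 1) (by ring) rfl hδ u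
  have n1 : ‖(2 * m + 1 : ℂ)‖ = 2 * m + 1 := by exact_mod_cast Complex.norm_natCast (2 * m + 1)
  have n2 : ‖(m + 1 : ℂ)‖ = m + 1 := by exact_mod_cast Complex.norm_natCast (m + 1)
  calc _ ≤ 1 * ((2 * m + 1) * (1 / Rd δ u) + (m + 1) * (1 / Rd δ u)) := by
        rw [pK, norm_mul]
        gcongr
        · exact c0_norm m
        · refine (norm_add_le _ _).trans ?_
          rw [norm_mul, norm_mul, norm_neg, n1, n2]
          gcongr
    _ = (3 * m + 2) / Rd δ u := by ring
    _ ≤ _ := by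
      unfold BK; gcongr; push_cast; nlinarith [(Nat.cast_nonneg m : (0:ℝ) ≤ m)]

lemma qK_bd (m : ℕ) {δ : ℝ} (hδ : 0 < δ) (u : ℂ) : ‖qK m δ u‖ ≤ BK (m + 1) / Rd δ u := by
  have hR := Rd_pos hδ u
  have e1 := EK_le0 (a := 2 * m + 2) (b := 0) (k := m + 2) (j := m + 1) (by ring) rfl hδ u
  have n2 : ‖(m + 1 : ℂ)‖ = m + 1 := by exact_mod_cast Complex.norm_natCast (m + 1)
  calc _ ≤ 1 * (m + 1) * (1 / Rd δ u) := by
        rw [qK, norm_mul, norm_mul, norm_neg, n2]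
        gcongr
        exact c0_norm m
    _ = (m + 1) / Rd δ u := by ring
    _ ≤ _ := by
      unfold BK; gcongr; push_cast; nlinarith [(Nat.cast_nonneg m : (0:ℝ) ≤ m)]

lemma b1K_bd {δ : ℝ} (hδ : 0 < δ) (u : ℂ) : ‖b1K δ u‖ ≤ BK 1 / Rd δ u := by
  have hR := Rd_pos hδ u
  have : b1K δ u = qK 0 δ u := by simp [b1K, qK, c0]
  rw [this]; exact qK_bd 0 hδ u

lemma Dp_bd {m : ℕ} (hm : 1 ≤ m) {δ : ℝ} (hδ : 0 < δ) (u : ℂ) :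
    ‖pz m δ u‖ + ‖py m δ u‖ ≤ BK (m + 1) * (‖u‖ / Rd δ u ^ 2) := by
  have hR := Rd_pos hδ u
  have e1 := EK_le1 (a := 2 * m + 1) (b := 0) (k := m + 2) (j := m) (by ring) rfl hδ u
  have e2 := EK_le1 (a := 2 * m + 2) (b := 1) (k := m + 3) (j := m + 1) (by ring) rfl hδ u
  have e3 := EK_le1 (a := 2 * m - 1) (b := 0) (k := m + 1) (j := m - 1) (by omega) (by omega) hδ u
  have e4 := EK_le1 (a := 2 * m) (b := 1) (k := m + 2) (j := m) (by ring) rfl hδ u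
  have e5 := EK_le1 (a := 2 * m + 1) (b := 2) (k := m + 3) (j := m + 1) (by ring) rfl hδ u
  have n1 : ‖(2 * m + 1 : ℂ)‖ = 2 * m + 1 := by exact_mod_cast Complex.norm_natCast (2 * m + 1)
  have n2 : ‖(m + 1 : ℂ)‖ = m + 1 := by exact_mod_cast Complex.norm_natCast (m + 1)
  have n3 : ‖(m + 2 : ℂ)‖ = m + 2 := by exact_mod_cast Complex.norm_natCast (m + 2)
  have n4 : ‖(2 * m : ℂ)‖ = 2 * m := by exact_mod_cast Complex.norm_natCast (2 * m)
  set X := ‖u‖ / Rd δ u ^ 2 with hX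
  have hX0 : 0 ≤ X := by positivity
  have a : ‖pz m δ u‖ ≤ 1 * ((2 * m + 1) * ((m + 1) * X) + (m + 1) * (X + (m + 2) * X)) := by
    rw [pz, norm_mul]
    gcongr
    · exact c0_norm m
    · refine (norm_add_le _ _).trans ?_
      rw [norm_mul, norm_mul, norm_mul, norm_neg, n1, n2]
      gcongr
      refine (norm_sub_le _ _).trans ?_
      rw [norm_mul, n3]
      gcongr
  have b : ‖py m δ u‖ ≤ 1 * ((2 * m + 1) * (2 * m * X + (m + 1) * X) +
      (m + 1) * ((2 * m + 1) * X + (m + 2) * X)) := by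
    rw [py, norm_mul]
    gcongr
    · exact c0_norm m
    · refine (norm_add_le _ _).trans ?_
      rw [norm_mul, norm_mul, norm_neg, n1, n2]
      gcongr
      · refine (norm_sub_le _ _).trans ?_
        rw [norm_mul, norm_mul (_ + _ : ℂ), n2, n4]
        gcongr
      · refine (norm_sub_le _ _).trans ?_
        rw [norm_mul, norm_mul, n1, n3]
        gcongr
  refine (add_le_add a b).trans ?_
  unfold BK; push_cast
  have hm0 : (0:ℝ) ≤ m := Nat.cast_nonneg m
  nlinarith [mul_nonneg hm0 hX0, mul_nonneg (mul_nonneg hm0 hm0) hX0]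

lemma bern_inv {x t : ℝ} (hx : 0 < x) (ht : 0 ≤ t) (k : ℕ) :
    |1 / (x + t) ^ k - 1 / x ^ k| ≤ k * t / (x ^ k * (x + t)) := by
  have hxt : 0 < x + t := by linarith
  have hb := one_add_mul_le_pow (a := x / (x + t) - 1) (by
    have : 0 ≤ x / (x + t) := by positivity
    linarith) k
  have e : x / (x + t) - 1 = - (t / (x + t)) := by field_simp; ring
  have e1 : 1 + (x / (x + t) - 1) = x / (x + t) := by ring
  rw [e1, e, div_pow] at hb
  have h2 : 1 / (x + t) ^ k ≤ 1 / x ^ k := by gcongr; linarith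
  rw [abs_sub_comm, abs_of_nonneg (by linarith)]
  have h3 : 1 / x ^ k - 1 / (x + t) ^ k = 1 / x ^ k * (1 - x ^ k / (x + t) ^ k) := by
    field_simp
  rw [h3]
  calc _ ≤ 1 / x ^ k * (k * (t / (x + t))) := by gcongr; linarith
    _ = _ := by field_simp

lemma EK_diff {a b k j : ℕ} (h : a + b = 2 * j) (hk : k = j + 1) {δ : ℝ} (hδ : 0 < δ) {u : ℂ} (hu : u ≠ 0) :
    ‖EK a b k 0 u - EK a b k δ u‖ ≤ k * (δ ^ 2 / (‖u‖ ^ 2 * Rd δ u)) := by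
  have hn : 0 < ‖u‖ := norm_pos_iff.2 hu
  have e : EK a b k 0 u - EK a b k δ u = (starRingEnd ℂ) u ^ a * u ^ b *
      ((-(1 / (‖u‖ ^ 2 + δ ^ 2) ^ k - 1 / (‖u‖ ^ 2) ^ k) : ℝ) : ℂ) := by
    simp only [EK, Rd]; push_cast; ring_nf
  rw [e, norm_mul, norm_mul, norm_pow, norm_pow, Complex.norm_conj, Complex.norm_real, norm_neg, ← pow_add, h]
  calc _ ≤ ‖u‖ ^ (2 * j) * (k * δ ^ 2 / ((‖u‖ ^ 2) ^ k * (‖u‖ ^ 2 + δ ^ 2))) := by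
        gcongr; exact bern_inv (by positivity) (by positivity) k
    _ = _ := by
      subst hk
      unfold Rd
      rw [pow_succ (‖u‖ ^ 2), pow_mul]
      field_simp

lemma bn_EK {m : ℕ} (hm : 1 ≤ m) {u : ℂ} (hu : u ≠ 0) : bnKer m u = c0 m * m * EK (2 * m) 0 (m + 1) 0 u := by
  obtain ⟨k, rfl⟩ := Nat.exists_eq_add_of_le' hm
  have hc : (starRingEnd ℂ) u ≠ 0 := by simpa using hu
  rw [EK, Rd_eq]
  simp only [bnKer, c0, Nat.add_sub_cancel, Complex.ofReal_zero]
  field_simp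
  ring

lemma EK0_red {m : ℕ} {u : ℂ} (hu : u ≠ 0) : EK (2 * m + 1) 1 (m + 2) 0 u = EK (2 * m) 0 (m + 1) 0 u := by
  have hc : (starRingEnd ℂ) u ≠ 0 := by simpa using hu
  rw [EK, EK, Rd_eq]
  simp only [Complex.ofReal_zero]
  field_simp
  ring

lemma pK_diff {m : ℕ} (hm : 1 ≤ m) {δ : ℝ} (hδ : 0 < δ) (u : ℂ) :
    ‖bnKer m u - pK m δ u‖ ≤ BK (m + 1) * (δ ^ 2 / (‖u‖ ^ 2 * Rd δ u)) := by
  have hR := Rd_pos hδ u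
  have hB := BK_nonneg (m + 1)
  by_cases hu : u = 0
  · subst hu
    have h1 : bnKer m 0 = 0 := by simp [bnKer]
    have h2 : pK m δ 0 = 0 := by
      have : m ≠ 0 := by omega
      simp [pK, EK, this]
    rw [h1, h2, sub_zero, norm_zero]; positivity
  have e1 := EK_diff (a := 2 * m) (b := 0) (k := m + 1) (j := m) (by ring) rfl hδ hu
  have e2 := EK_diff (a := 2 * m + 1) (b := 1) (k := m + 2) (j := m + 1) (by ring) rfl hδ hu
  have n1 : ‖(2 * m + 1 : ℂ)‖ = 2 * m + 1 := by exact_mod_cast Complex.norm_natCast (2 * m + 1)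
  have n2 : ‖(m + 1 : ℂ)‖ = m + 1 := by exact_mod_cast Complex.norm_natCast (m + 1)
  set X := δ ^ 2 / (‖u‖ ^ 2 * Rd δ u) with hX
  have hX0 : 0 ≤ X := by positivity
  have e : bnKer m u - pK m δ u = c0 m * ((2 * m + 1) * (EK (2 * m) 0 (m + 1) 0 u - EK (2 * m) 0 (m + 1) δ u)
      - (m + 1) * (EK (2 * m + 1) 1 (m + 2) 0 u - EK (2 * m + 1) 1 (m + 2) δ u)) := by
    rw [bn_EK hm hu, EK0_red hu, pK]; ring
  rw [e, norm_mul]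
  calc _ ≤ 1 * ((2 * m + 1) * ((m + 1 : ℕ) * X) + (m + 1) * ((m + 2 : ℕ) * X)) := by
        gcongr
        · exact c0_norm m
        · refine (norm_sub_le _ _).trans ?_
          rw [norm_mul, norm_mul, n1, n2]
          gcongr
    _ ≤ _ := by
      unfold BK; push_cast
      have hm0 : (0:ℝ) ≤ m := Nat.cast_nonneg m
      nlinarith [mul_nonneg hm0 hX0, mul_nonneg (mul_nonneg hm0 hm0) hX0]

lemma qK_diff (m : ℕ) {δ : ℝ} (hδ : 0 < δ) (u : ℂ) :
    ‖bnKer (m + 1) u - qK m δ u‖ ≤ BK (m + 1) * (δ ^ 2 / (‖u‖ ^ 2 * Rd δ u)) := by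
  have hR := Rd_pos hδ u
  have hB := BK_nonneg (m + 1)
  by_cases hu : u = 0
  · subst hu
    have h1 : bnKer (m + 1) 0 = 0 := by simp [bnKer]
    have h2 : qK m δ 0 = 0 := by simp [qK, EK]
    rw [h1, h2, sub_zero, norm_zero]; positivity
  have e1 := EK_diff (a := 2 * m + 2) (b := 0) (k := m + 2) (j := m + 1) (by ring) rfl hδ hu
  have n2 : ‖(m + 1 : ℂ)‖ = m + 1 := by exact_mod_cast Complex.norm_natCast (m + 1)
  set X := δ ^ 2 / (‖u‖ ^ 2 * Rd δ u) with hX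
  have hX0 : 0 ≤ X := by positivity
  have e : bnKer (m + 1) u - qK m δ u = (- c0 m * (m + 1)) *
      (EK (2 * m + 2) 0 (m + 2) 0 u - EK (2 * m + 2) 0 (m + 2) δ u) := by
    have : c0 (m + 1) = - c0 m := by simp only [c0, pow_succ]; ring
    rw [bn_EK (by omega) hu, qK, this]
    push_cast; ring_nf
  rw [e, norm_mul, norm_mul, norm_neg, n2]
  calc _ ≤ 1 * (m + 1) * ((m + 2 : ℕ) * X) := by
        gcongr
        exact c0_norm m
    _ ≤ _ := by
      unfold BK; push_cast
      have hm0 : (0:ℝ) ≤ m := Nat.cast_nonneg m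
      nlinarith [mul_nonneg hm0 hX0, mul_nonneg (mul_nonneg hm0 hm0) hX0]

lemma pK_rot (m : ℕ) {δ : ℝ} {ω : ℂ} (hω : ‖ω‖ = 1) (u : ℂ) :
    pK m δ (ω * u) = (starRingEnd ℂ) ω ^ (2 * m) * pK m δ u := by
  have h : (starRingEnd ℂ) ω * ω = 1 := by
    rw [mul_comm, Complex.mul_conj, Complex.normSq_eq_norm_sq, hω]; simp
  simp only [pK, EK_rot hω, pow_succ _ (2 * m), pow_one, pow_zero]
  linear_combination (c0 m * (-(m + 1)) * (starRingEnd ℂ) ω ^ (2 * m) * EK (2 * m + 1) 1 (m + 2) δ u) * h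

lemma qK_rot (m : ℕ) {δ : ℝ} {ω : ℂ} (hω : ‖ω‖ = 1) (u : ℂ) :
    qK m δ (ω * u) = (starRingEnd ℂ) ω ^ (2 * (m + 1)) * qK m δ u := by
  simp only [qK, EK_rot hω, pow_zero, mul_add, mul_one]; ring

lemma Rd_le {δ : ℝ} (u : ℂ) : ‖u‖ ^ 2 ≤ Rd δ u := by unfold Rd; nlinarith
lemma Rd_le' {δ : ℝ} (u : ℂ) : δ ^ 2 ≤ Rd δ u := by unfold Rd; nlinarith [sq_nonneg ‖u‖]

lemma ddiv_le {δ : ℝ} (hδ : 0 < δ) (u : ℂ) : δ ^ 2 / (‖u‖ ^ 2 * Rd δ u) ≤ 1 / ‖u‖ ^ 2 := by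
  have hR := Rd_pos hδ u
  by_cases hu : u = 0
  · subst hu; simp
  have hn : 0 < ‖u‖ := norm_pos_iff.2 hu
  rw [div_le_div_iff₀ (by positivity) (by positivity)]
  have := Rd_le' (δ := δ) u
  nlinarith [mul_nonneg (sq_nonneg ‖u‖) (sub_nonneg.2 this)]

lemma ddiv_le_s {δ s : ℝ} (hδ : 0 < δ) (hs0 : 0 ≤ s) (hs : s ≤ 2) (u : ℂ) :
    δ ^ 2 / (‖u‖ ^ 2 * Rd δ u) ≤ δ ^ s * ‖u‖ ^ (-2 - s) := by
  have hR := Rd_pos hδ u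
  by_cases hu : u = 0
  · subst hu; simp; positivity
  have hn : 0 < ‖u‖ := norm_pos_iff.2 hu
  have key : δ ^ 2 / Rd δ u ≤ (δ / ‖u‖) ^ s := by
    rcases le_total ‖u‖ δ with h | h
    · calc _ ≤ (1:ℝ) := by rw [div_le_one hR]; exact Rd_le' u
        _ ≤ _ := Real.one_le_rpow (by rwa [one_le_div hn]) hs0
    · calc _ ≤ δ ^ 2 / ‖u‖ ^ 2 := by gcongr; exact Rd_le u
        _ = (δ / ‖u‖) ^ (2:ℝ) := by rw [← div_pow]; norm_cast
        _ ≤ _ := Real.rpow_le_rpow_of_exponent_ge (by positivity) (by rwa [div_le_one hn]) hs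
  calc _ = δ ^ 2 / Rd δ u * (1 / ‖u‖ ^ 2) := by field_simp
    _ ≤ (δ / ‖u‖) ^ s * (1 / ‖u‖ ^ 2) := by gcongr
    _ = _ := by
      rw [Real.div_rpow hδ.le hn.le, sub_eq_add_neg, Real.rpow_add hn, Real.rpow_neg hn.le s, Real.rpow_neg hn.le 2]
      norm_cast
      field_simp

lemma invR_le_s {δ s : ℝ} (hδ : 0 < δ) (hs0 : 0 ≤ s) (hs : s ≤ 2) {u : ℂ} (hu : u ≠ 0) :
    1 / Rd δ u ≤ δ ^ (-s) * ‖u‖ ^ (s - 2) := by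
  have hR := Rd_pos hδ u
  have hn : 0 < ‖u‖ := norm_pos_iff.2 hu
  have key : ‖u‖ ^ (2 - s) * δ ^ s ≤ Rd δ u := by
    have : ∀ x : ℝ, 0 < x → ‖u‖ ≤ x → δ ≤ x → x ^ 2 ≤ Rd δ u → ‖u‖ ^ (2 - s) * δ ^ s ≤ Rd δ u := by
      intro x hx h1 h2 h3
      calc _ ≤ x ^ (2 - s) * x ^ s := by gcongr
        _ = x ^ 2 := by rw [← Real.rpow_add hx]; simp
        _ ≤ _ := h3
    rcases le_total ‖u‖ δ with h | h
    · exact this δ hδ h le_rfl (Rd_le' u)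
    · exact this ‖u‖ hn le_rfl h (Rd_le u)
  have e : δ ^ (-s) * ‖u‖ ^ (s - 2) = 1 / (‖u‖ ^ (2 - s) * δ ^ s) := by
    rw [Real.rpow_neg hδ.le, show s - 2 = -(2 - s) by ring, Real.rpow_neg hn.le]
    field_simp
  rw [e]
  gcongr

lemma pKd_ker {m : ℕ} (hm : 1 ≤ m) {δ : ℝ} (hδ : 0 < δ) :
    KerB (fun u => bnKer m u - pK m δ u) (BK (m + 1)) where
  nn := BK_nonneg _
  meas := (bn_meas m).sub (pK_meas m δ)
  bd := fun u => (pK_diff hm hδ u).trans (by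
    rw [div_eq_mul_one_div (BK (m + 1))]; exact mul_le_mul_of_nonneg_left (ddiv_le hδ u) (BK_nonneg _))
  rot := ⟨rotU m, rotU_norm m, fun u => by
    rw [bn_rot hm (rotU_norm m), pK_rot m (rotU_norm m), rotU_conj_pow hm]; ring⟩

lemma qKd_ker (m : ℕ) {δ : ℝ} (hδ : 0 < δ) :
    KerB (fun u => bnKer (m + 1) u - qK m δ u) (BK (m + 1)) where
  nn := BK_nonneg _
  meas := (bn_meas (m + 1)).sub (qK_meas m δ)
  bd := fun u => (qK_diff m hδ u).trans (by
    rw [div_eq_mul_one_div (BK (m + 1))]; exact mul_le_mul_of_nonneg_left (ddiv_le hδ u) (BK_nonneg _))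
  rot := ⟨rotU (m + 1), rotU_norm _, fun u => by
    rw [bn_rot (by omega) (rotU_norm _), qK_rot m (rotU_norm _), rotU_conj_pow (by omega)]; ring⟩

lemma pK_ker {m : ℕ} (hm : 1 ≤ m) {δ : ℝ} (hδ : 0 < δ) : KerB (pK m δ) (BK (m + 1)) where
  nn := BK_nonneg _
  meas := pK_meas m δ
  bd := fun u => by
    by_cases hu : u = 0
    · subst hu
      have : m ≠ 0 := by omega
      simp [pK, EK, this]
    have hn : 0 < ‖u‖ := norm_pos_iff.2 hu
    have := BK_nonneg (m + 1)
    exact (pK_bd m hδ u).trans (by gcongr; exact Rd_le u)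
  rot := ⟨rotU m, rotU_norm _, fun u => by
    rw [pK_rot m (rotU_norm _), rotU_conj_pow hm]; ring⟩

lemma qK_ker (m : ℕ) {δ : ℝ} (hδ : 0 < δ) : KerB (qK m δ) (BK (m + 1)) where
  nn := BK_nonneg _
  meas := qK_meas m δ
  bd := fun u => by
    by_cases hu : u = 0
    · subst hu
      simp [qK, EK]
    have hn : 0 < ‖u‖ := norm_pos_iff.2 hu
    have := BK_nonneg (m + 1)
    exact (qK_bd m hδ u).trans (by gcongr; exact Rd_le u)
  rot := ⟨rotU (m + 1), rotU_norm _, fun u => by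
    rw [qK_rot m (rotU_norm _), rotU_conj_pow (by omega)]; ring⟩

lemma b1K_eq (δ : ℝ) : b1K δ = qK 0 δ := by ext u; simp [b1K, qK, c0]

lemma b1K_lim {u : ℂ} (hu : u ≠ 0) : Tendsto (fun η => b1K η u) (𝓝[>] 0) (𝓝 (bnKer 1 u)) := by
  have hn : 0 < ‖u‖ := norm_pos_iff.2 hu
  have : Tendsto (fun η : ℝ => BK (0 + 1) * (η ^ 2 / (‖u‖ ^ 2 * ‖u‖ ^ 2))) (𝓝[>] 0) (𝓝 0) := by
    have : Continuous (fun η : ℝ => BK (0 + 1) * (η ^ 2 / (‖u‖ ^ 2 * ‖u‖ ^ 2))) := by fun_prop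
    have := (this.tendsto 0).mono_left (nhdsWithin_le_nhds (s := Ioi 0))
    simpa using this
  rw [tendsto_iff_norm_sub_tendsto_zero]
  refine squeeze_zero' (Eventually.of_forall fun _ => norm_nonneg _) ?_ this
  filter_upwards [self_mem_nhdsWithin] with η hη
  rw [b1K_eq, norm_sub_rev]
  have := BK_nonneg (0 + 1)
  refine (qK_diff 0 hη u).trans ?_
  gcongr
  exact Rd_le u

lemma pK_lip_far {m : ℕ} (hm : 1 ≤ m) {δ : ℝ} (hδ : 0 < δ) {r : ℝ} (hr : 0 < r) {S : Set ℂ}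
    (hS : Convex ℝ S) (hb : ∀ u ∈ S, ‖u‖ / Rd δ u ^ 2 ≤ r) {u v : ℂ} (hu : u ∈ S) (hv : v ∈ S) :
    ‖pK m δ v - pK m δ u‖ ≤ BK (m + 1) * r * ‖v - u‖ := by
  refine Convex.norm_image_sub_le_of_norm_hasFDerivWithin_le (𝕜 := ℝ)
    (fun x _ => (pK_deriv m hδ x).hasFDerivWithinAt) (fun x hx => ?_) hS hu hv
  refine le_trans ?_ ((Dp_bd hm hδ x).trans (by have := BK_nonneg (m+1); gcongr; exact hb x hx))
  refine ContinuousLinearMap.opNorm_le_bound _ (by positivity) fun w => ?_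
  rw [WD_apply, add_mul]
  refine (norm_add_le _ _).trans ?_
  rw [norm_mul, norm_mul, Complex.norm_conj]

lemma pK_lip {m : ℕ} (hm : 1 ≤ m) {δ : ℝ} (hδ : 0 < δ) (u v : ℂ) :
    ‖pK m δ v - pK m δ u‖ ≤ BK (m + 1) * (1 / δ ^ 3) * ‖v - u‖ := by
  refine pK_lip_far hm hδ (by positivity) convex_univ (fun x _ => ?_) (mem_univ _) (mem_univ _)
  have hR := Rd_pos hδ x
  rw [div_le_div_iff₀ (by positivity) (by positivity), one_mul]
  have h1 := Rd_le (δ := δ) x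
  have h2 := Rd_le' (δ := δ) x
  have h3 : ‖x‖ * δ ≤ Rd δ x := by unfold Rd; nlinarith [sq_nonneg (‖x‖ - δ)]
  calc _ = (‖x‖ * δ) * δ ^ 2 := by ring
    _ ≤ Rd δ x * Rd δ x := by gcongr
    _ = _ := by ring

lemma pK_lip_near {m : ℕ} (hm : 1 ≤ m) {δ : ℝ} (hδ : 0 < δ) {u v : ℂ} (hu : u ≠ 0) (h : ‖v - u‖ ≤ ‖u‖ / 2) :
    ‖pK m δ v - pK m δ u‖ ≤ BK (m + 1) * (8 / ‖u‖ ^ 3) * ‖v - u‖ := by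
  have hn : 0 < ‖u‖ := norm_pos_iff.2 hu
  refine pK_lip_far hm hδ (by positivity) (convex_closedBall u (‖u‖ / 2)) (fun x hx => ?_)
    (mem_closedBall_self (by positivity)) (by rwa [mem_closedBall, dist_eq_norm])
  have hx2 : ‖u‖ / 2 ≤ ‖x‖ := by
    rw [mem_closedBall, dist_eq_norm, norm_sub_rev] at hx
    have := norm_sub_norm_le u x
    linarith
  have hx0 : 0 < ‖x‖ := by linarith
  calc _ ≤ ‖x‖ / (‖x‖ ^ 2) ^ 2 := by gcongr; exact Rd_le x
    _ = 1 / ‖x‖ ^ 3 := by field_simp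
    _ ≤ 1 / (‖u‖ / 2) ^ 3 := by gcongr
    _ = _ := by field_simp; norm_num

def Pr (v : ℂ) : ℝ := 1 / Real.pi / (‖v‖ ^ 2 + 1) ^ 2

lemma Pr_nonneg (v : ℂ) : 0 ≤ Pr v := by unfold Pr; have := Real.pi_pos; positivity

lemma Pr_aux : IntegrableOn (fun y : ℝ => y * (1 / Real.pi / (y ^ 2 + 1) ^ 2)) (Ioi 0) ∧
    ∫ y in Ioi (0:ℝ), y * (1 / Real.pi / (y ^ 2 + 1) ^ 2) = 1 / (2 * Real.pi) := by
  have hp := Real.pi_pos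
  have hd : ∀ y ∈ Ici (0:ℝ), HasDerivAt (fun y : ℝ => -(1 / (2 * Real.pi)) * (y ^ 2 + 1)⁻¹)
      (y * (1 / Real.pi / (y ^ 2 + 1) ^ 2)) y := fun y _ => by
    have h1 : HasDerivAt (fun y : ℝ => y ^ 2 + 1) (2 * y) y := by
      simpa using (hasDerivAt_pow 2 y).add_const 1
    have := (h1.inv (by positivity)).const_mul (-(1 / (2 * Real.pi)))
    refine (this.congr_deriv ?_)
    field_simp
  have hl : Tendsto (fun y : ℝ => -(1 / (2 * Real.pi)) * (y ^ 2 + 1)⁻¹) atTop (𝓝 0) := by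
    have : Tendsto (fun y : ℝ => y ^ 2 + 1) atTop atTop :=
      tendsto_atTop_add_const_right _ _ (tendsto_pow_atTop (by norm_num))
    simpa using (tendsto_inv_atTop_zero.comp this).const_mul (-(1 / (2 * Real.pi)))
  have hnn : ∀ y ∈ Ioi (0:ℝ), 0 ≤ y * (1 / Real.pi / (y ^ 2 + 1) ^ 2) := fun y hy => by
    have : (0:ℝ) < y := hy
    positivity
  refine ⟨integrableOn_Ioi_deriv_of_nonneg' hd hnn hl, ?_⟩
  rw [integral_Ioi_of_hasDerivAt_of_nonneg' hd hnn hl]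
  simp

lemma Pr_integrable : Integrable Pr := by
  have := cx_radial_integrable Pr_aux.1 0
  simp only [zero_sub, norm_neg] at this
  exact this

lemma Pr_integral : ∫ v, Pr v = 1 := by
  have := cx_radial_integral (fun y => 1 / Real.pi / (y ^ 2 + 1) ^ 2) 0
  simp only [zero_sub, norm_neg] at this
  unfold Pr
  rw [this, Pr_aux.2]
  have := Real.pi_pos
  field_simp

lemma conv_P {η : ℝ} (hη : 0 < η) (q : ℂ → ℂ) (x : ℂ) :
    ∫ u, PK η (x - u) * q u = ∫ v, (Pr v : ℂ) * q (x - η * v) := by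
  have e1 : ∫ u, PK η (x - u) * q u = ∫ u, PK η u * q (x - u) := by
    rw [← integral_sub_left_eq_self (fun u => PK η u * q (x - u)) volume x]
    simp
  have e2 := Measure.integral_comp_smul (volume : Measure ℂ) (fun u => PK η u * q (x - u)) η
  rw [Complex.finrank_real_complex, abs_of_pos (by positivity)] at e2
  have e3 : ∫ u, PK η u * q (x - u) = (η ^ 2) • ∫ v, PK η (η • v) * q (x - η • v) := by
    rw [e2, smul_smul, mul_inv_cancel₀ (by positivity), one_smul]
  rw [e1, e3, ← integral_smul]
  congr 1; ext v
  have hR : (Rd 1 v : ℂ) ≠ 0 := by exact_mod_cast (Rd_pos one_pos v).ne'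
  have hη' : (η : ℂ) ≠ 0 := by exact_mod_cast hη.ne'
  have hp : (Real.pi : ℂ) ≠ 0 := by exact_mod_cast Real.pi_ne_zero
  have e4 : Rd η (η • v) = η ^ 2 * Rd 1 v := by
    unfold Rd; rw [norm_smul, Real.norm_of_nonneg hη.le]; ring
  rw [PK_eq hη, EK, e4]
  have e5 : (Pr v : ℂ) = 1 / Real.pi / (Rd 1 v : ℂ) ^ 2 := by
    simp [Pr, Rd]
  rw [e5, Complex.real_smul, Complex.real_smul]
  push_cast
  field_simp

lemma conv_P_bd {η B : ℝ} (hη : 0 < η) {q : ℂ → ℂ} (hB : ∀ u, ‖q u‖ ≤ B) (x : ℂ) :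
    ‖∫ u, PK η (x - u) * q u‖ ≤ B := by
  rw [conv_P hη]
  refine (norm_integral_le_of_norm_le (Pr_integrable.mul_const B) (ae_of_all _ fun v => ?_)).trans ?_
  · rw [norm_mul, Complex.norm_real, Real.norm_of_nonneg (Pr_nonneg v)]
    exact mul_le_mul_of_nonneg_left (hB _) (Pr_nonneg v)
  · rw [integral_mul_const, Pr_integral, one_mul]

lemma conv_P_lim {B : ℝ} {q : ℂ → ℂ} (hc : Continuous q) (hB : ∀ u, ‖q u‖ ≤ B) (x : ℂ) :
    Tendsto (fun η => ∫ u, PK η (x - u) * q u) (𝓝[>] 0) (𝓝 (q x)) := by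
  have h0 : q x = ∫ v, (Pr v : ℂ) * q x := by
    rw [integral_mul_const, integral_complex_ofReal, Pr_integral]; simp
  have : Tendsto (fun η : ℝ => ∫ v, (Pr v : ℂ) * q (x - η * v)) (𝓝[>] 0) (𝓝 (∫ v, (Pr v : ℂ) * q x)) := by
    refine tendsto_integral_filter_of_dominated_convergence (fun v => Pr v * B) ?_ ?_
      (Pr_integrable.mul_const B) ?_
    · refine Eventually.of_forall fun η => ?_
      refine (Complex.measurable_ofReal.comp_aemeasurable Pr_integrable.1.aemeasurable).aestronglyMeasurable.mul ?_
      exact (hc.comp (by fun_prop)).aestronglyMeasurable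
    · refine Eventually.of_forall fun η => ae_of_all _ fun v => ?_
      rw [norm_mul, Complex.norm_real, Real.norm_of_nonneg (Pr_nonneg v)]
      exact mul_le_mul_of_nonneg_left (hB _) (Pr_nonneg v)
    · refine ae_of_all _ fun v => Tendsto.const_mul _ ?_
      have h2 : Continuous (fun η : ℝ => q (x - η * v)) := hc.comp (by fun_prop)
      have := (h2.tendsto 0).mono_left (nhdsWithin_le_nhds (s := Ioi 0))
      simpa using this
  rw [← h0] at this
  refine this.congr' ?_
  filter_upwards [self_mem_nhdsWithin] with η hη
  rw [conv_P hη]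

/-- the regularised transform -/
def gD (Ω : Set ℂ) (m : ℕ) (δ : ℝ) (f : ℂ → ℂ) (ζ : ℂ) : ℂ := ∫ w in Ω, pK m δ (ζ - w) * f w

structure BdF (Ω : Set ℂ) (f : ℂ → ℂ) (M : ℝ) : Prop where
  meas : MeasurableSet Ω
  vol : volume Ω ≠ ⊤
  um : AEStronglyMeasurable f (volume.restrict Ω)
  ub : ∀ w ∈ Ω, ‖f w‖ ≤ M

lemma HolB.bdF {α Ω f M} (ha : 0 < α) (h : HolB α Ω f M) (ho : IsOpen Ω)
    (hb : Bornology.IsBounded Ω) : BdF Ω f M :=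
  ⟨ho.measurableSet, hb.measure_lt_top.ne, (h.continuousOn ha).aestronglyMeasurable ho.measurableSet, h.1⟩

/-- bounded kernel times `f` is integrable -/
lemma BdF.integrable {Ω f M} (h : BdF Ω f M) {κ : ℂ → ℂ} (hκ : Measurable κ) {B : ℝ} (hB : ∀ u, ‖κ u‖ ≤ B) (z : ℂ) :
    IntegrableOn (fun w => κ (z - w) * f w) Ω := by
  refine Integrable.mono' (g := fun _ => B * M) (integrableOn_const h.vol) ?_
    ((ae_restrict_iff' h.meas).2 (ae_of_all _ fun w hw => ?_))
  · exact ((hκ.comp (by fun_prop : Measurable fun w : ℂ => z - w)).aestronglyMeasurable).mul h.um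
  · rw [norm_mul]
    exact mul_le_mul (hB _) (h.ub w hw) (norm_nonneg _) ((norm_nonneg _).trans (hB 0))

lemma pK_bdd (m : ℕ) {δ : ℝ} (hδ : 0 < δ) (u : ℂ) : ‖pK m δ u‖ ≤ BK (m + 1) / δ ^ 2 := by
  have := BK_nonneg (m + 1)
  exact (pK_bd m hδ u).trans (by gcongr; exact Rd_le' u)
lemma qK_bdd (m : ℕ) {δ : ℝ} (hδ : 0 < δ) (u : ℂ) : ‖qK m δ u‖ ≤ BK (m + 1) / δ ^ 2 := by
  have := BK_nonneg (m + 1)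
  exact (qK_bd m hδ u).trans (by gcongr; exact Rd_le' u)

lemma gD_lip {Ω f M} (h : BdF Ω f M) {m : ℕ} (hm : 1 ≤ m) {δ : ℝ} (hδ : 0 < δ) (hM : 0 ≤ M) (ζ ξ : ℂ) :
    ‖gD Ω m δ f ζ - gD Ω m δ f ξ‖ ≤ BK (m + 1) * (1 / δ ^ 3) * M * volume.real Ω * ‖ζ - ξ‖ := by
  unfold gD
  rw [← integral_sub (h.integrable (pK_meas m δ) (pK_bdd m hδ) _) (h.integrable (pK_meas m δ) (pK_bdd m hδ) _)]
  refine (norm_setIntegral_le_of_norm_le_const (C := BK (m + 1) * (1 / δ ^ 3) * ‖ζ - ξ‖ * M)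
    h.vol.lt_top (fun w hw => ?_)).trans (le_of_eq (by ring))
  rw [← sub_mul, norm_mul]
  have hB := BK_nonneg (m + 1)
  refine mul_le_mul ?_ (h.ub w hw) (norm_nonneg _) (by positivity)
  have := pK_lip hm hδ (ξ - w) (ζ - w)
  simpa using this

lemma gD_cont {Ω f M} (h : BdF Ω f M) {m : ℕ} (hm : 1 ≤ m) {δ : ℝ} (hδ : 0 < δ) (hM : 0 ≤ M) :
    Continuous (gD Ω m δ f) := by
  have hB := BK_nonneg (m + 1)
  refine (LipschitzWith.of_dist_le_mul (K := ⟨BK (m + 1) * (1 / δ ^ 3) * M * volume.real Ω, by positivity⟩)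
    fun x y => ?_).continuous
  rw [dist_eq_norm, dist_eq_norm]
  exact gD_lip h hm hδ hM x y

lemma gD_bdd {Ω f M} (h : BdF Ω f M) {m : ℕ} {δ : ℝ} (hδ : 0 < δ) (ζ : ℂ) :
    ‖gD Ω m δ f ζ‖ ≤ BK (m + 1) / δ ^ 2 * M * volume.real Ω := by
  have hB := BK_nonneg (m + 1)
  refine norm_setIntegral_le_of_norm_le_const h.vol.lt_top (fun w hw => ?_)
  rw [norm_mul]
  exact mul_le_mul (pK_bdd m hδ _) (h.ub w hw) (norm_nonneg _) (by positivity)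

/-- decay of `pK` uniformly in `w` -/
lemma pK_unif (m : ℕ) {δ R : ℝ} (hδ : 0 < δ) {z w ζ : ℂ} (hzw : ‖z - w‖ ≤ R) :
    ‖pK m δ (ζ - w)‖ ≤ BK (m + 1) * (2 + 2 * R ^ 2 / δ ^ 2) / Rd δ (z - ζ) := by
  have hB := BK_nonneg (m + 1)
  have h1 := Rd_pos hδ (ζ - w)
  have h2 := Rd_pos hδ (z - ζ)
  refine (pK_bd m hδ _).trans ?_
  rw [div_le_div_iff₀ h1 h2, mul_assoc]
  gcongr
  have h3 : ‖z - ζ‖ ≤ ‖ζ - w‖ + R := by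
    have : z - ζ = (z - w) - (ζ - w) := by ring
    rw [this]; exact (norm_sub_le _ _).trans (by linarith)
  have h4 : ‖z - ζ‖ ^ 2 ≤ 2 * ‖ζ - w‖ ^ 2 + 2 * R ^ 2 := by
    have := pow_le_pow_left₀ (norm_nonneg _) h3 2
    nlinarith [sq_nonneg (‖ζ - w‖ - R)]
  have h5 : 2 * R ^ 2 ≤ 2 * R ^ 2 / δ ^ 2 * Rd δ (ζ - w) := by
    calc 2 * R ^ 2 = 2 * R ^ 2 / δ ^ 2 * δ ^ 2 := by field_simp
      _ ≤ _ := by gcongr; exact Rd_le' _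
  have h6 : Rd δ (z - ζ) ≤ 2 * ‖ζ - w‖ ^ 2 + 2 * R ^ 2 + δ ^ 2 := by unfold Rd; linarith
  have h7 : 2 * ‖ζ - w‖ ^ 2 + δ ^ 2 ≤ 2 * Rd δ (ζ - w) := by unfold Rd; nlinarith [sq_nonneg δ]
  linarith

lemma RR_integrable {η δ : ℝ} (hη : 0 < η) (hδ : 0 < δ) (z : ℂ) :
    Integrable (fun ζ => 1 / Rd η (z - ζ) * (1 / Rd δ (z - ζ))) := by
  have h : Integrable (fun u => EK 0 0 1 η u * EK 0 0 1 δ u) :=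
    Dec.integrable (((EK_dec (j := 2) (by omega) hη).mul (EK_dec (j := 2) (by omega) hδ)).mono (by norm_num))
      ((EK_meas 0 0 1 η).mul (EK_meas 0 0 1 δ))
  have h2 := (h.comp_sub_left z).norm
  refine h2.congr (ae_of_all _ fun ζ => ?_)
  have h3 := Rd_pos hη (z - ζ)
  have h4 := Rd_pos hδ (z - ζ)
  simp [EK, abs_of_pos h3, abs_of_pos h4]

/-- decay of `gD` -/
lemma gD_dec {Ω f M} (h : BdF Ω f M) (hM : 0 ≤ M) {m : ℕ} {δ R : ℝ} (hδ : 0 < δ) {z : ℂ}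
    (hR : ∀ w ∈ Ω, ‖z - w‖ ≤ R) (ζ : ℂ) :
    ‖gD Ω m δ f ζ‖ ≤ BK (m + 1) * (2 + 2 * R ^ 2 / δ ^ 2) * M * volume.real Ω * (1 / Rd δ (z - ζ)) := by
  have hB := BK_nonneg (m + 1)
  have h2 := Rd_pos hδ (z - ζ)
  refine (norm_setIntegral_le_of_norm_le_const (C := BK (m + 1) * (2 + 2 * R ^ 2 / δ ^ 2) / Rd δ (z - ζ) * M)
    h.vol.lt_top (fun w hw => ?_)).trans (le_of_eq (by ring))
  rw [norm_mul]
  exact mul_le_mul (pK_unif m hδ (hR w hw)) (h.ub w hw) (norm_nonneg _) (by positivity)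

lemma gD_fub {Ω f M} (h : BdF Ω f M) (hM : 0 ≤ M) {m : ℕ} {δ η R : ℝ} (hδ : 0 < δ) (hη : 0 < η) {z : ℂ}
    (hR : ∀ w ∈ Ω, ‖z - w‖ ≤ R) :
    ∫ ζ, b1K η (z - ζ) * gD Ω m δ f ζ = ∫ w in Ω, (∫ u, PK η (z - w - u) * qK m δ u) * f w := by
  have hB := BK_nonneg (m + 1)
  have hB1 := BK_nonneg 1
  set K := BK (m + 1) * (2 + 2 * R ^ 2 / δ ^ 2)
  have hK : 0 ≤ K := by positivity
  haveI : IsFiniteMeasure (volume.restrict Ω) := ⟨by rw [Measure.restrict_apply_univ]; exact h.vol.lt_top⟩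
  have hintg : Integrable (Function.uncurry fun ζ w => b1K η (z - ζ) * (pK m δ (ζ - w) * f w))
      ((volume : Measure ℂ).prod (volume.restrict Ω)) := by
    have hg : Integrable (fun p : ℂ × ℂ => (BK 1 * K * M * (1 / Rd η (z - p.1) * (1 / Rd δ (z - p.1)))) * (1:ℝ))
        ((volume : Measure ℂ).prod (volume.restrict Ω)) :=
      Integrable.mul_prod ((RR_integrable hη hδ z).const_mul _) (integrable_const _)
    refine hg.mono' ?_ ?_
    · refine AEStronglyMeasurable.mul ?_ (AEStronglyMeasurable.mul ?_ ?_)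
      · exact ((b1K_meas η).comp (by fun_prop : Measurable fun p : ℂ × ℂ => z - p.1)).aestronglyMeasurable
      · exact ((pK_meas m δ).comp (by fun_prop : Measurable fun p : ℂ × ℂ => p.1 - p.2)).aestronglyMeasurable
      · exact h.um.comp_snd
    · have e : ((volume : Measure ℂ).prod (volume.restrict Ω)) = ((volume : Measure ℂ).prod volume).restrict (univ ×ˢ Ω) := by
        rw [← Measure.prod_restrict, Measure.restrict_univ]
      rw [e, ae_restrict_iff' (MeasurableSet.univ.prod h.meas)]
      refine ae_of_all _ fun p hp => ?_
      have hw : p.2 ∈ Ω := hp.2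
      have r1 := Rd_pos hη (z - p.1)
      have r2 := Rd_pos hδ (z - p.1)
      simp only [Function.uncurry, norm_mul, mul_one]
      calc _ ≤ (BK 1 / Rd η (z - p.1)) * (K / Rd δ (z - p.1) * M) := by
            refine mul_le_mul (b1K_bd hη _) ?_ (by positivity) (by positivity)
            exact mul_le_mul (pK_unif m hδ (hR _ hw)) (h.ub _ hw) (norm_nonneg _) (by positivity)
        _ = _ := by ring
  have e1 : ∀ ζ, b1K η (z - ζ) * gD Ω m δ f ζ = ∫ w in Ω, b1K η (z - ζ) * (pK m δ (ζ - w) * f w) := fun ζ => by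
    rw [gD, ← integral_const_mul]
  simp only [e1]
  rw [integral_integral_swap hintg]
  congr 1; ext w
  rw [← conv_id m hδ hη, ← integral_mul_const,
    ← integral_sub_right_eq_self (fun u => b1K η (z - w - u) * pK m δ u * f w) w]
  congr 1; ext ζ
  have : z - w - (ζ - w) = z - ζ := by ring
  rw [this]; ring

lemma gD_locH {Ω f M} (h : BdF Ω f M) (hM : 0 ≤ M) {m : ℕ} (hm : 1 ≤ m) {δ : ℝ} (hδ : 0 < δ) {z : ℂ} {r : ℝ}
    (hr : 0 < r) (hs : ball z r ⊆ Ω) : LocH Ω (gD Ω m δ f) z r (BK (m + 1) / δ ^ 2 * M * volume.real Ω)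
      (BK (m + 1) * (1 / δ ^ 3) * M * volume.real Ω) 1 where
  meas := h.meas
  vol := h.vol
  um := (gD_cont h hm hδ hM).aestronglyMeasurable
  ub := fun w _ => gD_bdd h hδ w
  rpos := hr
  apos := one_pos
  sub := hs
  hol := fun w _ => by
    rw [Real.rpow_one, norm_sub_rev z w]; exact gD_lip h hm hδ hM w z

lemma pf_integrable {z : ℂ} {r : ℝ} (hr : 0 < r) {S : Set ℂ} (hS : S ⊆ (ball z r)ᶜ) :
    IntegrableOn (fun ζ => 1 / ‖z - ζ‖ ^ 4) S := by
  have h := compl_pow_integrable (s := 2) (by norm_num) z hr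
  refine (h.mono_set hS).congr (ae_of_all _ fun ζ => ?_)
  simp only
  rw [show (-2 - 2 : ℝ) = -(4:ℕ) by norm_num, Real.rpow_neg (norm_nonneg _), Real.rpow_natCast, one_div]

lemma gD_ext_integrable {Ω f M} (h : BdF Ω f M) (hM : 0 ≤ M) {m : ℕ} (hm : 1 ≤ m) {δ R : ℝ} (hδ : 0 < δ) {z : ℂ}
    (hR : ∀ w ∈ Ω, ‖z - w‖ ≤ R) {r : ℝ} (hr : 0 < r) {S : Set ℂ} (hSm : MeasurableSet S) (hS : S ⊆ (ball z r)ᶜ) 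
    {κ : ℂ → ℂ} {C : ℝ} (hκ : KerB κ C) :
    IntegrableOn (fun ζ => C * (BK (m + 1) * (2 + 2 * R ^ 2 / δ ^ 2) * M * volume.real Ω) * (1 / ‖z - ζ‖ ^ 4)) S ∧
    AEStronglyMeasurable (fun ζ => κ (z - ζ) * gD Ω m δ f ζ) (volume.restrict S) ∧
    ∀ ζ ∈ S, ‖κ (z - ζ) * gD Ω m δ f ζ‖ ≤ C * (BK (m + 1) * (2 + 2 * R ^ 2 / δ ^ 2) * M * volume.real Ω) * (1 / ‖z - ζ‖ ^ 4) := by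
  have hB := BK_nonneg (m + 1)
  have hC := hκ.nn
  refine ⟨(pf_integrable hr hS).const_mul _, ?_, fun ζ hζ => ?_⟩
  · exact ((hκ.meas.comp (by fun_prop : Measurable fun ζ : ℂ => z - ζ)).aestronglyMeasurable).mul
      (gD_cont h hm hδ hM).aestronglyMeasurable
  · have hpos : 0 < ‖z - ζ‖ := by
      have : ¬ ζ ∈ ball z r := hS hζ
      rw [mem_ball, dist_eq_norm, norm_sub_rev] at this
      linarith
    rw [norm_mul]
    calc _ ≤ (C / ‖z - ζ‖ ^ 2) * (BK (m + 1) * (2 + 2 * R ^ 2 / δ ^ 2) * M * volume.real Ω * (1 / ‖z - ζ‖ ^ 2)) := by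
          refine mul_le_mul (hκ.bd _) ((gD_dec h hM hδ hR ζ).trans ?_) (norm_nonneg _) (by positivity)
          gcongr
          exact Rd_le _
      _ = _ := by field_simp

/-- Identity (E) -/
lemma gD_E {Ω f M} (h : BdF Ω f M) (hM : 0 ≤ M) {m : ℕ} (hm : 1 ≤ m) {δ R : ℝ} (hδ : 0 < δ) {z : ℂ}
    (hR : ∀ w ∈ Ω, ‖z - w‖ ≤ R) {r : ℝ} (hr : 0 < r) (hs : ball z r ⊆ Ω) :
    Lam (bnKer 1) Ω (gD Ω m δ f) z r + ∫ ζ in Ωᶜ, bnKer 1 (z - ζ) * gD Ω m δ f ζ =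
      ∫ w in Ω, qK m δ (z - w) * f w := by
  have hB := BK_nonneg (m + 1)
  have hg := gD_locH h hM hm hδ hr hs
  have hc : Ωᶜ ⊆ (ball z r)ᶜ := compl_subset_compl.2 hs
  -- limit 1
  have l1 : Tendsto (fun η => Lam (b1K η) Ω (gD Ω m δ f) z r) (𝓝[>] 0) (𝓝 (Lam (bnKer 1) Ω (gD Ω m δ f) z r)) := by
    refine hg.tendsto_Lam (C := BK (0 + 1)) ?_ (fun u hu => b1K_lim hu)
    filter_upwards [self_mem_nhdsWithin] with η hη
    rw [b1K_eq]; exact qK_ker 0 hη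
  have l2 : Tendsto (fun η => ∫ ζ in Ωᶜ, b1K η (z - ζ) * gD Ω m δ f ζ) (𝓝[>] 0)
      (𝓝 (∫ ζ in Ωᶜ, bnKer 1 (z - ζ) * gD Ω m δ f ζ)) := by
    have hk : ∀ η : ℝ, 0 < η → KerB (b1K η) (BK (0 + 1)) := fun η hη => by rw [b1K_eq]; exact qK_ker 0 hη
    refine tendsto_integral_filter_of_dominated_convergence _ ?_ ?_
      (gD_ext_integrable h hM hm hδ hR hr h.meas.compl hc (hk 1 one_pos)).1 ?_
    · filter_upwards [self_mem_nhdsWithin] with η hη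
      exact (gD_ext_integrable h hM hm hδ hR hr h.meas.compl hc (hk η hη)).2.1
    · filter_upwards [self_mem_nhdsWithin] with η hη
      exact (ae_restrict_iff' h.meas.compl).2 (ae_of_all _ (gD_ext_integrable h hM hm hδ hR hr h.meas.compl hc (hk η hη)).2.2)
    · refine (ae_restrict_iff' h.meas.compl).2 (ae_of_all _ fun ζ hζ => ?_)
      refine (b1K_lim ?_).mul_const _
      intro h0
      exact hc hζ (by rw [← sub_eq_zero.1 h0]; exact mem_ball_self hr)
  have l3 : Tendsto (fun η => ∫ w in Ω, (∫ u, PK η (z - w - u) * qK m δ u) * f w) (𝓝[>] 0)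
      (𝓝 (∫ w in Ω, qK m δ (z - w) * f w)) := by
    refine tendsto_integral_filter_of_dominated_convergence (fun _ => BK (m + 1) / δ ^ 2 * M) ?_ ?_
      (integrableOn_const h.vol) ?_
    · filter_upwards [self_mem_nhdsWithin] with η hη
      refine AEStronglyMeasurable.mul ?_ h.um
      have : StronglyMeasurable (fun w : ℂ => ∫ u, PK η (z - w - u) * qK m δ u) := by
        refine StronglyMeasurable.integral_prod_right (f := fun w u => PK η (z - w - u) * qK m δ u) ?_
        refine Measurable.stronglyMeasurable ?_
        exact ((PK_meas η).comp (by fun_prop : Measurable fun p : ℂ × ℂ => z - p.1 - p.2)).mul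
          ((qK_meas m δ).comp measurable_snd)
      exact this.aestronglyMeasurable
    · filter_upwards [self_mem_nhdsWithin] with η hη
      refine (ae_restrict_iff' h.meas).2 (ae_of_all _ fun w hw => ?_)
      rw [norm_mul]
      exact mul_le_mul (conv_P_bd hη (qK_bdd m hδ) _) (h.ub w hw) (norm_nonneg _) (by positivity)
    · exact ae_of_all _ fun w => (conv_P_lim (qK_cont m hδ) (qK_bdd m hδ) (z - w)).mul_const _
  refine tendsto_nhds_unique (l1.add l2) (l3.congr' ?_)
  filter_upwards [self_mem_nhdsWithin] with η hη
  have hk : KerB (b1K η) (BK (0 + 1)) := by rw [b1K_eq]; exact qK_ker 0 hη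
  have hi : Integrable (fun ζ => b1K η (z - ζ) * gD Ω m δ f ζ) := by
    refine Integrable.mono' ((RR_integrable hη hδ z).const_mul
      (BK 1 * (BK (m + 1) * (2 + 2 * R ^ 2 / δ ^ 2) * M * volume.real Ω))) ?_ (ae_of_all _ fun ζ => ?_)
    · exact (((b1K_meas η).comp (by fun_prop : Measurable fun ζ : ℂ => z - ζ)).aestronglyMeasurable).mul
        (gD_cont h hm hδ hM).aestronglyMeasurable
    · rw [norm_mul]
      have := BK_nonneg 1
      have r1 := Rd_pos hη (z - ζ)
      refine (mul_le_mul (b1K_bd hη _) (gD_dec h hM hδ hR ζ) (norm_nonneg _) (by positivity)).trans (le_of_eq (by ring))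
  rw [← gD_fub h hM hδ hη hR, ← integral_add_compl h.meas hi, hg.bounded_eq hk (B := BK (0 + 1) / η ^ 2)]
  rw [b1K_eq]; exact qK_bdd 0 hη

lemma LocH.split {C : ℝ} {κ : ℂ → ℂ} (hκ : KerB κ C) {Ω u z ρ M A a} (h : LocH Ω u z ρ M A a) :
    IntegrableOn (fun w => κ (z - w) * (u w - u z)) (ball z ρ) ∧
    IntegrableOn (fun w => κ (z - w) * u w) (Ω \ ball z ρ) ∧
    Lam κ Ω u z ρ = (∫ w in ball z ρ, κ (z - w) * (u w - u z)) + ∫ w in Ω \ ball z ρ, κ (z - w) * u w := by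
  have hi := h.integrable hκ
  have e1 : EqOn (fun w => κ (z - w) * (u w - (ball z ρ).indicator (fun _ => u z) w))
      (fun w => κ (z - w) * (u w - u z)) (ball z ρ) := fun w hw => by simp only [indicator_of_mem hw]
  have e2 : EqOn (fun w => κ (z - w) * (u w - (ball z ρ).indicator (fun _ => u z) w))
      (fun w => κ (z - w) * u w) (Ω \ ball z ρ) := fun w hw => by simp only [indicator_of_notMem hw.2, sub_zero]
  have m2 : MeasurableSet (Ω \ ball z ρ) := h.meas.diff measurableSet_ball
  refine ⟨(hi.mono_set h.sub).congr_fun e1 measurableSet_ball, (hi.mono_set sdiff_subset).congr_fun e2 m2, ?_⟩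
  rw [Lam, ← integral_inter_add_sdiff measurableSet_ball hi, inter_eq_self_of_subset_right h.sub,
    setIntegral_congr_fun measurableSet_ball e1, setIntegral_congr_fun m2 e2]

lemma near_bd {C : ℝ} {κ : ℂ → ℂ} (hκ : KerB κ C) {Ω u z ρ M A a} (h : LocH Ω u z ρ M A a) :
    ‖∫ w in ball z ρ, κ (z - w) * (u w - u z)‖ ≤ C * A * (2 * Real.pi / a * ρ ^ a) := by
  have hA := h.Ann
  have hC := hκ.nn
  rw [← ball_pow_integral h.apos z h.rpos.le, ← integral_const_mul]
  refine norm_integral_le_of_norm_le ((ball_pow_integrable h.apos z ρ).const_mul _)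
    ((ae_restrict_iff' measurableSet_ball).2 (ae_of_all _ fun w hw => ?_))
  rw [norm_mul]
  by_cases hw0 : ‖z - w‖ = 0
  · have : z = w := sub_eq_zero.1 (norm_eq_zero.1 hw0)
    subst this
    simp only [sub_self, norm_zero, mul_zero]; positivity
  have hp : 0 < ‖z - w‖ := lt_of_le_of_ne (norm_nonneg _) (Ne.symm hw0)
  refine (mul_le_mul (hκ.bd _) (h.hol w hw) (norm_nonneg _) (by positivity)).trans (le_of_eq ?_)
  rw [Real.rpow_sub hp, Real.rpow_two]
  field_simp

/-- smallness of the transform with a difference kernel -/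
lemma Lam_dk {C : ℝ} {κ : ℂ → ℂ} (hκ : KerB κ C) {Ω f z t M α} (h : LocH Ω f z t M M α) (ht1 : t ≤ 1)
    (hb : ∀ u, ‖κ u‖ ≤ C * ((t ^ 2) ^ (α / 2) * ‖u‖ ^ (-2 - α / 2))) :
    ‖Lam κ Ω f z t‖ ≤ C * M * (8 * Real.pi / α) * t ^ (α / 2) := by
  have hM := h.Mnn
  have hC := hκ.nn
  have ht := h.rpos
  have hα := h.apos
  have hα2 : 0 < α / 2 := by positivity
  have hp := Real.pi_pos
  obtain ⟨-, -, e⟩ := h.split hκ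
  have et : (t ^ 2) ^ (α / 2) = t ^ α := by
    rw [← Real.rpow_natCast, ← Real.rpow_mul ht.le]; congr 1; push_cast; ring
  rw [et] at hb
  have n1 : ‖∫ w in ball z t, κ (z - w) * (f w - f z)‖ ≤ C * M * t ^ α * (2 * Real.pi / (α / 2) * t ^ (α / 2)) := by
    rw [← ball_pow_integral hα2 z ht.le, ← integral_const_mul]
    refine norm_integral_le_of_norm_le ((ball_pow_integrable hα2 z t).const_mul _)
      ((ae_restrict_iff' measurableSet_ball).2 (ae_of_all _ fun w hw => ?_))
    rw [norm_mul]
    by_cases hw0 : ‖z - w‖ = 0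
    · have : z = w := sub_eq_zero.1 (norm_eq_zero.1 hw0)
      subst this
      simp only [sub_self, norm_zero, mul_zero]; positivity
    have hp : 0 < ‖z - w‖ := lt_of_le_of_ne (norm_nonneg _) (Ne.symm hw0)
    refine (mul_le_mul (hb _) (h.hol w hw) (norm_nonneg _) (by positivity)).trans (le_of_eq ?_)
    have : ‖z - w‖ ^ (α / 2 - 2) = ‖z - w‖ ^ (-2 - α / 2) * ‖z - w‖ ^ α := by
      rw [← Real.rpow_add hp]; congr 1; ring
    rw [this]; ring
  have n2 : ‖∫ w in Ω \ ball z t, κ (z - w) * f w‖ ≤ C * M * t ^ α * (2 * Real.pi / (α / 2) * t ^ (-(α / 2))) := by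
    rw [← compl_pow_integral hα2 z ht, ← integral_const_mul]
    have hi : IntegrableOn (fun w => C * M * t ^ α * ‖z - w‖ ^ (-2 - α / 2)) (ball z t)ᶜ :=
      (compl_pow_integrable hα2 z ht).const_mul (C * M * t ^ α)
    have hsub : Ω \ ball z t ⊆ (ball z t)ᶜ := fun w hw => hw.2
    refine (norm_integral_le_of_norm_le (hi.mono_set hsub)
      ((ae_restrict_iff' (h.meas.diff measurableSet_ball)).2 (ae_of_all _ fun w hw => ?_))).trans
      (setIntegral_mono_set hi (ae_of_all _ fun w => by simp only [Pi.zero_apply]; positivity) hsub.eventuallyLE)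
    rw [norm_mul]
    refine (mul_le_mul (hb _) (h.ub w hw.1) (norm_nonneg _) (by positivity)).trans (le_of_eq (by ring))
  rw [e]
  refine (norm_add_le _ _).trans ((add_le_add n1 n2).trans ?_)
  have q1 : t ^ α * t ^ (-(α / 2)) = t ^ (α / 2) := by rw [← Real.rpow_add ht]; congr 1; ring
  have q2 : t ^ α ≤ 1 := Real.rpow_le_one ht.le ht1 hα.le
  calc _ = C * M * (4 * Real.pi / α) * (t ^ α * t ^ (α / 2) + t ^ α * t ^ (-(α / 2))) := by
        field_simp; ring
    _ ≤ C * M * (4 * Real.pi / α) * (1 * t ^ (α / 2) + t ^ (α / 2)) := by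
        rw [q1]; gcongr
    _ = _ := by ring

/-- sup bound for `gD` -/
lemma gD_sup {Ω f M} (h : BdF Ω f M) (hM : 0 ≤ M) {m : ℕ} {δ s : ℝ} (hδ : 0 < δ) (hs : 0 < s) (hs2 : s ≤ 2) (ζ : ℂ) :
    ‖gD Ω m δ f ζ‖ ≤ BK (m + 1) * (2 * Real.pi / s + volume.real Ω) * M * δ ^ (-s) := by
  have hB := BK_nonneg (m + 1)
  have hi := (riesz_integrable hs hs2 h.meas h.vol ζ).const_mul (BK (m + 1) * δ ^ (-s) * M)
  refine (norm_integral_le_of_norm_le hi ((ae_restrict_iff' h.meas).2 ?_)).trans ?_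
  · have : ∀ᵐ w : ℂ, w ≠ ζ := by simp [ae_iff]
    filter_upwards [this] with w hw hwΩ
    have hu : ζ - w ≠ 0 := sub_ne_zero.2 hw.symm
    rw [norm_mul]
    have : ‖pK m δ (ζ - w)‖ ≤ BK (m + 1) * (δ ^ (-s) * ‖ζ - w‖ ^ (s - 2)) :=
      (pK_bd m hδ _).trans (by
        rw [div_eq_mul_one_div]; exact mul_le_mul_of_nonneg_left (invR_le_s hδ hs.le hs2 hu) hB)
    refine (mul_le_mul this (h.ub w hwΩ) (norm_nonneg _) (by positivity)).trans (le_of_eq (by ring))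
  · rw [integral_const_mul]
    calc _ ≤ BK (m + 1) * δ ^ (-s) * M * (2 * Real.pi / s + volume.real Ω) := by
          gcongr; exact riesz_bound hs hs2 h.meas h.vol ζ
      _ = _ := by ring

def SOp (Ω : Set ℂ) (m : ℕ) (f : ℂ → ℂ) (z : ℂ) : ℂ := TnOp Ω 1 (TnOp Ω m f) z - TnOp Ω (m + 1) f z

def SD (Ω : Set ℂ) (m : ℕ) (δ : ℝ) (f : ℂ → ℂ) (z : ℂ) : ℂ :=
  - ∫ ζ in Ωᶜ, bnKer 1 (z - ζ) * gD Ω m δ f ζ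

lemma Lam_sub_ker {C C' : ℝ} {κ κ' : ℂ → ℂ} (hκ : KerB κ C) (hκ' : KerB κ' C') {Ω u z ρ M A a} (h : LocH Ω u z ρ M A a) :
    Lam (fun v => κ v - κ' v) Ω u z ρ = Lam κ Ω u z ρ - Lam κ' Ω u z ρ := by
  unfold Lam
  rw [← integral_sub (h.integrable hκ) (h.integrable hκ')]
  congr 1; ext w; ring

/-- The difference `T_m f - gD`. -/
lemma D_bd {α Ω f M} (hα : 0 < α) (hα1 : α ≤ 1) (h : HolB α Ω f M) (ho : IsOpen Ω) (hb : Bornology.IsBounded Ω)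
    {m : ℕ} (hm : 1 ≤ m) {t : ℝ} (ht : 0 < t) (ht1 : t ≤ 1) {ζ : ℂ} (hs : ball ζ t ⊆ Ω) :
    ‖TnOp Ω m f ζ - gD Ω m (t ^ 2) f ζ‖ ≤ BK (m + 1) * M * (8 * Real.pi / α) * t ^ (α / 2) := by
  have hδ : 0 < t ^ 2 := by positivity
  have hl := h.locH hα ho hb ht hs
  have e : TnOp Ω m f ζ - gD Ω m (t ^ 2) f ζ = Lam (fun v => bnKer m v - pK m (t ^ 2) v) Ω f ζ t := by
    rw [Lam_sub_ker (bn_ker hm) (pK_ker hm hδ) hl, hl.Tn_eq hm, gD, hl.bounded_eq (pK_ker hm hδ) (pK_bdd m hδ)]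
  rw [e]
  refine Lam_dk (pKd_ker hm hδ) hl ht1 fun u => (pK_diff hm hδ u).trans ?_
  exact mul_le_mul_of_nonneg_left (ddiv_le_s hδ (by positivity) (by linarith) u) (BK_nonneg _)

lemma Dq_bd {α Ω f M} (hα : 0 < α) (hα1 : α ≤ 1) (h : HolB α Ω f M) (ho : IsOpen Ω) (hb : Bornology.IsBounded Ω)
    {m : ℕ} {t : ℝ} (ht : 0 < t) (ht1 : t ≤ 1) {ζ : ℂ} (hs : ball ζ t ⊆ Ω) :
    ‖TnOp Ω (m + 1) f ζ - ∫ w in Ω, qK m (t ^ 2) (ζ - w) * f w‖ ≤ BK (m + 1) * M * (8 * Real.pi / α) * t ^ (α / 2) := by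
  have hδ : 0 < t ^ 2 := by positivity
  have hl := h.locH hα ho hb ht hs
  have e : TnOp Ω (m + 1) f ζ - ∫ w in Ω, qK m (t ^ 2) (ζ - w) * f w = Lam (fun v => bnKer (m + 1) v - qK m (t ^ 2) v) Ω f ζ t := by
    rw [Lam_sub_ker (bn_ker (by omega)) (qK_ker m hδ) hl, hl.Tn_eq (by omega), hl.bounded_eq (qK_ker m hδ) (qK_bdd m hδ)]
  rw [e]
  refine Lam_dk (qKd_ker m hδ) hl ht1 fun u => (qK_diff m hδ u).trans ?_
  exact mul_le_mul_of_nonneg_left (ddiv_le_s hδ (by positivity) (by linarith) u) (BK_nonneg _)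

/-- representation of `S - SD` -/
lemma S_repr {α Ω f M N} (hα : 0 < α) (h : HolB α Ω f M) (ho : IsOpen Ω) (hb : Bornology.IsBounded Ω)
    {m : ℕ} (hm : 1 ≤ m) (hg : HolB α Ω (TnOp Ω m f) N) {δ : ℝ} (hδ : 0 < δ) {z : ℂ}
    {r : ℝ} (hr : 0 < r) (hs : ball z r ⊆ Ω) :
    SOp Ω m f z - SD Ω m δ f z =
      ((∫ w in ball z r, bnKer 1 (z - w) * (TnOp Ω m f w - TnOp Ω m f z)) -
        ∫ w in ball z r, bnKer 1 (z - w) * (gD Ω m δ f w - gD Ω m δ f z))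
      + (∫ w in Ω \ ball z r, bnKer 1 (z - w) * (TnOp Ω m f w - gD Ω m δ f w))
      - (TnOp Ω (m + 1) f z - ∫ w in Ω, qK m δ (z - w) * f w) := by
  have hz : z ∈ Ω := hs (mem_ball_self hr)
  have hM := h.nonneg hz
  obtain ⟨R, hR1, hR, -⟩ := exists_R hb
  have hR' : ∀ w ∈ Ω, ‖z - w‖ ≤ R := fun w hw => by
    have := hR z hz hw
    rw [mem_ball, dist_eq_norm, norm_sub_rev] at this; exact this.le
  have hE := gD_E (h.bdF hα ho hb) hM hm hδ hR' hr hs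
  have k1 := bn_ker (k := 1) le_rfl
  have l1 := hg.locH hα ho hb hr hs
  have l2 := gD_locH (h.bdF hα ho hb) hM hm hδ hr hs
  obtain ⟨-, i1, e1⟩ := l1.split k1
  obtain ⟨-, i2, e2⟩ := l2.split k1
  have e3 : (∫ w in Ω \ ball z r, bnKer 1 (z - w) * (TnOp Ω m f w - gD Ω m δ f w)) =
      (∫ w in Ω \ ball z r, bnKer 1 (z - w) * TnOp Ω m f w) - ∫ w in Ω \ ball z r, bnKer 1 (z - w) * gD Ω m δ f w := by
    rw [← integral_sub i1 i2]; congr 1; ext w; ring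
  rw [e3, SOp, SD, l1.Tn_eq le_rfl, e1, ← hE, e2]
  ring

lemma far_bd {ε Ω ρ L} (D : Dom ε Ω ρ L) {α : ℝ} (hα : 0 < α) (hα1 : α ≤ 1) {m : ℕ} (hm : 1 ≤ m) :
    ∃ C : ℝ, 0 ≤ C ∧ ∀ (f : ℂ → ℂ) (M N t : ℝ) (z : ℂ), HolB α Ω f M → HolB α Ω (TnOp Ω m f) N → z ∈ Ω →
      0 < t → t ≤ 1 → t ≤ dst Ω z / 2 →
      ‖∫ w in Ω \ ball z (t ^ 8), bnKer 1 (z - w) * (TnOp Ω m f w - gD Ω m (t ^ 2) f w)‖ ≤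
        C * (M + N) * t ^ (α / 4) * (1 + 1 / dst Ω z ^ 2) := by
  obtain ⟨Cc, hCc, hcol⟩ := D.collar
  have hπ := Real.pi_pos
  have hB := BK_nonneg (m + 1)
  have hB1 := BK_nonneg 1
  have hvol : volume Ω ≠ ⊤ := D.bdd.measure_lt_top.ne
  have hmΩ := D.op.measurableSet
  set V := volume.real Ω with hV
  have hV0 : 0 ≤ V := measureReal_nonneg
  set s := α / 32 with hs
  have hs0 : 0 < s := by positivity
  set C1 := BK 1 * (BK (m + 1) * (8 * Real.pi / α)) * (2 * Real.pi / s + V) with hC1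
  set C2 := BK 1 * 4 * (1 + BK (m + 1) * (2 * Real.pi / (1 / 4) + V)) * Cc with hC2
  have hC10 : 0 ≤ C1 := by positivity
  have hC20 : 0 ≤ C2 := by positivity
  refine ⟨C1 + C2, by positivity, fun f M N t z hf hg hz ht ht1 htd => ?_⟩
  have hM := hf.nonneg hz
  have hN := hg.nonneg hz
  have hd : 0 < dst Ω z := dst_pos D.op D.bdd hz
  set d := dst Ω z with hdd
  have hr : 0 < t ^ 8 := by positivity
  set K1 := BK 1 * (BK (m + 1) * M * (8 * Real.pi / α) * t ^ (α / 2)) * t ^ (-(α / 4)) with hK1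
  set K2 := BK 1 * 4 / d ^ 2 * (N + BK (m + 1) * (2 * Real.pi / (1 / 4) + V) * M * (t ^ 2) ^ (-(1 / 4 : ℝ))) with hK2
  have hK10 : 0 ≤ K1 := by positivity
  have hK20 : 0 ≤ K2 := by positivity
  set col := {ζ ∈ Ω | dst Ω ζ < t} with hcold
  have hcm : MeasurableSet col := by
    have : col = Ω ∩ {ζ | dst Ω ζ < t} := rfl
    rw [this]
    exact hmΩ.inter (measurableSet_lt (continuous_infDist_pt _).measurable measurable_const)
  have i1 : IntegrableOn (fun w => K1 * ‖z - w‖ ^ (s - 2)) Ω :=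
    (riesz_integrable hs0 (by rw [hs]; linarith) hmΩ hvol z).const_mul _
  have i2 : IntegrableOn (col.indicator fun _ => K2) Ω := (integrableOn_const hvol).indicator hcm
  have i12 : IntegrableOn (fun w => K1 * ‖z - w‖ ^ (s - 2) + col.indicator (fun _ => K2) w) Ω := i1.add i2
  have pt : ∀ w ∈ Ω \ ball z (t ^ 8), ‖bnKer 1 (z - w) * (TnOp Ω m f w - gD Ω m (t ^ 2) f w)‖ ≤
      K1 * ‖z - w‖ ^ (s - 2) + col.indicator (fun _ => K2) w := by
    intro w hw
    have hwr : t ^ 8 ≤ ‖z - w‖ := by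
      have := hw.2
      rwa [mem_ball, dist_eq_norm, norm_sub_rev, not_lt] at this
    have hwp : 0 < ‖z - w‖ := hr.trans_le hwr
    rw [norm_mul]
    by_cases hc : dst Ω w < t
    · have hwc : w ∈ col := ⟨hw.1, hc⟩
      rw [indicator_of_mem hwc]
      have hfar : d / 2 ≤ ‖z - w‖ := by
        have := dst_lip Ω z w
        linarith
      have b1 : ‖bnKer 1 (z - w)‖ ≤ BK 1 * 4 / d ^ 2 := by
        refine (bn_bd le_rfl _).trans ?_
        calc BK 1 / ‖z - w‖ ^ 2 ≤ BK 1 / (d / 2) ^ 2 := by gcongr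
          _ = _ := by field_simp; try norm_num
      have b2 : ‖TnOp Ω m f w - gD Ω m (t ^ 2) f w‖ ≤ N + BK (m + 1) * (2 * Real.pi / (1 / 4) + V) * M * (t ^ 2) ^ (-(1 / 4 : ℝ)) :=
        (norm_sub_le _ _).trans (add_le_add (hg.1 w hw.1)
          (gD_sup (hf.bdF hα D.op D.bdd) hM (by positivity) (by norm_num) (by norm_num) w))
      have := mul_le_mul b1 b2 (norm_nonneg _) (by positivity)
      have h0 : 0 ≤ K1 * ‖z - w‖ ^ (s - 2) := by positivity
      linarith
    · have hwc : w ∉ col := fun h => hc h.2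
      rw [indicator_of_notMem hwc, add_zero]
      have hsub : ball w t ⊆ Ω := (ball_subset_ball (not_lt.1 hc)).trans (dst_ball Ω w)
      have b2 := D_bd hα hα1 hf D.op D.bdd hm ht ht1 hsub
      have b1 : ‖bnKer 1 (z - w)‖ ≤ BK 1 * (t ^ (-(α / 4)) * ‖z - w‖ ^ (s - 2)) := by
        refine (bn_bd le_rfl _).trans ?_
        rw [div_eq_mul_one_div]
        refine mul_le_mul_of_nonneg_left ?_ hB1
        have q1 : (t ^ 8) ^ (-s) = t ^ (-(α / 4)) := by
          rw [← Real.rpow_natCast, ← Real.rpow_mul ht.le]; congr 1; rw [hs]; push_cast; ring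
        have q2 : ‖z - w‖ ^ (-s) ≤ (t ^ 8) ^ (-s) := Real.rpow_le_rpow_of_nonpos hr hwr (by linarith)
        rw [← q1]
        calc 1 / ‖z - w‖ ^ 2 = ‖z - w‖ ^ (-s) * ‖z - w‖ ^ (s - 2) := by
              rw [← Real.rpow_add hwp, show -s + (s - 2) = -(2:ℕ) by push_cast; ring, Real.rpow_neg hwp.le,
                Real.rpow_natCast, one_div]
          _ ≤ _ := by gcongr
      refine (mul_le_mul b1 b2 (norm_nonneg _) (by positivity)).trans (le_of_eq ?_)
      rw [hK1]; ring
  have hmd : MeasurableSet (Ω \ ball z (t ^ 8)) := hmΩ.diff measurableSet_ball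
  refine (norm_integral_le_of_norm_le (i12.mono_set sdiff_subset)
    ((ae_restrict_iff' hmd).2 (ae_of_all _ pt))).trans ?_
  refine (setIntegral_mono_set i12 (ae_of_all _ fun w => ?_) (sdiff_subset).eventuallyLE).trans ?_
  · simp only [Pi.zero_apply]
    exact add_nonneg (by positivity) (indicator_nonneg (fun _ _ => hK20) _)
  have e2 : ∫ w in Ω, col.indicator (fun _ => K2) w ≤ Cc * t * K2 := by
    rw [setIntegral_indicator hcm, inter_eq_self_of_subset_right (fun w hw => hw.1), setIntegral_const, smul_eq_mul]
    exact mul_le_mul_of_nonneg_right (hcol t ht) hK20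
  have e1 : ∫ w in Ω, K1 * ‖z - w‖ ^ (s - 2) ≤ K1 * (2 * Real.pi / s + V) := by
    rw [integral_const_mul]
    exact mul_le_mul_of_nonneg_left (riesz_bound hs0 (by rw [hs]; linarith) hmΩ hvol z) hK10
  rw [integral_add i1 i2]
  refine (add_le_add e1 e2).trans ?_
  have q1 : t ^ (α / 2) * t ^ (-(α / 4)) = t ^ (α / 4) := by rw [← Real.rpow_add ht]; congr 1; ring
  have q2 : t * (t ^ 2) ^ (-(1 / 4 : ℝ)) = t ^ (1 / 2 : ℝ) := by
    rw [← Real.rpow_natCast, ← Real.rpow_mul ht.le]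
    nth_rw 1 [← Real.rpow_one t]
    rw [← Real.rpow_add ht]; congr 1; norm_num
  have q3 : t ^ (1 / 2 : ℝ) ≤ t ^ (α / 4) := Real.rpow_le_rpow_of_exponent_ge ht ht1 (by linarith)
  have q4 : t ≤ t ^ (α / 4) := by
    conv_lhs => rw [← Real.rpow_one t]
    exact Real.rpow_le_rpow_of_exponent_ge ht ht1 (by linarith)
  have p1 : K1 * (2 * Real.pi / s + V) = C1 * M * t ^ (α / 4) := by
    rw [← q1, hK1, hC1]; ring
  set X := BK (m + 1) * (2 * Real.pi / (1 / 4) + V) with hX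
  have hX0 : 0 ≤ X := by positivity
  have p2 : Cc * t * K2 ≤ C2 * (M + N) * t ^ (α / 4) * (1 / d ^ 2) := by
    calc Cc * t * K2 = Cc * (BK 1 * 4 / d ^ 2) * (N * t + X * M * (t * (t ^ 2) ^ (-(1 / 4 : ℝ)))) := by
          rw [hK2]; ring
      _ ≤ Cc * (BK 1 * 4 / d ^ 2) * (N * t ^ (α / 4) + X * M * t ^ (α / 4)) := by
          rw [q2]; gcongr
      _ ≤ Cc * (BK 1 * 4 / d ^ 2) * ((1 + X) * (M + N) * t ^ (α / 4)) := by
          refine mul_le_mul_of_nonneg_left ?_ (by positivity)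
          rw [← add_mul]
          refine mul_le_mul_of_nonneg_right ?_ (by positivity)
          nlinarith [mul_nonneg hX0 hN]
      _ = _ := by rw [hC2]; ring
  rw [p1]
  calc _ ≤ C1 * M * t ^ (α / 4) + C2 * (M + N) * t ^ (α / 4) * (1 / d ^ 2) := by linarith
    _ ≤ C1 * (M + N) * t ^ (α / 4) + C2 * (M + N) * t ^ (α / 4) * (1 / d ^ 2)
        + (C2 * (M + N) * t ^ (α / 4) + C1 * (M + N) * t ^ (α / 4) * (1 / d ^ 2)) := by
        have : C1 * M * t ^ (α / 4) ≤ C1 * (M + N) * t ^ (α / 4) := by gcongr; linarith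
        have : 0 ≤ (C2 * (M + N) * t ^ (α / 4) + C1 * (M + N) * t ^ (α / 4) * (1 / d ^ 2)) := by positivity
        linarith
    _ = _ := by ring

/-- Step (a): regularisation error. -/
lemma step_a {ε Ω ρ L} (D : Dom ε Ω ρ L) {α : ℝ} (hα : 0 < α) (hα1 : α ≤ ε) {m : ℕ} (hm : 1 ≤ m) :
    ∃ C : ℝ, 0 ≤ C ∧ ∀ (f : ℂ → ℂ) (M t : ℝ) (z : ℂ), HolB α Ω f M → z ∈ Ω →
      0 < t → t ≤ 1 → t ≤ dst Ω z / 2 →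
      ‖SOp Ω m f z - SD Ω m (t ^ 2) f z‖ ≤ C * M * t ^ (α / 4) * (1 + 1 / dst Ω z ^ 2) := by
  have hε1 := D.e1
  have hα1' : α ≤ 1 := by linarith
  obtain ⟨CA, hCA, hTA⟩ := TA D hm hα hα1
  obtain ⟨CF, hCF, hF⟩ := far_bd D hα hα1' hm
  have hπ := Real.pi_pos
  have hB := BK_nonneg (m + 1)
  have hB1 := BK_nonneg 1
  set V := volume.real Ω with hV
  have hV0 : 0 ≤ V := measureReal_nonneg
  set n1 := BK 1 * CA * (2 * Real.pi / α) with hn1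
  set n2 := BK 1 * (BK (m + 1) * V) * (2 * Real.pi) with hn2
  set n3 := CF * (1 + CA) with hn3
  set n4 := BK (m + 1) * (8 * Real.pi / α) with hn4
  have : 0 ≤ n1 := by positivity
  have : 0 ≤ n2 := by positivity
  have : 0 ≤ n3 := by positivity
  have : 0 ≤ n4 := by positivity
  refine ⟨n1 + n2 + n3 + n4, by positivity, fun f M t z hf hz ht ht1 htd => ?_⟩
  have hM := hf.nonneg hz
  have hg := hTA M f hM hf
  have hd : 0 < dst Ω z := dst_pos D.op D.bdd hz
  have hr : 0 < t ^ 8 := by positivity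
  have hδ : 0 < t ^ 2 := by positivity
  have hr' : t ^ 8 ≤ t := pow_le_of_le_one ht.le ht1 (by norm_num)
  have hsb : ball z t ⊆ Ω := (ball_subset_ball (by linarith : t ≤ dst Ω z)).trans (dst_ball Ω z)
  have hs8 : ball z (t ^ 8) ⊆ Ω := (ball_subset_ball hr').trans hsb
  rw [S_repr hα hf D.op D.bdd hm hg hδ hr hs8]
  have k1 := bn_ker (k := 1) le_rfl
  have b1 := near_bd k1 (hg.locH hα D.op D.bdd hr hs8)
  have b2 := near_bd k1 (gD_locH (hf.bdF hα D.op D.bdd) hM hm hδ hr hs8)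
  have b3 := hF f M (CA * M) t z hf hg hz ht ht1 htd
  have b4 := Dq_bd hα hα1' hf D.op D.bdd (m := m) ht ht1 hsb
  set T := t ^ (α / 4) with hT
  have hT0 : 0 ≤ T := by positivity
  have p1 : (t ^ 8) ^ α ≤ T := by
    rw [← Real.rpow_natCast, ← Real.rpow_mul ht.le]
    exact Real.rpow_le_rpow_of_exponent_ge ht ht1 (by push_cast; linarith)
  have p4 : t ^ (α / 2) ≤ T := Real.rpow_le_rpow_of_exponent_ge ht ht1 (by linarith)
  have p2 : t ^ 2 ≤ T := by
    rw [← Real.rpow_natCast]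
    exact Real.rpow_le_rpow_of_exponent_ge ht ht1 (by push_cast; linarith)
  have c1 : BK 1 * (CA * M) * (2 * Real.pi / α * (t ^ 8) ^ α) ≤ n1 * M * T := by
    calc _ = n1 * M * (t ^ 8) ^ α := by rw [hn1]; ring
      _ ≤ _ := by gcongr
  have c2 : BK 1 * (BK (m + 1) * (1 / (t ^ 2) ^ 3) * M * V) * (2 * Real.pi / 1 * (t ^ 8) ^ (1:ℝ)) ≤ n2 * M * T := by
    calc _ = n2 * M * t ^ 2 := by rw [hn2, Real.rpow_one]; field_simp
      _ ≤ _ := by gcongr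
  have c4 : BK (m + 1) * M * (8 * Real.pi / α) * t ^ (α / 2) ≤ n4 * M * T := by
    calc _ = n4 * M * t ^ (α / 2) := by rw [hn4]; ring
      _ ≤ _ := by gcongr
  have c3 : CF * (M + CA * M) * T * (1 + 1 / dst Ω z ^ 2) = n3 * M * T * (1 + 1 / dst Ω z ^ 2) := by rw [hn3]; ring
  rw [c3] at b3
  have e1 : (1:ℝ) ≤ 1 + 1 / dst Ω z ^ 2 := by
    have : 0 ≤ 1 / dst Ω z ^ 2 := by positivity
    linarith
  calc _ ≤ n1 * M * T + n2 * M * T + n3 * M * T * (1 + 1 / dst Ω z ^ 2) + n4 * M * T := by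
        refine (norm_sub_le _ _).trans (add_le_add ((norm_add_le _ _).trans (add_le_add ((norm_sub_le _ _).trans ?_) b3)) (b4.trans c4))
        exact add_le_add (b1.trans c1) (b2.trans c2)
    _ ≤ n1 * M * T * (1 + 1 / dst Ω z ^ 2) + n2 * M * T * (1 + 1 / dst Ω z ^ 2)
        + n3 * M * T * (1 + 1 / dst Ω z ^ 2) + n4 * M * T * (1 + 1 / dst Ω z ^ 2) := by
        have : ∀ x : ℝ, 0 ≤ x → x ≤ x * (1 + 1 / dst Ω z ^ 2) := fun x hx => le_mul_of_one_le_right hx e1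
        have a1 := this (n1 * M * T) (by positivity)
        have a2 := this (n2 * M * T) (by positivity)
        have a4 := this (n4 * M * T) (by positivity)
        linarith
    _ = _ := by ring

/-- the difference kernel -/
def AK (z z1 ζ : ℂ) : ℂ := bnKer 1 (z - ζ) - bnKer 1 (z1 - ζ)

lemma AK_meas (z z1 : ℂ) : Measurable (AK z z1) := dk_meas 1 z z1

lemma AK_bd {z z1 ζ : ℂ} (h : ‖z - z1‖ ≤ ‖z - ζ‖ / 2) : ‖AK z z1 ζ‖ ≤ BK 1 * ‖z - z1‖ * (1 / ‖z - ζ‖ ^ 3) :=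
  bn_diff' le_rfl h

lemma AK_far {z z1 ζ : ℂ} {H : Set ℂ} {r : ℝ} (hH : H ⊆ (ball z r)ᶜ) (hh : ‖z - z1‖ ≤ r / 2) (hζ : ζ ∈ H) :
    r ≤ ‖z - ζ‖ ∧ ‖z - z1‖ ≤ ‖z - ζ‖ / 2 := by
  have : ¬ ζ ∈ ball z r := hH hζ
  rw [mem_ball, dist_eq_norm, norm_sub_rev, not_lt] at this
  exact ⟨this, by linarith⟩

/-- bounded functions integrate against `AK` -/
lemma AK_mul_integrable {z z1 : ℂ} {S : Set ℂ} (hS : MeasurableSet S)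
    (hi : IntegrableOn (fun ζ => 1 / ‖z - ζ‖ ^ 3) S) (hf : ∀ w ∈ S, ‖z - z1‖ ≤ ‖z - w‖ / 2) {g : ℂ → ℂ}
    (hg : AEStronglyMeasurable g (volume.restrict S)) {B : ℝ} (hB : ∀ ζ ∈ S, ‖g ζ‖ ≤ B) :
    IntegrableOn (fun ζ => AK z z1 ζ * g ζ) S ∧
    ‖∫ ζ in S, AK z z1 ζ * g ζ‖ ≤ BK 1 * ‖z - z1‖ * B * ∫ ζ in S, 1 / ‖z - ζ‖ ^ 3 := by
  have hB1 := BK_nonneg 1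
  have hb : ∀ ζ ∈ S, ‖AK z z1 ζ * g ζ‖ ≤ BK 1 * ‖z - z1‖ * B * (1 / ‖z - ζ‖ ^ 3) := fun ζ hζ => by
    rw [norm_mul]
    exact (mul_le_mul (AK_bd (hf ζ hζ)) (hB ζ hζ) (norm_nonneg _) (by positivity)).trans (le_of_eq (by ring))
  have hi2 := hi.const_mul (BK 1 * ‖z - z1‖ * B)
  refine ⟨Integrable.mono' hi2 ((AK_meas z z1).aestronglyMeasurable.mul hg)
    ((ae_restrict_iff' hS).2 (ae_of_all _ hb)), ?_⟩
  rw [← integral_const_mul]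
  exact norm_integral_le_of_norm_le hi2 ((ae_restrict_iff' hS).2 (ae_of_all _ hb))

lemma far3 {z : ℂ} {H : Set ℂ} {r : ℝ} (hr : 0 < r) (hH : H ⊆ (ball z r)ᶜ) :
    IntegrableOn (fun ζ => 1 / ‖z - ζ‖ ^ 3) H ∧ ∫ ζ in H, 1 / ‖z - ζ‖ ^ 3 ≤ 2 * Real.pi / r := by
  have hi := compl3_integrable z hr
  refine ⟨hi.mono_set hH, ?_⟩
  rw [← compl3_integral z hr]
  exact setIntegral_mono_set hi (ae_of_all _ fun w => by simp only [Pi.zero_apply]; positivity) hH.eventuallyLE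

lemma J1 {m : ℕ} (hm : 1 ≤ m) {z z1 w : ℂ} {H : Set ℂ} (hHm : MeasurableSet H) {r δ τ : ℝ} (hr : 0 < r)
    (hH : H ⊆ (ball z r)ᶜ) (hh : ‖z - z1‖ ≤ r / 2) (hδ : 0 < δ) (hτ : 0 < τ) (hw : ∀ ζ ∈ H, τ ≤ ‖ζ - w‖)
    (h0 : ∫ ζ in H, AK z z1 ζ * bnKer m (ζ - w) = 0) :
    ‖∫ ζ in H, AK z z1 ζ * pK m δ (ζ - w)‖ ≤ BK 1 * ‖z - z1‖ * (BK (m + 1) * (δ ^ 2 / τ ^ 4)) * (2 * Real.pi / r) := by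
  have hB := BK_nonneg (m + 1)
  have hBm := BK_nonneg m
  have hB1 := BK_nonneg 1
  obtain ⟨hi, hib⟩ := far3 hr hH
  have hf : ∀ ζ ∈ H, ‖z - z1‖ ≤ ‖z - ζ‖ / 2 := fun ζ hζ => (AK_far hH hh hζ).2
  have ms : Measurable (fun ζ : ℂ => ζ - w) := by fun_prop
  obtain ⟨i1, -⟩ := AK_mul_integrable hHm hi hf (g := fun ζ => pK m δ (ζ - w))
    ((pK_meas m δ).comp ms).aestronglyMeasurable (fun ζ _ => pK_bdd m hδ _)
  obtain ⟨i2, -⟩ := AK_mul_integrable hHm hi hf (g := fun ζ => bnKer m (ζ - w))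
    ((bn_meas m).comp ms).aestronglyMeasurable (B := BK m / τ ^ 2) (fun ζ hζ => (bn_bd hm _).trans (by
      have := hw ζ hζ
      gcongr))
  have e : ∫ ζ in H, AK z z1 ζ * pK m δ (ζ - w) = ∫ ζ in H, AK z z1 ζ * (pK m δ (ζ - w) - bnKer m (ζ - w)) := by
    have : (fun ζ => AK z z1 ζ * (pK m δ (ζ - w) - bnKer m (ζ - w))) =
      fun ζ => AK z z1 ζ * pK m δ (ζ - w) - AK z z1 ζ * bnKer m (ζ - w) := by ext ζ; ring
    rw [this, integral_sub i1 i2, h0, sub_zero]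
  rw [e]
  refine (AK_mul_integrable hHm hi hf (g := fun ζ => pK m δ (ζ - w) - bnKer m (ζ - w))
    (((pK_meas m δ).comp ms).sub ((bn_meas m).comp ms)).aestronglyMeasurable (B := BK (m + 1) * (δ ^ 2 / τ ^ 4)) 
    (fun ζ hζ => ?_)).2.trans (by gcongr)
  rw [norm_sub_rev]
  refine (pK_diff hm hδ _).trans ?_
  have h1 := hw ζ hζ
  have h2 : ‖ζ - w‖ ^ 2 ≤ Rd δ (ζ - w) := Rd_le _
  have h3 : τ ^ 4 ≤ ‖ζ - w‖ ^ 2 * Rd δ (ζ - w) := by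
    have : τ ^ 2 ≤ ‖ζ - w‖ ^ 2 := by gcongr
    calc τ ^ 4 = τ ^ 2 * τ ^ 2 := by ring
      _ ≤ _ := by gcongr; exact this.trans h2
  gcongr

lemma J2 {m : ℕ} (hm : 1 ≤ m) {z z1 w : ℂ} {H : Set ℂ} (hHm : MeasurableSet H) {r δ R s : ℝ} (hr : 0 < r)
    (hH : H ⊆ (ball z r)ᶜ) (hh : ‖z - z1‖ ≤ r / 2) (hδ : 0 < δ) (hδ1 : δ ≤ 1) (hδr : δ ≤ r) (hs : 0 < s) (hs2 : s ≤ 2)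
    (hw0 : 0 < ‖z - w‖) (hwR : ‖z - w‖ ≤ R) 
    (h0 : ∫ ζ in H, AK z z1 ζ = 0) :
    ‖∫ ζ in H, AK z z1 ζ * pK m δ (ζ - w)‖ ≤ (BK 1 * BK (m + 1) *
      (8 * (2 * Real.pi / s * R ^ s) + 8 * (2 * Real.pi / s) + 4 * Real.pi * (R ^ 2 + 1))) * ‖z - z1‖ * δ ^ (-s) * (1 / ‖z - w‖ ^ 3) := by
  have hB := BK_nonneg (m + 1)
  have hB1 := BK_nonneg 1
  have hπ := Real.pi_pos
  obtain ⟨hi, hib⟩ := far3 hr hH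
  have hR : 0 < R := hw0.trans_le hwR
  have hf : ∀ ζ ∈ H, ‖z - z1‖ ≤ ‖z - ζ‖ / 2 := fun ζ hζ => (AK_far hH hh hζ).2
  have ms : Measurable (fun ζ : ℂ => ζ - w) := by fun_prop
  set h := ‖z - z1‖ with hhd
  set B := BK (m + 1) with hBd
  set q := ‖z - w‖ with hq
  set c1 := BK 1 * B * h * 8 / q ^ 3 * δ ^ (-s) with hc1
  set c3 := BK 1 * B * h * (1 + 1 / q ^ 2) with hc3
  have h0' : 0 ≤ h := norm_nonneg _
  have hc10 : 0 ≤ c1 := by positivity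
  have hc30 : 0 ≤ c3 := by positivity
  obtain ⟨i1, -⟩ := AK_mul_integrable hHm hi hf (g := fun ζ => pK m δ (ζ - w))
    ((pK_meas m δ).comp ms).aestronglyMeasurable (fun ζ _ => pK_bdd m hδ _)
  have iA : IntegrableOn (AK z z1) H := dk_integrable le_rfl hHm hi hf
  have e : ∫ ζ in H, AK z z1 ζ * pK m δ (ζ - w) = ∫ ζ in H, AK z z1 ζ * (pK m δ (ζ - w) - pK m δ (z - w)) := by
    have : (fun ζ => AK z z1 ζ * (pK m δ (ζ - w) - pK m δ (z - w))) =
      fun ζ => AK z z1 ζ * pK m δ (ζ - w) - AK z z1 ζ * pK m δ (z - w) := by ext ζ; ring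
    rw [this, integral_sub i1 (iA.mul_const _), integral_mul_const, h0, zero_mul, sub_zero]
  rw [e]
  set g1 : ℂ → ℝ := (ball z R).indicator (fun ζ => c1 * ‖z - ζ‖ ^ (s - 2)) with hg1
  set g2 : ℂ → ℝ := (ball w 1).indicator (fun ζ => c1 * ‖w - ζ‖ ^ (s - 2)) with hg2
  set g3 : ℂ → ℝ := (ball z (q / 2))ᶜ.indicator (fun ζ => c3 * (1 / ‖z - ζ‖ ^ 3)) with hg3
  have n1 : ∀ ζ, 0 ≤ g1 ζ := fun ζ => indicator_nonneg (fun _ _ => by positivity) _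
  have n2 : ∀ ζ, 0 ≤ g2 ζ := fun ζ => indicator_nonneg (fun _ _ => by positivity) _
  have n3 : ∀ ζ, 0 ≤ g3 ζ := fun ζ => indicator_nonneg (fun _ _ => by positivity) _
  have I1 : Integrable g1 := by
    rw [hg1, integrable_indicator_iff measurableSet_ball]; exact (ball_pow_integrable hs z R).const_mul _
  have I2 : Integrable g2 := by
    rw [hg2, integrable_indicator_iff measurableSet_ball]; exact (ball_pow_integrable hs w 1).const_mul _
  have I3 : Integrable g3 := by
    rw [hg3, integrable_indicator_iff measurableSet_ball.compl]
    exact (compl3_integrable z (by positivity)).const_mul _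
  have I12 : Integrable (fun ζ => g1 ζ + g2 ζ) := I1.add I2
  have I : Integrable (fun ζ => g1 ζ + g2 ζ + g3 ζ) := I12.add I3
  have E1 : ∫ ζ, g1 ζ = c1 * (2 * Real.pi / s * R ^ s) := by
    rw [hg1, integral_indicator measurableSet_ball, integral_const_mul, ball_pow_integral hs z hR.le]
  have E2 : ∫ ζ, g2 ζ = c1 * (2 * Real.pi / s) := by
    rw [hg2, integral_indicator measurableSet_ball, integral_const_mul, ball_pow_integral hs w zero_le_one, Real.one_rpow, mul_one]
  have E3 : ∫ ζ, g3 ζ = c3 * (2 * Real.pi / (q / 2)) := by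
    rw [hg3, integral_indicator measurableSet_ball.compl, integral_const_mul, compl3_integral z (by positivity)]
  have pt : ∀ᵐ ζ ∂(volume.restrict H), ‖AK z z1 ζ * (pK m δ (ζ - w) - pK m δ (z - w))‖ ≤ g1 ζ + g2 ζ + g3 ζ := by
    refine (ae_restrict_iff' hHm).2 ?_
    have : ∀ᵐ ζ : ℂ, ζ ≠ w := by simp [ae_iff]
    filter_upwards [this] with ζ hζw hζ
    obtain ⟨hζr, hζ2⟩ := AK_far hH hh hζ
    have hA := AK_bd hζ2
    have hp : 0 < ‖z - ζ‖ := hr.trans_le hζr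
    rw [norm_mul]
    by_cases hc : ‖z - ζ‖ < q / 2
    · have hb : ζ ∈ ball z R := by
        rw [mem_ball, dist_eq_norm, norm_sub_rev]; linarith
      have v1 : g1 ζ = c1 * ‖z - ζ‖ ^ (s - 2) := by rw [hg1, indicator_of_mem hb]
      have hl := pK_lip_near hm hδ (u := z - w) (v := ζ - w) (norm_pos_iff.1 hw0) (by
        have : ζ - w - (z - w) = -(z - ζ) := by ring
        rw [this, norm_neg]; exact hc.le)
      have e4 : ζ - w - (z - w) = -(z - ζ) := by ring
      rw [e4, norm_neg] at hl
      have hds : 1 / ‖z - ζ‖ ^ 2 ≤ δ ^ (-s) * ‖z - ζ‖ ^ (s - 2) := by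
        have q2 : ‖z - ζ‖ ^ (-s) ≤ δ ^ (-s) := Real.rpow_le_rpow_of_nonpos hδ (hδr.trans hζr) (by linarith)
        calc 1 / ‖z - ζ‖ ^ 2 = ‖z - ζ‖ ^ (-s) * ‖z - ζ‖ ^ (s - 2) := by
              rw [← Real.rpow_add hp, show -s + (s - 2) = -(2:ℕ) by push_cast; ring, Real.rpow_neg hp.le,
                Real.rpow_natCast, one_div]
          _ ≤ _ := by gcongr
      have : ‖AK z z1 ζ‖ * ‖pK m δ (ζ - w) - pK m δ (z - w)‖ ≤ g1 ζ := by
        rw [v1]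
        calc _ ≤ (BK 1 * h * (1 / ‖z - ζ‖ ^ 3)) * (B * (8 / q ^ 3) * ‖z - ζ‖) :=
              mul_le_mul hA hl (norm_nonneg _) (by positivity)
          _ = BK 1 * B * h * 8 / q ^ 3 * (1 / ‖z - ζ‖ ^ 2) := by field_simp
          _ ≤ BK 1 * B * h * 8 / q ^ 3 * (δ ^ (-s) * ‖z - ζ‖ ^ (s - 2)) := by gcongr
          _ = _ := by rw [hc1]; ring
      linarith [n2 ζ, n3 ζ]
    · have hc' : q / 2 ≤ ‖z - ζ‖ := not_lt.1 hc
      have hb : ζ ∈ (ball z (q / 2))ᶜ := by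
        rw [mem_compl_iff, mem_ball, dist_eq_norm, norm_sub_rev]; exact hc
      have v3 : g3 ζ = c3 * (1 / ‖z - ζ‖ ^ 3) := by rw [hg3, indicator_of_mem hb]
      have hA8 : ‖AK z z1 ζ‖ ≤ BK 1 * h * (8 / q ^ 3) := by
        refine hA.trans ?_
        have : 1 / ‖z - ζ‖ ^ 3 ≤ 1 / (q / 2) ^ 3 := by gcongr
        have e8 : 1 / (q / 2) ^ 3 = 8 / q ^ 3 := by field_simp; norm_num
        rw [e8] at this
        gcongr
      have hpz : ‖pK m δ (z - w)‖ ≤ B * (1 / q ^ 2) := by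
        refine (pK_bd m hδ _).trans ?_
        rw [div_eq_mul_one_div]
        gcongr
        exact Rd_le _
      have t1 : ‖AK z z1 ζ‖ * ‖pK m δ (z - w)‖ ≤ (BK 1 * h * (1 / ‖z - ζ‖ ^ 3)) * (B * (1 / q ^ 2)) :=
        mul_le_mul hA hpz (norm_nonneg _) (by positivity)
      have t2 : ‖AK z z1 ζ‖ * ‖pK m δ (ζ - w)‖ ≤ g2 ζ + (BK 1 * h * (1 / ‖z - ζ‖ ^ 3)) * B := by
        by_cases hcw : ζ ∈ ball w 1
        · have v2 : g2 ζ = c1 * ‖w - ζ‖ ^ (s - 2) := by rw [hg2, indicator_of_mem hcw]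
          have hpp : ‖pK m δ (ζ - w)‖ ≤ B * (δ ^ (-s) * ‖w - ζ‖ ^ (s - 2)) := by
            refine (pK_bd m hδ _).trans ?_
            rw [div_eq_mul_one_div, norm_sub_rev w ζ]
            exact mul_le_mul_of_nonneg_left (invR_le_s hδ hs.le hs2 (sub_ne_zero.2 hζw)) hB
          have := mul_le_mul hA8 hpp (norm_nonneg _) (by positivity)
          have h5 : 0 ≤ (BK 1 * h * (1 / ‖z - ζ‖ ^ 3)) * B := by positivity
          rw [v2]
          calc _ ≤ BK 1 * h * (8 / q ^ 3) * (B * (δ ^ (-s) * ‖w - ζ‖ ^ (s - 2))) := this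
            _ = c1 * ‖w - ζ‖ ^ (s - 2) := by rw [hc1]; ring
            _ ≤ _ := by linarith
        · have hpp : ‖pK m δ (ζ - w)‖ ≤ B := by
            refine (pK_bd m hδ _).trans (div_le_self hB ?_)
            rw [mem_ball, dist_eq_norm, not_lt] at hcw
            have := Rd_le (δ := δ) (ζ - w)
            nlinarith
          have := mul_le_mul hA hpp (norm_nonneg _) (by positivity)
          linarith [n2 ζ]
      have t3 : ‖AK z z1 ζ‖ * ‖pK m δ (ζ - w) - pK m δ (z - w)‖ ≤
          ‖AK z z1 ζ‖ * ‖pK m δ (ζ - w)‖ + ‖AK z z1 ζ‖ * ‖pK m δ (z - w)‖ := by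
        rw [← mul_add]; exact mul_le_mul_of_nonneg_left (norm_sub_le _ _) (norm_nonneg _)
      have t4 : (BK 1 * h * (1 / ‖z - ζ‖ ^ 3)) * B + (BK 1 * h * (1 / ‖z - ζ‖ ^ 3)) * (B * (1 / q ^ 2)) = g3 ζ := by
        rw [v3, hc3]; ring
      linarith [n1 ζ]
  refine (norm_integral_le_of_norm_le I.integrableOn pt).trans ?_
  refine (setIntegral_le_integral I (ae_of_all _ fun ζ => ?_)).trans ?_
  · simp only [Pi.zero_apply]; linarith [n1 ζ, n2 ζ, n3 ζ]
  rw [integral_add I12 I3, integral_add I1 I2, E1, E2, E3]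
  have hδs : 1 ≤ δ ^ (-s) := Real.one_le_rpow_of_pos_of_le_one_of_nonpos hδ hδ1 (by linarith)
  have f3 : c3 * (2 * Real.pi / (q / 2)) ≤ BK 1 * B * h * (4 * Real.pi * (R ^ 2 + 1)) / q ^ 3 * δ ^ (-s) := by
    have e9 : c3 * (2 * Real.pi / (q / 2)) = BK 1 * B * h * (4 * Real.pi * (q ^ 2 + 1)) / q ^ 3 := by
      rw [hc3]; field_simp; ring
    rw [e9]
    calc _ ≤ BK 1 * B * h * (4 * Real.pi * (R ^ 2 + 1)) / q ^ 3 := by gcongr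
      _ ≤ _ := le_mul_of_one_le_right (by positivity) hδs
  calc _ ≤ c1 * (2 * Real.pi / s * R ^ s) + c1 * (2 * Real.pi / s) + BK 1 * B * h * (4 * Real.pi * (R ^ 2 + 1)) / q ^ 3 * δ ^ (-s) := by linarith
    _ = _ := by rw [hc1]; ring

lemma AK_fub {Ω f M} (h : BdF Ω f M) (hM : 0 ≤ M) {m : ℕ} {δ : ℝ} (hδ : 0 < δ) {z z1 : ℂ} {H : Set ℂ}
    (hHm : MeasurableSet H) {r : ℝ} (hr : 0 < r) (hH : H ⊆ (ball z r)ᶜ) (hh : ‖z - z1‖ ≤ r / 2) :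
    ∫ ζ in H, AK z z1 ζ * gD Ω m δ f ζ = ∫ w in Ω, (∫ ζ in H, AK z z1 ζ * pK m δ (ζ - w)) * f w := by
  have hB := BK_nonneg (m + 1)
  have hB1 := BK_nonneg 1
  haveI : IsFiniteMeasure (volume.restrict Ω) := ⟨by rw [Measure.restrict_apply_univ]; exact h.vol.lt_top⟩
  have hintg : Integrable (Function.uncurry fun ζ w => AK z z1 ζ * (pK m δ (ζ - w) * f w))
      ((volume.restrict H).prod (volume.restrict Ω)) := by
    have hg : Integrable (fun p : ℂ × ℂ => (BK 1 * ‖z - z1‖ * (BK (m + 1) / δ ^ 2 * M) * (1 / ‖z - p.1‖ ^ 3)) * (1:ℝ))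
        ((volume.restrict H).prod (volume.restrict Ω)) :=
      Integrable.mul_prod ((far3 hr hH).1.const_mul _) (integrable_const _)
    refine hg.mono' ?_ ?_
    · refine AEStronglyMeasurable.mul ?_ (AEStronglyMeasurable.mul ?_ ?_)
      · exact ((AK_meas z z1).comp (by fun_prop : Measurable fun p : ℂ × ℂ => p.1)).aestronglyMeasurable
      · exact ((pK_meas m δ).comp (by fun_prop : Measurable fun p : ℂ × ℂ => p.1 - p.2)).aestronglyMeasurable
      · exact h.um.comp_snd
    · rw [Measure.prod_restrict, ae_restrict_iff' (hHm.prod h.meas)]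
      refine ae_of_all _ fun p hp => ?_
      have hζ : p.1 ∈ H := hp.1
      have hw : p.2 ∈ Ω := hp.2
      simp only [Function.uncurry, norm_mul, mul_one]
      calc _ ≤ (BK 1 * ‖z - z1‖ * (1 / ‖z - p.1‖ ^ 3)) * (BK (m + 1) / δ ^ 2 * M) := by
            refine mul_le_mul (AK_bd (AK_far hH hh hζ).2) ?_ (by positivity) (by positivity)
            exact mul_le_mul (pK_bdd m hδ _) (h.ub _ hw) (norm_nonneg _) (by positivity)
        _ = _ := by ring
  have e1 : ∀ ζ, AK z z1 ζ * gD Ω m δ f ζ = ∫ w in Ω, AK z z1 ζ * (pK m δ (ζ - w) * f w) := fun ζ => by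
    rw [gD, ← integral_const_mul]
  simp only [e1]
  rw [integral_integral_swap hintg]
  congr 1; ext w
  rw [← integral_mul_const]
  congr 1; ext ζ
  ring

lemma half_int {ε Ω ρ L} (D : Dom ε Ω ρ L) {m : ℕ} (hm : 1 ≤ m) {s : ℝ} (hs : 0 < s) (hs2 : s ≤ 2) :
    ∃ C : ℝ, 0 ≤ C ∧ ∀ (f : ℂ → ℂ) (M τ : ℝ) (z z1 : ℂ), BdF Ω f M → 0 ≤ M → z ∈ Ω →
      ‖z - z1‖ ≤ kap L * dst Ω z → dst Ω z < ρ → ∀ e φ, Chart ε Ω z ρ L e φ →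
      0 < τ → τ ≤ 1 → τ ≤ dst Ω z ^ (1 + ε) → τ ≤ dst Ω z / (2 * (1 + L)) →
      ‖∫ ζ in HP (tanE z e φ) (tanT z e φ), AK z z1 ζ * gD Ω m (τ ^ 3) f ζ‖ ≤
        C * M * ‖z - z1‖ * (τ ^ 3) ^ (-s) * dst Ω z ^ (ε - 1) := by
  have hL := D.L1
  have hε0 := D.e0
  have hρ := D.r0
  obtain ⟨C, hC, hT⟩ := thinW D
  obtain ⟨R, hR1, hR, -⟩ := exists_R D.bdd
  have hB1 := BK_nonneg 1
  have hB := BK_nonneg (m + 1)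
  set A1 := BK 1 * BK (m + 1) * (2 * Real.pi * (1 + L)) with hA1
  set A2 := BK 1 * BK (m + 1) *
      (8 * (2 * Real.pi / s * R ^ s) + 8 * (2 * Real.pi / s) + 4 * Real.pi * (R ^ 2 + 1)) with hA2
  have pA1 : 0 ≤ A1 := by positivity
  have pA2 : 0 ≤ A2 := by positivity
  refine ⟨A1 * volume.real Ω + A2 * C, by positivity, ?_⟩
  intro f M τ z z1 hf hM hz hzz hd e φ h hτ hτ1 hτe hτd
  have hdp := dst_pos D.op D.bdd hz
  obtain ⟨k1, k2, k3, k4⟩ := kap_mul hL hdp.le hzz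
  set d := dst Ω z with hdd
  set H := HP (tanE z e φ) (tanT z e φ) with hHdef
  have hHm : MeasurableSet H := HP_meas _ _
  have hHf : H ⊆ (ball z (d / (1 + L)))ᶜ := HP_far D hz hd h
  have hr : 0 < d / (1 + L) := by positivity
  set δ := τ ^ 3 with hδdef
  have hδ : 0 < δ := by positivity
  have hδτ : δ ≤ τ := by
    calc τ ^ 3 ≤ τ ^ 1 := pow_le_pow_of_le_one hτ.le hτ1 (by norm_num)
      _ = τ := pow_one _
  have hδ1 : δ ≤ 1 := hδτ.trans hτ1
  have hδr : δ ≤ d / (1 + L) := by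
    refine hδτ.trans (hτd.trans ?_)
    gcongr; linarith
  have hn := norm_nonneg (z - z1)
  set P := δ ^ (-s) with hP
  have hP1 : 1 ≤ P := Real.one_le_rpow_of_pos_of_le_one_of_nonpos hδ hδ1 (by linarith)
  have hQ : 0 < d ^ (ε - 1) := by positivity
  have nz : (tanE z e φ * z).im ≤ tanT z e φ := HP_near D hz hd h (by simp; positivity)
  have nz1 : (tanE z e φ * z1).im ≤ tanT z e φ := HP_near D hz hd h k2
  obtain ⟨w1, w2⟩ := hT z hz hd e φ h τ hτ.le hτe hτd
  set W := Wset Ω L z e φ τ with hW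
  have hWm : MeasurableSet W := Wset_meas D.op L z e φ τ
  -- pointwise
  have key : ∀ w ∈ Ω, ‖∫ ζ in H, AK z z1 ζ * pK m δ (ζ - w)‖ ≤
      A1 * ‖z - z1‖ * P * d ^ (ε - 1) + A2 * ‖z - z1‖ * P * W.indicator (fun w => 1 / ‖z - w‖ ^ 3) w := by
    intro w hw
    by_cases hwW : w ∈ W
    · rw [indicator_of_mem hwW]
      have f1 := Wset_far D hz hd h hτd hwW
      have f2 : 0 < ‖z - w‖ := lt_of_lt_of_le (by positivity) f1
      have f3 : ‖z - w‖ ≤ R := by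
        have := hR z hz hw
        rw [mem_ball, dist_comm, dist_eq_norm] at this; exact this.le
      have := J2 hm hHm hr hHf k3 hδ hδ1 hδr hs hs2 f2 f3 (HP_zero2 le_rfl (tanE_ne h.e1 φ) nz nz1)
      refine this.trans ?_
      have : 0 ≤ A1 * ‖z - z1‖ * P * d ^ (ε - 1) := by positivity
      rw [← hA2, ← hP]
      linarith
    · rw [indicator_of_notMem hwW, mul_zero, add_zero]
      have hsw : sht z e φ w ≤ -((1 + L) * τ) := by
        by_contra hc
        push Not at hc
        exact hwW (Or.inl ⟨hw, hc⟩)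
      have hpos : 0 ≤ (1 + L) * τ := by positivity
      have hww : (tanE z e φ * w).im ≤ tanT z e φ := by
        have := sht_eq z e φ w
        linarith
      have hfar : ∀ ζ ∈ H, τ ≤ ‖ζ - w‖ := fun ζ hζ => by
        rw [hHdef, mem_HP_iff] at hζ
        have t1 := h.T1 ζ w
        have t2 := le_abs_self (sht z e φ ζ - sht z e φ w)
        have : (1 + L) * τ ≤ (1 + L) * ‖ζ - w‖ := by linarith
        exact le_of_mul_le_mul_left this (by linarith)
      have := J1 hm hHm hr hHf k3 hδ hτ hfar (HP_zero1 hm (tanE_ne h.e1 φ) nz nz1 hww)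
      refine this.trans ?_
      have q1 : δ ^ 2 / τ ^ 4 ≤ τ := by
        rw [hδdef, div_le_iff₀ (by positivity)]
        have : (τ ^ 3) ^ 2 = τ * τ ^ 4 * τ := by ring
        rw [this]
        exact mul_le_of_le_one_right (by positivity) hτ1
      have q2 : δ ^ 2 / τ ^ 4 / d ≤ P * d ^ (ε - 1) := by
        have hd1 : d ≤ 1 := hd.le.trans D.r1
        calc δ ^ 2 / τ ^ 4 / d ≤ d ^ (1 + ε) / d := by gcongr; exact q1.trans hτe
          _ = d * d ^ (ε - 1) := by
            rw [div_eq_iff hdp.ne', show 1 + ε = 1 + (ε - 1) + 1 by ring, Real.rpow_add hdp, Real.rpow_add hdp, Real.rpow_one]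
          _ ≤ P * d ^ (ε - 1) := by gcongr; exact hd1.trans hP1
      calc _ = A1 * ‖z - z1‖ * (δ ^ 2 / τ ^ 4 / d) := by rw [hA1]; field_simp
        _ ≤ A1 * ‖z - z1‖ * (P * d ^ (ε - 1)) := by gcongr
        _ = _ := by ring
  have hWi : IntegrableOn (W.indicator (fun w => 1 / ‖z - w‖ ^ 3)) Ω := by
    have : Integrable (W.indicator (fun w => 1 / ‖z - w‖ ^ 3)) := (integrable_indicator_iff hWm).2 w1
    exact this.integrableOn
  haveI : IsFiniteMeasure (volume.restrict Ω) := ⟨by rw [Measure.restrict_apply_univ]; exact hf.vol.lt_top⟩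
  have hWb : ∫ w in Ω, W.indicator (fun w => 1 / ‖z - w‖ ^ 3) w ≤ C * d ^ (ε - 1) := by
    rw [setIntegral_indicator hWm]
    exact (setIntegral_mono_set w1 (ae_of_all _ fun _ => by positivity) inter_subset_right.eventuallyLE).trans w2
  rw [AK_fub hf hM hδ hHm hr hHf k3]
  have c1 : IntegrableOn (fun _ : ℂ => A1 * ‖z - z1‖ * P * d ^ (ε - 1) * M) Ω := integrable_const _
  have c2 : IntegrableOn (fun w : ℂ => A2 * ‖z - z1‖ * P * M * W.indicator (fun w => 1 / ‖z - w‖ ^ 3) w) Ω := hWi.const_mul _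
  have c3 : IntegrableOn (fun w : ℂ => A1 * ‖z - z1‖ * P * d ^ (ε - 1) * M +
    A2 * ‖z - z1‖ * P * M * W.indicator (fun w => 1 / ‖z - w‖ ^ 3) w) Ω := c1.add c2
  refine (norm_integral_le_of_norm_le c3 ?_).trans ?_
  · rw [ae_restrict_iff' hf.meas]
    refine ae_of_all _ fun w hw => ?_
    rw [norm_mul]
    calc _ ≤ (A1 * ‖z - z1‖ * P * d ^ (ε - 1) + A2 * ‖z - z1‖ * P * W.indicator (fun w => 1 / ‖z - w‖ ^ 3) w) * M :=
          mul_le_mul (key w hw) (hf.ub w hw) (norm_nonneg _) ((norm_nonneg _).trans (key w hw))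
      _ = _ := by ring
  · rw [integral_add c1 c2, integral_const, integral_const_mul, smul_eq_mul]
    simp only [measureReal_restrict_apply_univ]
    calc _ ≤ volume.real Ω * (A1 * ‖z - z1‖ * P * d ^ (ε - 1) * M) + A2 * ‖z - z1‖ * P * M * (C * d ^ (ε - 1)) := by
          gcongr
      _ = _ := by ring

lemma step_b {ε Ω ρ L} (D : Dom ε Ω ρ L) {α : ℝ} (hα : 0 < α) {m : ℕ} (hm : 1 ≤ m) {s : ℝ} (hs : 0 < s) (hs2 : s ≤ 2) :
    ∃ C : ℝ, 0 ≤ C ∧ ∀ (f : ℂ → ℂ) (M τ : ℝ) (z z1 : ℂ), HolB α Ω f M → z ∈ Ω →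
      ‖z - z1‖ ≤ kap L * dst Ω z → 
      0 < τ → τ ≤ 1 → τ ≤ dst Ω z ^ (1 + ε) → τ ≤ dst Ω z / (2 * (1 + L)) →
      ‖SD Ω m (τ ^ 3) f z - SD Ω m (τ ^ 3) f z1‖ ≤
        C * M * ‖z - z1‖ * (τ ^ 3) ^ (-s) * dst Ω z ^ (ε - 1) := by
  have hL := D.L1
  have hε0 := D.e0
  have hρ := D.r0
  obtain ⟨C, hC, hT⟩ := thinW D
  obtain ⟨C', hC', hH'⟩ := half_int D hm hs hs2
  obtain ⟨R, hR1, hR, -⟩ := exists_R D.bdd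
  have hB1 := BK_nonneg 1
  have hB := BK_nonneg (m + 1)
  set G := BK (m + 1) * (2 * Real.pi / s + volume.real Ω) with hG
  have pG : 0 ≤ G := by positivity
  refine ⟨BK 1 * G * C + BK 1 * G * C + C' + BK 1 * G * (2 * Real.pi * ρ ^ (-ε)), by positivity, ?_⟩
  intro f M τ z z1 hfH hz hzz hτ hτ1 hτe hτd
  have hM := hfH.nonneg hz
  have hf := hfH.bdF hα D.op D.bdd
  have hdp := dst_pos D.op D.bdd hz
  obtain ⟨k1, k2, k3, k4⟩ := kap_mul hL hdp.le hzz
  have hn := norm_nonneg (z - z1)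
  have hz1 : z1 ∈ Ω := dst_ball Ω z (by rw [mem_ball, dist_comm, dist_eq_norm]; linarith)
  have hd1p := dst_pos D.op D.bdd hz1
  have hcm : MeasurableSet Ωᶜ := D.op.measurableSet.compl
  have hci : IntegrableOn (fun ζ => 1 / ‖z - ζ‖ ^ 3) Ωᶜ :=
    (compl3_integrable z hdp).mono_set (compl_far Ω z)
  have hcf : ∀ w ∈ Ωᶜ, ‖z - z1‖ ≤ ‖z - w‖ / 2 := fun w hw => by
    have := dst_le_of_notMem (z := z) hw
    linarith
  set d := dst Ω z with hdd
  set δ := τ ^ 3 with hδdef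
  have hδ : 0 < δ := by positivity
  have hRle : ∀ y ∈ Ω, ∀ w ∈ Ω, ‖y - w‖ ≤ R := fun y hy w hw => by
    have := hR y hy hw
    rw [mem_ball, dist_comm, dist_eq_norm] at this; exact this.le
  have hintg : ∀ y ∈ Ω, IntegrableOn (fun ζ => bnKer 1 (y - ζ) * gD Ω m δ f ζ) Ωᶜ := fun y hy => by
    obtain ⟨a1, a2, a3⟩ := gD_ext_integrable hf hM hm hδ (hRle y hy) (dst_pos D.op D.bdd hy) hcm (compl_far Ω y) (bn_ker le_rfl)
    exact a1.mono' a2 ((ae_restrict_iff' hcm).2 (ae_of_all _ a3))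
  have e0 : SD Ω m δ f z - SD Ω m δ f z1 = - ∫ ζ in Ωᶜ, AK z z1 ζ * gD Ω m δ f ζ := by
    have : ∫ ζ in Ωᶜ, AK z z1 ζ * gD Ω m δ f ζ = (∫ ζ in Ωᶜ, bnKer 1 (z - ζ) * gD Ω m δ f ζ) -
        ∫ ζ in Ωᶜ, bnKer 1 (z1 - ζ) * gD Ω m δ f ζ := by
      rw [← integral_sub (hintg z hz) (hintg z1 hz1)]
      congr 1; ext ζ; simp only [AK]; ring
    rw [this, SD, SD]; ring
  rw [e0, norm_neg]
  set P := δ ^ (-s) with hP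
  have hPp : 0 < P := by positivity
  have hp : 0 < d ^ (ε - 1) := by positivity
  have hgm : ∀ S : Set ℂ, AEStronglyMeasurable (gD Ω m δ f) (volume.restrict S) := fun S =>
    (gD_cont hf hm hδ hM).aestronglyMeasurable
  have hgb : ∀ S : Set ℂ, ∀ ζ ∈ S, ‖gD Ω m δ f ζ‖ ≤ G * M * P := fun S ζ _ => gD_sup hf hM hδ hs hs2 ζ
  have hI := AK_mul_integrable hcm hci hcf (hgm _) (hgb _)
  by_cases hd : d < ρ
  · obtain ⟨e, φ, h⟩ := D.ch z hz hd
    have hh0 := hH' f M τ z z1 hf hM hz hzz hd e φ h hτ hτ1 hτe hτd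
    set H := HP (tanE z e φ) (tanT z e φ)
    have hHm : MeasurableSet H := HP_meas _ _
    have hHf : H ⊆ (ball z (d / (1 + L)))ᶜ := HP_far D hz hd h
    have hr : 0 < d / (1 + L) := by positivity
    have hHi := (far3 hr hHf).1
    have hHff : ∀ w ∈ H, ‖z - z1‖ ≤ ‖z - w‖ / 2 := fun w hw => (AK_far hHf k3 hw).2
    have hIH := AK_mul_integrable hHm hHi hHff (hgm _) (hgb _)
    have e1 := int_sub_sets hcm hHm hI.1 hIH.1
    obtain ⟨w1, w2⟩ := hT z hz hd e φ h 0 le_rfl (by positivity) (by positivity)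
    have s1 : Ωᶜ \ H ⊆ Wset Ω L z e φ 0 := fun ζ hζ => by
      right
      refine ⟨hζ.1, ?_⟩
      have := hζ.2
      rw [mem_HP_iff] at this
      linarith
    have s2 : H \ Ωᶜ ⊆ Wset Ω L z e φ 0 := fun ζ hζ => by
      left
      refine ⟨not_not.1 hζ.2, ?_⟩
      have := hζ.1
      rw [mem_HP_iff] at this
      linarith
    have b1 := (AK_mul_integrable (hcm.diff hHm) (w1.mono_set s1) (z1 := z1) (fun w hw => hcf w hw.1) (hgm _) (hgb _)).2
    have b2 := (AK_mul_integrable (hHm.diff hcm) (w1.mono_set s2) (z1 := z1) (fun w hw => hHff w hw.1) (hgm _) (hgb _)).2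
    have m1 : ∫ w in Ωᶜ \ H, 1 / ‖z - w‖ ^ 3 ≤ C * d ^ (ε - 1) :=
      (setIntegral_mono_set w1 (ae_of_all _ fun _ => by positivity) s1.eventuallyLE).trans w2
    have m2 : ∫ w in H \ Ωᶜ, 1 / ‖z - w‖ ^ 3 ≤ C * d ^ (ε - 1) :=
      (setIntegral_mono_set w1 (ae_of_all _ fun _ => by positivity) s2.eventuallyLE).trans w2
    rw [sub_eq_iff_eq_add] at e1
    rw [e1]
    calc _ ≤ BK 1 * ‖z - z1‖ * (G * M * P) * (C * d ^ (ε - 1)) + BK 1 * ‖z - z1‖ * (G * M * P) * (C * d ^ (ε - 1))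
            + C' * M * ‖z - z1‖ * P * d ^ (ε - 1) := by
          refine (norm_add_le _ _).trans (add_le_add ?_ hh0)
          refine (norm_sub_le _ _).trans (add_le_add (b1.trans ?_) (b2.trans ?_)) <;> gcongr
      _ = (BK 1 * G * C + BK 1 * G * C + C') * M * ‖z - z1‖ * P * d ^ (ε - 1) := by ring
      _ ≤ _ := by
        gcongr ?_ * _ * _ * _ * _
        have : 0 ≤ BK 1 * G * (2 * Real.pi * ρ ^ (-ε)) := by positivity
        linarith
  · push Not at hd
    have m1 : ∫ w in Ωᶜ, 1 / ‖z - w‖ ^ 3 ≤ 2 * Real.pi / d := (far3 hdp (compl_far Ω z)).2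
    have m2 : 1 / d ≤ ρ ^ (-ε) * d ^ (ε - 1) := by
      have : 1 / d = d ^ (-ε) * d ^ (ε - 1) := by
        rw [← Real.rpow_add hdp]; ring_nf; rw [Real.rpow_neg_one]
      rw [this]
      gcongr ?_ * _
      exact Real.rpow_le_rpow_of_nonpos hρ hd (by linarith)
    calc _ ≤ BK 1 * ‖z - z1‖ * (G * M * P) * (2 * Real.pi / d) := by
          refine hI.2.trans ?_
          gcongr
      _ = BK 1 * ‖z - z1‖ * (G * M * P) * (2 * Real.pi) * (1 / d) := by ring
      _ ≤ BK 1 * ‖z - z1‖ * (G * M * P) * (2 * Real.pi) * (ρ ^ (-ε) * d ^ (ε - 1)) := by gcongr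
      _ = (BK 1 * G * (2 * Real.pi * ρ ^ (-ε))) * M * ‖z - z1‖ * P * d ^ (ε - 1) := by ring
      _ ≤ _ := by
        gcongr ?_ * _ * _ * _ * _
        have : 0 ≤ BK 1 * G * C + BK 1 * G * C + C' := by positivity
        linarith

lemma S_sup {ε Ω ρ L} (D : Dom ε Ω ρ L) {α : ℝ} (hα : 0 < α) (hα1 : α ≤ ε) {m : ℕ} (hm : 1 ≤ m) :
    ∃ C : ℝ, 0 ≤ C ∧ ∀ (M : ℝ) (f : ℂ → ℂ), 0 ≤ M → HolB α Ω f M → ∀ z ∈ Ω, ‖SOp Ω m f z‖ ≤ C * M := by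
  obtain ⟨C1, h1, H1⟩ := TA D hm hα hα1
  obtain ⟨C2, h2, H2⟩ := TA D (le_refl 1) hα hα1
  obtain ⟨C3, h3, H3⟩ := TA D (show 1 ≤ m + 1 by omega) hα hα1
  refine ⟨C2 * C1 + C3, by positivity, fun M f hM hf z hz => ?_⟩
  have a := (H2 _ _ (by positivity) (H1 M f hM hf)).1 z hz
  have b := (H3 M f hM hf).1 z hz
  refine (norm_sub_le _ _).trans ((add_le_add a b).trans (le_of_eq (by ring)))

theorem TB {ε Ω ρ L} (D : Dom ε Ω ρ L) {α β : ℝ} (hα : 0 < α) (hα1 : α ≤ ε) (hβ : 0 < β) (hβε : β < ε)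
    {m : ℕ} (hm : 1 ≤ m) :
    ∃ C : ℝ, 0 ≤ C ∧ ∀ (M : ℝ) (f : ℂ → ℂ), 0 ≤ M → HolB α Ω f M → HolB β Ω (SOp Ω m f) (C * M) := by
  have hL := D.L1
  have hε0 := D.e0
  have hε1 := D.e1
  obtain ⟨CA, pA, HA⟩ := S_sup D hα hα1 hm
  obtain ⟨Ca, pa, Ha⟩ := step_a D hα hα1 hm
  set K := 8 / α with hK
  have hKp : 8 ≤ K := by rw [hK, le_div_iff₀ hα]; linarith
  set s := (ε - β) / (3 * K) with hs
  have hsp : 0 < s := by apply div_pos <;> linarith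
  have hs2 : s ≤ 2 := by rw [hs, div_le_iff₀ (by linarith)]; linarith
  obtain ⟨Cb, pb, Hb⟩ := step_b D hα hm hsp hs2
  obtain ⟨c0, hc0, Cc, pc, Hc⟩ := D.chain (β := β) (kap_pos hL) (by have := kap_le hL; linarith) hβ
  refine ⟨Cc * (4 * Ca + Cb + 2 * CA), by positivity, fun M f hM hf => ?_⟩
  rw [mul_assoc]
  refine Hc _ _ (by positivity) ?_ ?_
  swap
  · intro z hz _
    refine (HA M f hM hf z hz).trans ?_
    gcongr; linarith
  intro z hz z1 hzz
  have hdp := dst_pos D.op D.bdd hz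
  obtain ⟨k1, k2, k3, k4⟩ := kap_mul hL hdp.le hzz
  have hz1 : z1 ∈ Ω := dst_ball Ω z (by rw [mem_ball, dist_comm, dist_eq_norm]; linarith)
  have hd1 := dst_lip Ω z z1
  set d := dst Ω z with hdd
  set h := ‖z - z1‖ with hh
  rcases eq_or_lt_of_le (norm_nonneg (z - z1)) with h0 | h0
  · have : z = z1 := by rwa [eq_comm, norm_eq_zero, sub_eq_zero] at h0
    rw [this, sub_self, norm_zero]; positivity
  rw [← hh] at h0
  by_cases h1 : 1 ≤ h
  · have a := HA M f hM hf z hz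
    have b := HA M f hM hf z1 hz1
    have hb : 1 ≤ h ^ β := Real.one_le_rpow h1 hβ.le
    calc _ ≤ CA * M + CA * M := (norm_sub_le _ _).trans (add_le_add a b)
      _ = (2 * CA) * M * 1 := by ring
      _ ≤ _ := by
        gcongr
        linarith
  push Not at h1
  have hh1 : h ≤ 1 := h1.le
  set τ := h ^ K with hτ
  set t := h ^ (3 * K / 2) with ht
  have hτp : 0 < τ := by positivity
  have htp : 0 < t := by positivity
  have hτt : t ^ 2 = τ ^ 3 := by
    rw [ht, hτ, ← Real.rpow_natCast, ← Real.rpow_natCast, ← Real.rpow_mul h0.le, ← Real.rpow_mul h0.le]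
    congr 1; push_cast; ring
  have hth : t ≤ h := by
    calc t ≤ h ^ (1:ℝ) := Real.rpow_le_rpow_of_exponent_ge h0 hh1 (by linarith)
      _ = h := Real.rpow_one h
  have hτh : τ ≤ h := by
    calc τ ≤ h ^ (1:ℝ) := Real.rpow_le_rpow_of_exponent_ge h0 hh1 (by linarith)
      _ = h := Real.rpow_one h
  have hta : t ^ (α / 4) = h ^ 3 := by
    rw [ht, ← Real.rpow_mul h0.le, ← Real.rpow_natCast]
    congr 1; rw [hK]; push_cast; field_simp; norm_num
  have hhβ : h ≤ h ^ β := by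
    calc h = h ^ (1:ℝ) := (Real.rpow_one h).symm
      _ ≤ _ := Real.rpow_le_rpow_of_exponent_ge h0 hh1 (by linarith)
  have hA : ∀ y ∈ Ω, 2 * h ≤ dst Ω y → ‖SOp Ω m f y - SD Ω m (τ ^ 3) f y‖ ≤ 2 * Ca * M * h ^ β := by
    intro y hy hdy
    have := Ha f M t y hf hy htp (hth.trans hh1) (by linarith)
    rw [hτt, hta] at this
    refine this.trans ?_
    have hyp : 0 < dst Ω y := by linarith
    have q : h ^ 3 * (1 + 1 / dst Ω y ^ 2) ≤ 2 * h := by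
      have q1 : h ^ 2 / dst Ω y ^ 2 ≤ 1 := by
        rw [div_le_one (by positivity)]; gcongr; linarith
      have q2 : h ^ 2 ≤ 1 := pow_le_one₀ h0.le hh1
      calc h ^ 3 * (1 + 1 / dst Ω y ^ 2) = h * (h ^ 2 + h ^ 2 / dst Ω y ^ 2) := by ring
        _ ≤ h * (1 + 1) := by gcongr
        _ = _ := by ring
    calc _ = Ca * M * (h ^ 3 * (1 + 1 / dst Ω y ^ 2)) := by ring
      _ ≤ Ca * M * (2 * h ^ β) := mul_le_mul_of_nonneg_left (by linarith) (by positivity)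
      _ = _ := by ring
  have a1 := hA z hz (by linarith)
  have a2 := hA z1 hz1 (by linarith)
  have hτe : τ ≤ d ^ (1 + ε) := by
    calc τ ≤ h ^ (1 + ε) := Real.rpow_le_rpow_of_exponent_ge h0 hh1 (by linarith)
      _ ≤ _ := by gcongr; linarith
  have hτd : τ ≤ d / (2 * (1 + L)) := by
    have : 1 / (2 * (1 + L)) * d = d / (2 * (1 + L)) := by ring
    have p : 0 < d / (2 * (1 + L)) := by positivity
    linarith
  have b := Hb f M τ z z1 hf hz hzz hτp (hτh.trans hh1) hτe hτd
  have hb : h * (τ ^ 3) ^ (-s) * d ^ (ε - 1) ≤ h ^ β := by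
    have e1 : (τ ^ 3) ^ (-s) = h ^ (-(ε - β)) := by
      rw [hτ, ← Real.rpow_natCast, ← Real.rpow_mul h0.le, ← Real.rpow_mul h0.le]
      congr 1; rw [hs]; push_cast; field_simp
    have e2 : d ^ (ε - 1) ≤ h ^ (ε - 1) := Real.rpow_le_rpow_of_nonpos h0 (by linarith) (by linarith)
    calc _ ≤ h * h ^ (-(ε - β)) * h ^ (ε - 1) := by rw [e1]; gcongr
      _ = h ^ (1:ℝ) * h ^ (-(ε - β)) * h ^ (ε - 1) := by rw [Real.rpow_one]
      _ = h ^ β := by rw [← Real.rpow_add h0, ← Real.rpow_add h0]; congr 1; ring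
  have e : SOp Ω m f z - SOp Ω m f z1 = (SOp Ω m f z - SD Ω m (τ ^ 3) f z) - (SOp Ω m f z1 - SD Ω m (τ ^ 3) f z1)
    + (SD Ω m (τ ^ 3) f z - SD Ω m (τ ^ 3) f z1) := by ring
  rw [e]
  calc _ ≤ 2 * Ca * M * h ^ β + 2 * Ca * M * h ^ β + Cb * M * (h * (τ ^ 3) ^ (-s) * d ^ (ε - 1)) := by
        refine (norm_add_le _ _).trans (add_le_add ((norm_sub_le _ _).trans (add_le_add a1 a2)) (b.trans (le_of_eq (by ring))))
    _ ≤ 2 * Ca * M * h ^ β + 2 * Ca * M * h ^ β + Cb * M * h ^ β := by gcongr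
    _ = (4 * Ca + Cb) * M * h ^ β := by ring
    _ ≤ _ := by gcongr ?_ * _ * _; linarith

lemma hn_of_HolB {α : ℝ} {Ω : Set ℂ} {f : ℂ → ℂ} {M : ℝ} (h : HolB α Ω f M) (hM : 0 ≤ M) :
    holderNorm α Ω f ≤ ENNReal.ofReal (2 * M) := by
  rw [two_mul, ENNReal.ofReal_add hM hM]
  refine add_le_add (iSup_le fun x => ?_) (iSup_le fun p => ?_)
  · rw [← enorm_eq_nnnorm, ← ofReal_norm]
    exact ENNReal.ofReal_le_ofReal (h.1 x.1 x.2)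
  · refine ENNReal.ofReal_le_ofReal (div_le_of_le_mul₀ (by positivity) hM (h.2 _ p.1.2 _ p.2.2))

lemma HolB_of_hn {α : ℝ} (hα : 0 < α) {Ω : Set ℂ} {f : ℂ → ℂ} (h : holderNorm α Ω f ≠ ⊤) :
    HolB α Ω f (holderNorm α Ω f).toReal := by
  constructor
  · intro z hz
    rw [← ENNReal.ofReal_le_iff_le_toReal h, ofReal_norm, enorm_eq_nnnorm]
    refine le_trans ?_ le_self_add
    exact le_iSup (fun x : Ω => (‖f x.1‖₊ : ℝ≥0∞)) ⟨z, hz⟩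
  · intro z hz w hw
    by_cases hzw : z = w
    · subst hzw
      rw [sub_self, norm_zero]
      positivity
    · have hp : 0 < ‖z - w‖ ^ α := by
        have : 0 < ‖z - w‖ := norm_pos_iff.2 (sub_ne_zero.2 hzw)
        positivity
      rw [← div_le_iff₀ hp, ← ENNReal.ofReal_le_iff_le_toReal h]
      refine le_trans ?_ le_add_self
      exact le_iSup (fun p : Ω × Ω => ENNReal.ofReal (‖f p.1.1 - f p.2.1‖ / ‖p.1.1 - p.2.1‖ ^ α)) (⟨z, hz⟩, ⟨w, hw⟩)

lemma iter_HolB {ε Ω ρ L} (D : Dom ε Ω ρ L) {α : ℝ} (hα : 0 < α) (hα1 : α ≤ ε) (n : ℕ) :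
    ∃ C : ℝ, 0 ≤ C ∧ ∀ (M : ℝ) (f : ℂ → ℂ), 0 ≤ M → HolB α Ω f M → HolB α Ω ((BOm Ω)^[n] f) (C * M) := by
  induction n with
  | zero => exact ⟨1, zero_le_one, fun M f _ h => by simpa using h⟩
  | succ n ih =>
    obtain ⟨C, hC, H⟩ := ih
    obtain ⟨C1, hC1, H1⟩ := TA D (le_refl 1) hα hα1
    refine ⟨C1 * C, by positivity, fun M f hM h => ?_⟩
    rw [Function.iterate_succ_apply', BOm_eq, mul_assoc]
    exact H1 _ _ (by positivity) (H M f hM h)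

lemma K_HolB {ε Ω ρ L} (D : Dom ε Ω ρ L) {α : ℝ} (hα : 0 < α) (hα1 : α ≤ ε) {n : ℕ} (hn : 1 ≤ n) :
    ∃ C : ℝ, 0 ≤ C ∧ ∀ (M : ℝ) (f : ℂ → ℂ), 0 ≤ M → HolB α Ω f M → HolB α Ω (KnOp Ω n f) (C * M) := by
  obtain ⟨C, hC, H⟩ := iter_HolB D hα hα1 n
  obtain ⟨C1, hC1, H1⟩ := TA D hn hα hα1
  refine ⟨C + C1, by positivity, fun M f hM h => ?_⟩
  have a := (H M f hM h).add ((H1 M f hM h).smul (-1))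
  have : KnOp Ω n f = (BOm Ω)^[n] f + (-1 : ℂ) • TnOp Ω n f := by
    rw [KnOp]; ext z; simp [sub_eq_add_neg]
  rw [this]
  refine a.mono (le_of_eq ?_)
  simp; ring

lemma K_succ {ε Ω ρ L} (D : Dom ε Ω ρ L) {α : ℝ} (hα : 0 < α) (hα1 : α ≤ ε) {n : ℕ} (hn : 1 ≤ n) {f : ℂ → ℂ} {M : ℝ}
    (hM : 0 ≤ M) (h : HolB α Ω f M) {z : ℂ} (hz : z ∈ Ω) :
    KnOp Ω (n + 1) f z = TnOp Ω 1 (KnOp Ω n f) z + SOp Ω n f z := by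
  obtain ⟨C, hC, H⟩ := K_HolB D hα hα1 hn
  obtain ⟨C1, hC1, H1⟩ := TA D hn hα hα1
  have e : (BOm Ω)^[n] f = KnOp Ω n f + TnOp Ω n f := by rw [KnOp]; ring
  have := HolB.Tn_add hα (H M f hM h) (H1 M f hM h) D.op D.bdd (le_refl 1) hz
  rw [KnOp, Pi.sub_apply, Function.iterate_succ_apply', BOm_eq, e, this, SOp]
  ring

lemma K_reg {ε Ω ρ L} (D : Dom ε Ω ρ L) {α β : ℝ} (hα : 0 < α) (hα1 : α ≤ ε) (hβ : 0 < β) (hβε : β < ε)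
    {n : ℕ} (hn : 1 ≤ n) :
    ∃ C : ℝ, 0 ≤ C ∧ ∀ (M : ℝ) (f : ℂ → ℂ), 0 ≤ M → HolB α Ω f M → HolB β Ω (KnOp Ω n f) (C * M) := by
  induction n, hn using Nat.le_induction with
  | base =>
    refine ⟨0, le_rfl, fun M f hM h => ?_⟩
    have : KnOp Ω 1 f = 0 := by rw [KnOp, Function.iterate_one, BOm_eq, sub_self]
    rw [this]
    exact ⟨fun z _ => by simp, fun z _ w _ => by simp⟩
  | succ n hn ih =>
    obtain ⟨C, hC, H⟩ := ih
    obtain ⟨C1, hC1, H1⟩ := TA D (le_refl 1) hβ hβε.le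
    obtain ⟨C2, hC2, H2⟩ := TB D hα hα1 hβ hβε hn
    refine ⟨C1 * C + C2, by positivity, fun M f hM h => ?_⟩
    have a := (H1 _ _ (by positivity) (H M f hM h)).add (H2 M f hM h)
    have e : ∀ z ∈ Ω, KnOp Ω (n + 1) f z = TnOp Ω 1 (KnOp Ω n f) z + SOp Ω n f z := fun z hz =>
      K_succ D hα hα1 hn hM h hz
    have a' := a.mono (N := (C1 * C + C2) * M) (le_of_eq (by ring))
    refine ⟨fun z hz => ?_, fun z hz w hw => ?_⟩
    · rw [e z hz]; exact a'.1 z hz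
    · rw [e z hz, e w hw]; exact a'.2 z hz w hw

lemma iter_add {ε Ω ρ L} (D : Dom ε Ω ρ L) {α : ℝ} (hα : 0 < α) (hα1 : α ≤ ε) (n : ℕ) {f g : ℂ → ℂ} {M N : ℝ}
    (hM : 0 ≤ M) (hN : 0 ≤ N) (h : HolB α Ω f M) (h' : HolB α Ω g N) :
    ∀ z ∈ Ω, (BOm Ω)^[n] (f + g) z = (BOm Ω)^[n] f z + (BOm Ω)^[n] g z := by
  induction n with
  | zero => intro z _; rfl
  | succ n ih =>
    intro z hz
    obtain ⟨C, hC, H⟩ := iter_HolB D hα hα1 n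
    have := HolB.Tn_add hα (H M f hM h) (H N g hN h') D.op D.bdd (le_refl 1) hz
    simp only [Function.iterate_succ_apply', BOm_eq]
    rw [← this]
    exact congrFun (Tn_congr D.op.measurableSet (fun w hw => ih w hw)) z

lemma iter_smul {ε Ω ρ L} (D : Dom ε Ω ρ L) {α : ℝ} (hα : 0 < α) (hα1 : α ≤ ε) (n : ℕ) {f : ℂ → ℂ} {M : ℝ}
    (hM : 0 ≤ M) (h : HolB α Ω f M) (c : ℂ) :
    ∀ z ∈ Ω, (BOm Ω)^[n] (c • f) z = c * (BOm Ω)^[n] f z := by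
  induction n with
  | zero => intro z _; rfl
  | succ n ih =>
    intro z hz
    obtain ⟨C, hC, H⟩ := iter_HolB D hα hα1 n
    have := HolB.Tn_smul hα (H M f hM h) D.op D.bdd (le_refl 1) c hz
    simp only [Function.iterate_succ_apply', BOm_eq]
    rw [← this]
    exact congrFun (Tn_congr D.op.measurableSet (fun w hw => ih w hw)) z

/-- pointwise convergence on a countable dense set along a subsequence gives uniform Cauchy. -/
lemma AA {Ω : Set ℂ} (hb : Bornology.IsBounded Ω) {β C : ℝ} (hβ : 0 < β) (hC : 0 ≤ C) (u : ℕ → ℂ → ℂ)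
    (hu : ∀ k, HolB β Ω (u k) C) (hne : Ω.Nonempty) :
    ∃ φ : ℕ → ℕ, StrictMono φ ∧ ∀ η > 0, ∃ N : ℕ, ∀ j ≥ N, ∀ k ≥ N, ∀ z ∈ Ω, ‖u (φ j) z - u (φ k) z‖ ≤ η := by
  haveI : Nonempty Ω := hne.to_subtype
  obtain ⟨q, hq⟩ := TopologicalSpace.exists_dense_seq Ω
  have hcpt : IsCompact (Set.pi univ fun _ : ℕ => closedBall (0:ℂ) C) :=
    isCompact_univ_pi fun _ => isCompact_closedBall _ _
  obtain ⟨v, -, φ, hφ, hv⟩ := hcpt.tendsto_subseq (x := fun k i => u k (q i)) (fun k i _ => by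
    rw [mem_closedBall, dist_zero_right]; exact (hu k).1 _ (q i).2)
  refine ⟨φ, hφ, fun η hη => ?_⟩
  -- radius
  obtain ⟨r, hr, hrr⟩ : ∃ r : ℝ, 0 < r ∧ C * r ^ β ≤ η / 3 := by
    refine ⟨(η / 3 / (C + 1)) ^ (1 / β), by positivity, ?_⟩
    rw [← Real.rpow_mul (by positivity), one_div_mul_cancel hβ.ne', Real.rpow_one]
    rw [← mul_div_assoc, div_le_iff₀ (by positivity)]
    nlinarith
  have htb : TotallyBounded (univ : Set Ω) := by
    have : TotallyBounded Ω := hb.isCompact_closure.totallyBounded.subset subset_closure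
    have h2 := totallyBounded_preimage isUniformEmbedding_subtype_val.isUniformInducing this (f := ((↑) : Ω → ℂ))
    rwa [Subtype.coe_preimage_self] at h2
  obtain ⟨t, ht, hcov⟩ := totallyBounded_iff.1 htb (r / 2) (by positivity)
  have hch : ∀ y : Ω, ∃ i, dist y (q i) < r / 2 := fun y => by
    obtain ⟨i, hi⟩ := (hq.exists_dist_lt y (show 0 < r / 2 by positivity))
    exact ⟨i, hi⟩
  choose I hI using hch
  have hcau : ∀ y ∈ t, ∃ N : ℕ, ∀ j ≥ N, ∀ k ≥ N, ‖u (φ j) (q (I y)) - u (φ k) (q (I y))‖ ≤ η / 3 := fun y _ => by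
    have h1 := (tendsto_pi_nhds.1 hv (I y)).cauchySeq
    obtain ⟨N, hN⟩ := Metric.cauchySeq_iff.1 h1 (η / 3) (by positivity)
    refine ⟨N, fun j hj k hk => ?_⟩
    have := hN j hj k hk
    rw [dist_eq_norm] at this
    exact this.le
  choose! Nf hNf using hcau
  obtain ⟨N, hN⟩ := (ht.image Nf).bddAbove
  refine ⟨N, fun j hj k hk z hz => ?_⟩
  have hzc := hcov (mem_univ (⟨z, hz⟩ : Ω))
  simp only [mem_iUnion] at hzc
  obtain ⟨y, hy, hzy⟩ := hzc
  have hNy : Nf y ≤ N := hN (mem_image_of_mem Nf hy)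
  have hd : dist (⟨z, hz⟩ : Ω) (q (I y)) < r := by
    have := dist_triangle (⟨z, hz⟩ : Ω) y (q (I y))
    have h1 := hI y
    have h2 : dist (⟨z, hz⟩ : Ω) y < r / 2 := hzy
    linarith
  have hd' : ‖z - q (I y)‖ ≤ r := by
    rw [Subtype.dist_eq, dist_eq_norm] at hd; exact hd.le
  have hb' : ∀ k, ‖u k z - u k (q (I y))‖ ≤ η / 3 := fun k => by
    refine ((hu k).2 z hz _ (q (I y)).2).trans (le_trans ?_ hrr)
    gcongr
  have h1 := hb' (φ j)
  have h2 := hb' (φ k)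
  have h3 := hNf y hy j (hNy.trans hj) k (hNy.trans hk)
  have e : u (φ j) z - u (φ k) z = (u (φ j) z - u (φ j) (q (I y))) + (u (φ j) (q (I y)) - u (φ k) (q (I y)))
    - (u (φ k) z - u (φ k) (q (I y))) := by ring
  rw [e]
  refine (norm_sub_le _ _).trans ?_
  have := norm_add_le (u (φ j) z - u (φ j) (q (I y))) (u (φ j) (q (I y)) - u (φ k) (q (I y)))
  linarith

lemma interp {Ω : Set ℂ} {α β C : ℝ} (hα : 0 < α) (hαβ : α < β) (hC : 0 ≤ C) {θ : ℝ} (hθ : 0 < θ) :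
    ∃ η > 0, ∀ w : ℂ → ℂ, HolB β Ω w C → (∀ z ∈ Ω, ‖w z‖ ≤ η) → HolB α Ω w θ := by
  obtain ⟨r, hr, hrr⟩ : ∃ r : ℝ, 0 < r ∧ C * r ^ (β - α) ≤ θ := by
    have hba : 0 < β - α := by linarith
    refine ⟨(θ / (C + 1)) ^ (1 / (β - α)), by positivity, ?_⟩
    rw [← Real.rpow_mul (by positivity), one_div_mul_cancel hba.ne', Real.rpow_one]
    rw [← mul_div_assoc, div_le_iff₀ (by positivity)]
    nlinarith
  refine ⟨min θ (θ * r ^ α / 2), by positivity, fun w hw hb => ⟨fun z hz => (hb z hz).trans (min_le_left _ _), ?_⟩⟩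
  intro z hz y hy
  rcases eq_or_lt_of_le (norm_nonneg (z - y)) with h0 | h0
  · have : z = y := by rwa [eq_comm, norm_eq_zero, sub_eq_zero] at h0
    rw [this, sub_self, norm_zero]; positivity
  by_cases hzy : ‖z - y‖ ≤ r
  · refine (hw.2 z hz y hy).trans ?_
    calc C * ‖z - y‖ ^ β = C * ‖z - y‖ ^ (β - α) * ‖z - y‖ ^ α := by
          rw [mul_assoc, ← Real.rpow_add h0]; ring_nf
      _ ≤ C * r ^ (β - α) * ‖z - y‖ ^ α := by
        have : 0 ≤ β - α := by linarith
        gcongr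
      _ ≤ _ := by gcongr
  · push Not at hzy
    have a := (hb z hz).trans (min_le_right _ _)
    have b := (hb y hy).trans (min_le_right _ _)
    calc _ ≤ θ * r ^ α / 2 + θ * r ^ α / 2 := (norm_sub_le _ _).trans (add_le_add a b)
      _ = θ * r ^ α := by ring
      _ ≤ _ := by gcongr

lemma cpt {Ω : Set ℂ} (hb : Bornology.IsBounded Ω) {α β C : ℝ} (hα : 0 < α) (hαβ : α < β) (hC : 0 ≤ C) (u : ℕ → ℂ → ℂ)
    (hu : ∀ k, HolB β Ω (u k) C) (hne : Ω.Nonempty) :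
    ∃ φ : ℕ → ℕ, StrictMono φ ∧ ∃ h : ℂ → ℂ, Tendsto (fun j => holderNorm α Ω (u (φ j) - h)) atTop (𝓝 0) := by
  obtain ⟨φ, hφ, H⟩ := AA hb (hα.trans hαβ) hC u hu hne
  refine ⟨φ, hφ, ?_⟩
  have hlim : ∀ z, ∃ l, z ∈ Ω → Tendsto (fun j => u (φ j) z) atTop (𝓝 l) := fun z => by
    by_cases hz : z ∈ Ω
    · have : CauchySeq fun j => u (φ j) z := Metric.cauchySeq_iff.2 fun η hη => by
        obtain ⟨N, hN⟩ := H (η / 2) (by positivity)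
        refine ⟨N, fun j hj k hk => ?_⟩
        rw [dist_eq_norm]
        have := hN j hj k hk z hz
        linarith
      obtain ⟨l, hl⟩ := cauchySeq_tendsto_of_complete this
      exact ⟨l, fun _ => hl⟩
    · exact ⟨0, fun h => absurd h hz⟩
  choose h hh using hlim
  refine ⟨h, ?_⟩
  have hhol : HolB β Ω h C := by
    refine ⟨fun z hz => ?_, fun z hz w hw => ?_⟩
    · exact le_of_tendsto' (hh z hz).norm fun j => (hu _).1 z hz
    · exact le_of_tendsto' ((hh z hz).sub (hh w hw)).norm fun j => (hu _).2 z hz w hw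
  have hdiff : ∀ j, HolB β Ω (u (φ j) - h) (C + C) := fun j => by
    have := (hu (φ j)).add (hhol.smul (-1))
    have e : u (φ j) - h = u (φ j) + (-1 : ℂ) • h := by ext z; simp [sub_eq_add_neg]
    rw [e]
    exact this.mono (le_of_eq (by simp))
  rw [ENNReal.tendsto_nhds_zero]
  intro θ hθ
  obtain ⟨θ', h1, h2⟩ : ∃ θ' : ℝ, 0 < θ' ∧ ENNReal.ofReal (2 * θ') ≤ θ := by
    by_cases ht : θ = ⊤
    · exact ⟨1, one_pos, by rw [ht]; exact le_top⟩
    · have : 0 < θ.toReal := ENNReal.toReal_pos hθ.ne' ht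
      refine ⟨θ.toReal / 2, by positivity, ?_⟩
      rw [mul_div_cancel₀ _ two_ne_zero, ENNReal.ofReal_toReal ht]
  obtain ⟨η, hη, Hη⟩ := interp (Ω := Ω) hα hαβ (by positivity : 0 ≤ C + C) h1
  obtain ⟨N, hN⟩ := H η hη
  filter_upwards [eventually_ge_atTop N] with j hj
  refine (hn_of_HolB (Hη _ (hdiff j) fun z hz => ?_) h1.le).trans h2
  have hl : Tendsto (fun k => ‖u (φ j) z - u (φ k) z‖) atTop (𝓝 ‖u (φ j) z - h z‖) :=
    (tendsto_const_nhds.sub (hh z hz)).norm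
  refine le_of_tendsto hl ?_
  filter_upwards [eventually_ge_atTop N] with k hk
  exact hN j hj k hk z hz

/-- For a bounded `C^{1+ε}` domain `Ω ⊆ ℂ`, `0 < ε' < ε` and `n ≥ 1`:
for `g ∈ Lip(ε',Ω)` the principal values defining `B_Ω(g)` and `T_n(g)` exist on `Ω` and
`B_Ω(g) ∈ Lip(ε',Ω)`; moreover the operator `K_n = B_Ω^n − T_n` is linear on `Ω`, bounded on
`Lip(ε',Ω)`, and compact from `Lip(ε',Ω)` into itself. -/
theorem statement14 (ε ε' : ℝ) (hε0 : 0 < ε) (hε1 : ε < 1) (hε'0 : 0 < ε') (hε'ε : ε' < ε)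
    (n : ℕ) (hn : 1 ≤ n)
    (Ω : Set ℂ) (hΩo : IsOpen Ω) (hΩc : IsConnected Ω)
    (hΩb : Bornology.IsBounded Ω) (hΩ : HasC1HolderBoundaryC ε Ω) :
    -- the principal value defining `B_Ω(g)` exists on `Ω` and `B_Ω(g) ∈ Lip(ε',Ω)`
    (∀ g : ℂ → ℂ, holderNorm ε' Ω g ≠ ⊤ →
      (∀ z ∈ Ω, Tendsto (beurlingTrunc Ω g z) (𝓝[>] 0) (𝓝 (BOm Ω g z))) ∧
      holderNorm ε' Ω (BOm Ω g) ≠ ⊤) ∧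
    -- the principal value defining `T_n(g)` exists on `Ω`
    (∀ g : ℂ → ℂ, holderNorm ε' Ω g ≠ ⊤ →
      ∀ z ∈ Ω, Tendsto (bnTrunc Ω n g z) (𝓝[>] 0) (𝓝 (TnOp Ω n g z))) ∧
    -- `K_n` is linear (on `Ω`, on Lipschitz functions)
    (∀ g₁ g₂ : ℂ → ℂ, holderNorm ε' Ω g₁ ≠ ⊤ → holderNorm ε' Ω g₂ ≠ ⊤ →
      ∀ z ∈ Ω, KnOp Ω n (g₁ + g₂) z = KnOp Ω n g₁ z + KnOp Ω n g₂ z) ∧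
    (∀ c : ℂ, ∀ g : ℂ → ℂ, holderNorm ε' Ω g ≠ ⊤ →
      ∀ z ∈ Ω, KnOp Ω n (c • g) z = c * KnOp Ω n g z) ∧
    -- `K_n` is bounded on `Lip(ε',Ω)`
    (∃ M : ℝ≥0, ∀ g : ℂ → ℂ, holderNorm ε' Ω g ≠ ⊤ →
      holderNorm ε' Ω (KnOp Ω n g) ≤ ↑M * holderNorm ε' Ω g) ∧
    -- `K_n` is compact from `Lip(ε',Ω)` into itself
    (∀ g : ℕ → ℂ → ℂ, (∀ k, holderNorm ε' Ω (g k) ≤ 1) →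
      ∃ φ : ℕ → ℕ, StrictMono φ ∧
        ∃ h : ℂ → ℂ,
          Tendsto (fun j => holderNorm ε' Ω (KnOp Ω n (g (φ j)) - h)) atTop (𝓝 0)) := by
  obtain ⟨ρ, L, D⟩ := exists_Dom hε0 hε1 hΩo hΩb hΩ
  obtain ⟨C1, hC1, H1⟩ := TA D (le_refl 1) hε'0 hε'ε.le
  obtain ⟨CK, hCK, HK⟩ := K_HolB D hε'0 hε'ε.le hn
  obtain ⟨C2, hC2, H2⟩ := K_reg D (α := ε') (β := (ε' + ε) / 2) hε'0 hε'ε.le (by linarith) (by linarith) hn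
  refine ⟨fun g hg => ⟨fun z hz => ?_, ?_⟩, fun g hg z hz => ?_, fun g₁ g₂ h₁ h₂ z hz => ?_, fun c g hg z hz => ?_, ?_, ?_⟩
  · rw [beurlingTrunc_eq, BOm_eq]
    exact (HolB_of_hn hε'0 hg).Tn_tendsto hε'0 hΩo hΩb (le_refl 1) hz
  · rw [BOm_eq]
    exact ne_top_of_le_ne_top ENNReal.ofReal_ne_top
      (hn_of_HolB (H1 _ _ ENNReal.toReal_nonneg (HolB_of_hn hε'0 hg)) (by positivity))
  · exact (HolB_of_hn hε'0 hg).Tn_tendsto hε'0 hΩo hΩb hn hz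
  · have k1 := HolB_of_hn hε'0 h₁
    have k2 := HolB_of_hn hε'0 h₂
    have a := iter_add D hε'0 hε'ε.le n ENNReal.toReal_nonneg ENNReal.toReal_nonneg k1 k2 z hz
    have b := HolB.Tn_add hε'0 k1 k2 hΩo hΩb hn hz
    simp only [KnOp, Pi.sub_apply]
    rw [a, b]; ring
  · have k1 := HolB_of_hn hε'0 hg
    have a := iter_smul D hε'0 hε'ε.le n ENNReal.toReal_nonneg k1 c z hz
    have b := HolB.Tn_smul hε'0 k1 hΩo hΩb hn c hz
    simp only [KnOp, Pi.sub_apply]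
    rw [a, b]; ring
  · refine ⟨(2 * CK).toNNReal, fun g hg => ?_⟩
    refine (hn_of_HolB (HK _ _ ENNReal.toReal_nonneg (HolB_of_hn hε'0 hg)) (by positivity)).trans ?_
    rw [← mul_assoc, ENNReal.ofReal_mul (by positivity), ENNReal.ofReal_toReal hg]
    rfl
  · intro g hg
    refine cpt hΩb hε'0 (β := (ε' + ε) / 2) (by linarith) (C := C2 * 1) (by positivity) (fun k => KnOp Ω n (g k))
      (fun k => ?_) hΩc.nonempty
    have hfin : holderNorm ε' Ω (g k) ≠ ⊤ := ne_top_of_le_ne_top ENNReal.one_ne_top (hg k)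
    refine H2 1 (g k) zero_le_one ((HolB_of_hn hε'0 hfin).mono ?_)
    exact ENNReal.toReal_le_of_le_ofReal zero_le_one (by rw [ENNReal.ofReal_one]; exact hg k)

end
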